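/- Let p be a prime with p ≥ 5 and k an even integer, and let K = Q(√-1). If f ∈ M_k^{(s)}(U_2(O_K), ν_k)_{Z_(p)} satisfies a_f([[m, α],[ᾱ, n]]) ≡ 0 (mod p) for all integers m, n and all α ∈ D_K^{-1} with 0 ≤ m ≤ (5k+8)/40, 0 ≤ n ≤ (15k+4)/120 and mn − N(α) ≥ 0 (where N is the norm), then a_f(H) ≡ 0 (mod p) for every semi-positive definite H ∈ Λ_2(K), i.e. f ≡ 0 (mod p). -/

import Mathlib

open Complex Matrix
open scoped ComplexOrder

noncomputable section

/-- `√d_K` for an imaginary quadratic discriminant `d < 0`,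
taken as `√|d| · i` in the upper half plane. -/
def sqrtD (d : ℤ) : ℂ := Real.sqrt (-d) * Complex.I

/-- The ring of integers `O_K = ℤ[(d + √d)/2]` of the imaginary quadratic field of
discriminant `d`, viewed as a subset of `ℂ`. -/
def ringInt (d : ℤ) : Set ℂ :=
  {z | ∃ a b : ℤ, z = (a : ℂ) + (b : ℂ) * (((d : ℂ) + sqrtD d) / 2)}

/-- The inverse different `D_K⁻¹ = O_K / √d_K`. -/
def invDiff (d : ℤ) : Set ℂ := {z | sqrtD d * z ∈ ringInt d}

/-- The Hermitian upper half-space of degree 2: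
`Z` with `(Z - ᵗZ̄)/(2i)` positive definite. -/
def HermitianUpperHalfSpace : Set (Matrix (Fin 2) (Fin 2) ℂ) :=
  {Z | ((Z - Zᴴ).map (fun w => w / (2 * Complex.I))).PosDef}

/-- The lattice `Λ₂(K)`: Hermitian matrices with integral diagonal and
`√d_K ·`(off-diagonal entries) in `O_K`. -/
def LambdaH (d : ℤ) : Set (Matrix (Fin 2) (Fin 2) ℂ) :=
  {H | H.IsHermitian ∧ (∀ i, ∃ n : ℤ, H i i = (n : ℂ)) ∧
    ∀ i j, sqrtD d * H i j ∈ ringInt d}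

/-- Semi-positive elements of `Λ₂(K)`, the index set of Fourier expansions. -/
def HermLattice (d : ℤ) : Set (Matrix (Fin 2) (Fin 2) ℂ) :=
  {H | H ∈ LambdaH d ∧ H.PosSemidef}

/-- The symplectic-form matrix `J₂ = [[0, -1], [1, 0]]` (2×2 blocks). -/
def J2 : Matrix (Fin 2 ⊕ Fin 2) (Fin 2 ⊕ Fin 2) ℂ :=
  Matrix.fromBlocks 0 (-1) 1 0

/-- The Hermitian modular group `U₂(O_K)`:
matrices with entries in `O_K` satisfying `ᵗM̄ J₂ M = J₂`. -/
def HermitianModularGroup (d : ℤ) : Set (Matrix (Fin 2 ⊕ Fin 2) (Fin 2 ⊕ Fin 2) ℂ) :=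
  {M | (∀ i j, M i j ∈ ringInt d) ∧ Mᴴ * J2 * M = J2}

/-- The fractional-linear action `Z ↦ (AZ + B)(CZ + D)⁻¹`. -/
def matAct (M : Matrix (Fin 2 ⊕ Fin 2) (Fin 2 ⊕ Fin 2) ℂ)
    (Z : Matrix (Fin 2) (Fin 2) ℂ) : Matrix (Fin 2) (Fin 2) ℂ :=
  (M.toBlocks₁₁ * Z + M.toBlocks₁₂) * (M.toBlocks₂₁ * Z + M.toBlocks₂₂)⁻¹

/-- The character `ν_k`: `det^{k/2}` for `K = ℚ(√-1)` (i.e. `d = -4`, `k` even),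
and `det^k` for `K = ℚ(√-3)` (i.e. `d = -3`). -/
def nuChar (d k : ℤ) (M : Matrix (Fin 2 ⊕ Fin 2) (Fin 2 ⊕ Fin 2) ℂ) : ℂ :=
  if d = -4 then M.det ^ (k / 2) else M.det ^ k

/-- A Hermitian modular form of degree 2, weight `k` and character `ν_k` for `U₂(O_K)`,
bundled with its Fourier expansion over the semi-positive part of `Λ₂(K)`. -/
structure HermitianModularForm (d k : ℤ) where
  toFun : Matrix (Fin 2) (Fin 2) ℂ → ℂ
  coeff : Matrix (Fin 2) (Fin 2) ℂ → ℂ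
  holo : DifferentiableOn ℂ (fun Z : Fin 2 → Fin 2 → ℂ => toFun (Matrix.of Z))
    {Z | Matrix.of Z ∈ HermitianUpperHalfSpace}
  transform : ∀ M ∈ HermitianModularGroup d, ∀ Z ∈ HermitianUpperHalfSpace,
    toFun (matAct M Z) =
      nuChar d k M * (M.toBlocks₂₁ * Z + M.toBlocks₂₂).det ^ k * toFun Z
  coeff_supported : ∀ H, coeff H ≠ 0 → H ∈ HermLattice d
  expansion : ∀ Z ∈ HermitianUpperHalfSpace,
    HasSum (fun H : HermLattice d =>
      coeff H * Complex.exp (2 * Real.pi * Complex.I * ((H : Matrix (Fin 2) (Fin 2) ℂ) * Z).trace))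
      (toFun Z)

/-- A Hermitian modular form is symmetric if `f(ᵗZ) = f(Z)`. -/
def IsSymmetricHMF {d k : ℤ} (f : HermitianModularForm d k) : Prop :=
  ∀ Z ∈ HermitianUpperHalfSpace, f.toFun Zᵀ = f.toFun Z

/-- `z` is a `p`-integral rational number: `z = a/b` with `p ∤ b`. -/
def IsPIntegral (p : ℕ) (z : ℂ) : Prop :=
  ∃ a b : ℤ, ¬ (p : ℤ) ∣ b ∧ (b : ℂ) * z = (a : ℂ)

/-- `z ≡ w (mod p^l)` in the local ring `ℤ_(p)`, i.e. `(z - w)/p^l` is `p`-integral. -/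
def ModCongr (p l : ℕ) (z w : ℂ) : Prop :=
  IsPIntegral p ((z - w) / (p : ℂ) ^ l)


/-- The lexicographic order on `Λ₂(K)` used to define `ord_p`:
compare first `tr H`, then the `(1,1)`-entry `m`, then (for off-diagonal entry
`(a + b i)/2`) first `a`, then `b`. -/
def lexLt (H H' : Matrix (Fin 2) (Fin 2) ℂ) : Prop :=
  H.trace.re < H'.trace.re ∨
    (H.trace = H'.trace ∧
      ((H 0 0).re < (H' 0 0).re ∨
        (H 0 0 = H' 0 0 ∧
          ((H 0 1).re < (H' 0 1).re ∨
            ((H 0 1).re = (H' 0 1).re ∧ (H 0 1).im < (H' 0 1).im)))))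

/-- The Siegel upper half-space of degree `n`: symmetric complex matrices with
positive definite imaginary part. -/
def SiegelUpperHalfSpace (n : ℕ) : Set (Matrix (Fin n) (Fin n) ℂ) :=
  {Z | Z.IsSymm ∧ ((Z - Zᴴ).map (fun w => w / (2 * Complex.I))).PosDef}

/-- The symplectic-form matrix over `ℤ` in degree `n`. -/
def Jn (n : ℕ) : Matrix (Fin n ⊕ Fin n) (Fin n ⊕ Fin n) ℤ :=
  Matrix.fromBlocks 0 (-1) 1 0

/-- The Siegel modular group `Γ_n = Sp_n(ℤ)` (as a set of `2n × 2n` integer matrices). -/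
def SiegelModularGroup (n : ℕ) : Set (Matrix (Fin n ⊕ Fin n) (Fin n ⊕ Fin n) ℤ) :=
  {M | Mᵀ * Jn n * M = Jn n}

/-- The fractional-linear action of an integral symplectic matrix on the Siegel
upper half-space. -/
def matActS {n : ℕ} (M : Matrix (Fin n ⊕ Fin n) (Fin n ⊕ Fin n) ℤ)
    (Z : Matrix (Fin n) (Fin n) ℂ) : Matrix (Fin n) (Fin n) ℂ :=
  ((M.map (fun a => (a : ℂ))).toBlocks₁₁ * Z + (M.map (fun a => (a : ℂ))).toBlocks₁₂) *
    ((M.map (fun a => (a : ℂ))).toBlocks₂₁ * Z + (M.map (fun a => (a : ℂ))).toBlocks₂₂)⁻¹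

/-- The index lattice of Fourier expansions of Siegel modular forms of level `N`:
semi-positive symmetric rational matrices `T` with `N·T` half-integral,
i.e. `T ∈ (1/N)Λ_n`. -/
def SiegelLattice (n : ℕ) (N : ℕ) : Set (Matrix (Fin n) (Fin n) ℚ) :=
  {T | T.IsSymm ∧ (∀ i, ∃ a : ℤ, (N : ℚ) * T i i = (a : ℚ)) ∧
    (∀ i j, ∃ a : ℤ, 2 * (N : ℚ) * T i j = (a : ℚ)) ∧
    (T.map (fun q => (q : ℝ))).PosSemidef}

/-- A Siegel modular form of degree `n` and weight `k` for a subgroup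
`Γ ⊆ Γ_n = Sp_n(ℤ)` of level `N`, bundled with its Fourier expansion. For the
full modular group take `Γ = SiegelModularGroup n` and `N = 1`. -/
structure SiegelModularForm (n : ℕ) (k : ℤ)
    (Γ : Set (Matrix (Fin n ⊕ Fin n) (Fin n ⊕ Fin n) ℤ)) (N : ℕ) where
  toFun : Matrix (Fin n) (Fin n) ℂ → ℂ
  coeff : Matrix (Fin n) (Fin n) ℚ → ℂ
  holo : DifferentiableOn ℂ (fun Z : Fin n → Fin n → ℂ => toFun (Matrix.of Z))
    {Z | Matrix.of Z ∈ SiegelUpperHalfSpace n}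
  transform : ∀ M ∈ Γ, ∀ Z ∈ SiegelUpperHalfSpace n,
    toFun (matActS M Z) =
      ((M.map (fun a => (a : ℂ))).toBlocks₂₁ * Z +
        (M.map (fun a => (a : ℂ))).toBlocks₂₂).det ^ k * toFun Z
  coeff_supported : ∀ T, coeff T ≠ 0 → T ∈ SiegelLattice n N
  expansion : ∀ Z ∈ SiegelUpperHalfSpace n,
    HasSum (fun T : SiegelLattice n N =>
      coeff T * Complex.exp (2 * Real.pi * Complex.I *
        (((T : Matrix (Fin n) (Fin n) ℚ).map (fun q => (q : ℂ))) * Z).trace))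
      (toFun Z)


/-- A Hermitian cusp form (degree 2, class number one field): the Fourier
coefficients vanish off the positive definite part of the lattice. -/
def IsCuspHMF {d k : ℤ} (f : HermitianModularForm d k) : Prop :=
  ∀ H, ¬ H.PosDef → f.coeff H = 0

/-- `H0 = ord_p f`: `H0` is the minimal element of `Λ₂(K)`, in the lexicographic
order `lexLt`, whose Fourier coefficient is not divisible by `p`. -/
def IsOrdP (p : ℕ) {d k : ℤ} (f : HermitianModularForm d k)
    (H0 : Matrix (Fin 2) (Fin 2) ℂ) : Prop :=
  H0 ∈ HermLattice d ∧ ¬ ModCongr p 1 (f.coeff H0) 0 ∧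
    ∀ H ∈ HermLattice d, lexLt H H0 → ModCongr p 1 (f.coeff H) 0

namespace HermitianSturm

open UpperHalfPlane hiding I
open ModularForm MatrixGroups PowerSeries

section Sturm

/-- Power series all of whose coefficients lie in the subring `O`. -/
def coeffSubring {R : Type*} [CommRing R] (O : Subring R) : Subring (PowerSeries R) :=
  (PowerSeries.map O.subtype).range

lemma mem_coeffSubring {R : Type*} [CommRing R] {O : Subring R} {P : PowerSeries R} :
    P ∈ coeffSubring O ↔ ∀ n, coeff n P ∈ O := by
  constructor
  · rintro ⟨Q, rfl⟩ n
    simp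
  · intro h
    exact ⟨PowerSeries.mk fun n => ⟨coeff n P, h n⟩, by ext n; simp⟩

/-- Division by a series with vanishing constant coefficient and linear coefficient `1`
preserves membership of initial coefficients in a submodule. -/
lemma coeff_mem_of_coeff_mul_mem {O : Subring ℂ} (J : Submodule O ℂ) {D h : PowerSeries ℂ}
    (hD : ∀ n, coeff n D ∈ O) (h0 : coeff 0 D = 0) (h1 : coeff 1 D = 1) (N : ℕ)
    (hJ : ∀ n < N, coeff (n + 1) (D * h) ∈ J) : ∀ n < N, coeff n h ∈ J := by
  intro n
  induction n using Nat.strong_induction_on with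
  | _ n ih =>
    intro hn
    have key := hJ n hn
    rw [PowerSeries.coeff_mul, Finset.Nat.antidiagonal_succ, Finset.sum_cons] at key
    simp only [h0, zero_mul, zero_add, Finset.sum_map, Function.Embedding.prodMap,
      Function.Embedding.coeFn_mk, Prod.map] at key
    rw [← Finset.Nat.sum_antidiagonal_swap] at key
    rw [Finset.Nat.sum_antidiagonal_eq_sum_range_succ_mk, Finset.sum_range_succ] at key
    have hlast : coeff (n - n).succ D * coeff n h = coeff n h := by simp [h1]
    simp only [Prod.swap, Function.Embedding.coe_refl, id] at key
    change _ + coeff (n - n).succ D * coeff n h ∈ J at key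
    rw [hlast] at key
    refine (Submodule.add_mem_iff_right J (J.sum_mem fun i hi => ?_)).mp key
    have hi' : i < n := by simpa using hi
    exact J.smul_mem (⟨_, hD (n - i).succ⟩ : O) (ih i hi' (hi'.trans hn))

lemma E₄_coeff_mem (O : Subring ℂ) (n : ℕ) : coeff n (qExpansion 1 E₄) ∈ O := by
  rw [EisensteinSeries.E_qExpansion_coeff _ ⟨2, rfl⟩]
  split_ifs with h
  · exact one_mem _
  · have : (-(2 * (4 : ℕ) / (bernoulli 4 : ℚ)) : ℂ) = ((240 : ℕ) : ℂ) := by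
      norm_num [show bernoulli 4 = -1 / 30 by decide +kernel]
    rw [this]
    exact mul_mem (natCast_mem _ _) (natCast_mem _ _)

lemma E₆_coeff_mem (O : Subring ℂ) (n : ℕ) : coeff n (qExpansion 1 E₆) ∈ O := by
  rw [EisensteinSeries.E_qExpansion_coeff _ ⟨3, rfl⟩]
  split_ifs with h
  · exact one_mem _
  · have : (-(2 * (6 : ℕ) / (bernoulli 6 : ℚ)) : ℂ) = ((-504 : ℤ) : ℂ) := by
      norm_num [show bernoulli 6 = 1 / 42 by decide +kernel]
    rw [this]
    exact mul_mem (intCast_mem _ _) (natCast_mem _ _)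

/-- In every even weight `w ≥ 0`, `w ≠ 2`, there is a form with constant term `1` and integral
coefficients. -/
lemma exists_monic_form (O : Subring ℂ) {w : ℤ} (hw : 0 ≤ w) (hev : Even w) (h2 : w ≠ 2) :
    ∃ E : ModularForm 𝒮ℒ w, (∀ n, coeff n (qExpansion 1 E) ∈ O) ∧
      coeff 0 (qExpansion 1 E) = 1 := by
  obtain ⟨a, b, hab⟩ : ∃ a b : ℕ, (a : ℤ) * 4 + b * 6 = w := by
    obtain ⟨c, rfl⟩ := hev
    rcases Int.even_or_odd c with ⟨e, he⟩ | ⟨e, he⟩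
    · exact ⟨e.toNat, 0, by omega⟩
    · exact ⟨(e - 1).toNat, 1, by omega⟩
  refine ⟨ModularForm.mcast (by linarith) ((E₄.pow a).mul (E₆.pow b)), ?_⟩
  have hq : qExpansion 1 (ModularForm.mcast (Γ' := 𝒮ℒ) (b := w) (by linarith)
      ((E₄.pow a).mul (E₆.pow b))) = qExpansion 1 E₄ ^ a * qExpansion 1 E₆ ^ b := by
    rw [ModularForm.qExpansion_mcast,
      ModularForm.qExpansion_mul one_pos one_mem_strictPeriods_SL,
      ModularForm.qExpansion_pow one_pos one_mem_strictPeriods_SL,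
      ModularForm.qExpansion_pow one_pos one_mem_strictPeriods_SL]
  rw [hq]
  constructor
  · rw [← mem_coeffSubring]
    exact mul_mem (pow_mem (mem_coeffSubring.2 (E₄_coeff_mem O)) _)
      (pow_mem (mem_coeffSubring.2 (E₆_coeff_mem O)) _)
  · rw [coeff_zero_eq_constantCoeff_apply, map_mul, map_pow, map_pow]
    simp only [← coeff_zero_eq_constantCoeff_apply]
    rw [EisensteinSeries.E_qExpansion_coeff_zero _ ⟨2, rfl⟩,
      EisensteinSeries.E_qExpansion_coeff_zero _ ⟨3, rfl⟩]
    simp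

/-- **Sturm's theorem** in level one, with coefficients in a subring `O` and congruences modulo
an `O`-submodule `J`. -/
theorem sturm_levelOne_congruence (O : Subring ℂ) (J : Submodule O ℂ)
    (hΔ : ∀ n, coeff n (qExpansion 1 ModularForm.discriminant) ∈ O) (N : ℕ) :
    ∀ {w : ℤ} (g : ModularForm 𝒮ℒ w), (∀ n, coeff n (qExpansion 1 g) ∈ O) → w < 12 * N →
      (∀ n < N, coeff n (qExpansion 1 g) ∈ J) → ∀ n, coeff n (qExpansion 1 g) ∈ J := by
  have hD0 : coeff 0 (qExpansion 1 ModularForm.discriminant) = 0 := by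
    simpa using CuspFormClass.qExpansion_coeff_zero CuspForm.discriminant one_pos
      one_mem_strictPeriods_SL
  have hD1 := ModularForm.discriminant_qExpansion_coeff_one
  induction N with
  | zero =>
    intro w g _ hw _ n
    have : g = 0 := DFunLike.coe_injective
      (ModularFormClass.levelOne_neg_weight_eq_zero (by simpa using hw) g)
    simp [this, qExpansion_zero]
  | succ N ih =>
    intro w g hO hw hJ n
    by_cases hz : g = 0
    · simp [hz, qExpansion_zero]
    have hw0 : 0 ≤ w := by
      by_contra! h
      exact hz (DFunLike.coe_injective (ModularFormClass.levelOne_neg_weight_eq_zero h g))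
    have hev : Even w := by
      by_contra h
      exact hz (ModularForm.levelOne_odd_weight_eq_zero (Int.not_even_iff_odd.1 h) g)
    have hw2 : w ≠ 2 := by
      rintro rfl
      exact hz (rank_zero_iff_forall_zero.mp ModularForm.levelOne_weight_two_rank_zero g)
    obtain ⟨E, hEO, hE1⟩ := exists_monic_form O hw0 hev hw2
    set c := coeff 0 (qExpansion 1 g) with hc
    have hcJ : c ∈ J := hJ 0 N.succ_pos
    have hcO : c ∈ O := hO 0
    let gE : ModularForm 𝒮ℒ w := g - c • E
    have hq : qExpansion 1 gE = qExpansion 1 g - c • qExpansion 1 E := by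
      have h1 := ModularForm.qExpansion_sub one_pos one_mem_strictPeriods_SL g (c • E)
      have h2 := ModularForm.qExpansion_smul one_pos one_mem_strictPeriods_SL c E
      calc _ = _ := h1
        _ = _ := by rw [← h2]; rfl
    have hcoeff : ∀ n, coeff n (qExpansion 1 gE) =
        coeff n (qExpansion 1 g) - c * coeff n (qExpansion 1 E) := by
      intro n
      rw [hq]; simp
    have hEJ : ∀ n, c * coeff n (qExpansion 1 E) ∈ J := fun n => by
      rw [mul_comm]; exact J.smul_mem (⟨_, hEO n⟩ : O) hcJ
    have hcusp : coeff 0 (qExpansion 1 gE) = 0 := by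
      rw [hcoeff, hE1, ← hc]; simp
    have hfac := ModularForm.qExpansion_eq_qExpansion_discriminant_mul gE hcusp
    set h := CuspForm.discriminantEquiv (toCuspForm gE hcusp) with hh
    have hhO : ∀ n, coeff n (qExpansion 1 h) ∈ O := by
      intro n
      let J' : Submodule O ℂ := Submodule.span O {1}
      have memJ' : ∀ z, z ∈ J' ↔ z ∈ O := fun z => by
        rw [Submodule.mem_span_singleton]
        exact ⟨fun ⟨a, ha⟩ => by rw [← ha]; exact mul_mem a.2 (one_mem _),
          fun hz => ⟨⟨z, hz⟩, mul_one z⟩⟩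
      rw [← memJ']
      refine coeff_mem_of_coeff_mul_mem J' hΔ hD0 hD1 (n + 1) (fun m _ => ?_) n n.lt_succ_self
      rw [← hfac, memJ', hcoeff]
      exact sub_mem (hO _) (mul_mem hcO (hEO _))
    have hhJ : ∀ n, coeff n (qExpansion 1 h) ∈ J := by
      refine ih h hhO (by push_cast at hw; linarith) ?_
      refine coeff_mem_of_coeff_mul_mem J hΔ hD0 hD1 N (fun m hm => ?_)
      rw [← hfac, hcoeff]
      exact J.sub_mem (hJ _ (by omega)) (hEJ _)
    have : coeff n (qExpansion 1 g) =
        coeff n (qExpansion 1 gE) + c * coeff n (qExpansion 1 E) := by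
      rw [hcoeff]; ring
    rw [this, hfac, PowerSeries.coeff_mul]
    exact J.add_mem (J.sum_mem fun x _ => J.smul_mem (⟨_, hΔ _⟩ : O) (hhJ _)) (hEJ _)

end Sturm

section Convergent

open scoped NNReal

lemma hasFPowerSeriesOnBall_of_hasSum {r : ℝ≥0} (hr : 0 < r) {a : ℕ → ℂ} {F : ℂ → ℂ}
    (ha : ∀ z : ℂ, ‖z‖ < r → HasSum (fun n => a n * z ^ n) (F z)) :
    HasFPowerSeriesOnBall F (.ofScalars ℂ a) 0 r where
  r_le := by
    refine le_of_forall_lt_imp_le_of_dense fun s hs => ?_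
    lift s to ℝ≥0 using hs.ne_top
    apply FormalMultilinearSeries.le_radius_of_summable
    have hs' : ‖((s : ℝ) : ℂ)‖ < r := by simpa using hs
    simpa [mul_comm] using (ha _ hs').summable.norm
  r_pos := by simpa using hr
  hasSum := by
    intro y hy
    rw [Metric.eball_coe, mem_ball_zero_iff] at hy
    simpa [mul_comm] using ha y hy

/-- Uniqueness of power series expansions. -/
lemma coeff_unique_of_hasSum {r : ℝ≥0} (hr : 0 < r) {a b : ℕ → ℂ} {F : ℂ → ℂ}
    (ha : ∀ z : ℂ, ‖z‖ < r → HasSum (fun n => a n * z ^ n) (F z))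
    (hb : ∀ z : ℂ, ‖z‖ < r → HasSum (fun n => b n * z ^ n) (F z)) : a = b := by
  have h := (hasFPowerSeriesOnBall_of_hasSum hr ha).hasFPowerSeriesAt.eq_formalMultilinearSeries
    (hasFPowerSeriesOnBall_of_hasSum hr hb).hasFPowerSeriesAt
  funext n
  simpa using congr_arg (FormalMultilinearSeries.coeff · n) h

/-- Power series converging absolutely on the open unit disc. -/
def convSubring : Subring (PowerSeries ℂ) where
  carrier := {P | ∀ q : ℂ, ‖q‖ < 1 → Summable fun n => ‖coeff n P * q ^ n‖}
  zero_mem' := by intro q _; simp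
  one_mem' := by
    intro q _
    refine summable_of_ne_finset_zero (s := {0}) fun n hn => ?_
    simp [PowerSeries.coeff_one, show n ≠ 0 by simpa using hn]
  add_mem' := by
    intro P Q hP hQ q hq
    refine Summable.of_nonneg_of_le (fun _ => norm_nonneg _) (fun n => ?_) ((hP q hq).add (hQ q hq))
    rw [map_add, add_mul]
    exact norm_add_le _ _
  neg_mem' := by
    intro P hP q hq
    simpa using hP q hq
  mul_mem' := by
    intro P Q hP hQ q hq
    refine (summable_norm_sum_mul_antidiagonal_of_summable_norm (hP q hq) (hQ q hq)).congr
      fun n => congrArg norm ?_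
    symm
    rw [PowerSeries.coeff_mul, Finset.sum_mul]
    refine Finset.sum_congr rfl fun x hx => ?_
    rw [← Finset.HasAntidiagonal.mem_antidiagonal.1 hx, pow_add]
    ring

lemma mem_convSubring {P : PowerSeries ℂ} :
    P ∈ convSubring ↔ ∀ q : ℂ, ‖q‖ < 1 → Summable fun n => ‖coeff n P * q ^ n‖ := Iff.rfl

/-- Evaluation of a convergent power series at a point of the unit disc. -/
def evalDisc (q : ℂ) (hq : ‖q‖ < 1) : convSubring →+* ℂ where
  toFun P := ∑' n, coeff n P.1 * q ^ n
  map_zero' := by simp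
  map_one' := by
    rw [tsum_eq_single 0]
    · simp
    · intro n hn
      simp [PowerSeries.coeff_one, hn]
  map_add' P Q := by
    rw [← Summable.tsum_add (P.2 q hq).of_norm (Q.2 q hq).of_norm]
    simp [add_mul]
  map_mul' P Q := by
    rw [tsum_mul_tsum_eq_tsum_sum_antidiagonal_of_summable_norm (P.2 q hq) (Q.2 q hq)]
    refine tsum_congr fun n => ?_
    rw [Subring.coe_mul, PowerSeries.coeff_mul, Finset.sum_mul]
    refine Finset.sum_congr rfl fun x hx => ?_
    rw [← Finset.HasAntidiagonal.mem_antidiagonal.1 hx, pow_add]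
    ring

lemma hasSum_evalDisc (P : convSubring) (q : ℂ) (hq : ‖q‖ < 1) :
    HasSum (fun n => coeff n P.1 * q ^ n) (evalDisc q hq P) :=
  (P.2 q hq).of_norm.hasSum

lemma convSubring_ext {P Q : convSubring} (h : ∀ q hq, evalDisc q hq P = evalDisc q hq Q) :
    P = Q := by
  have := coeff_unique_of_hasSum (r := 1) one_pos (a := fun n => coeff n P.1)
    (b := fun n => coeff n Q.1) (F := fun q => ∑' n, coeff n P.1 * q ^ n)
    (fun q hq => hasSum_evalDisc P q (by simpa using hq))
    (fun q hq => by
      have hq' : ‖q‖ < 1 := by simpa using hq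
      have := hasSum_evalDisc Q q hq'
      rw [← h q hq'] at this
      exact this)
  exact Subtype.ext (PowerSeries.ext fun n => congr_fun this n)

lemma differentiableOn_tsum_convSubring (P : convSubring) :
    DifferentiableOn ℂ (fun q => ∑' n, coeff n P.1 * q ^ n) (Metric.ball 0 1) := by
  have := (hasFPowerSeriesOnBall_of_hasSum (r := 1) one_pos (a := fun n => coeff n P.1)
    (F := fun q => ∑' n, coeff n P.1 * q ^ n)
    (fun q hq => hasSum_evalDisc P q (by simpa using hq))).differentiableOn
  rwa [Metric.eball_coe] at this

/-- A convergent series without zeros in the disc is invertible. -/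
lemma isUnit_convSubring (P : convSubring) (h : ∀ q hq, evalDisc q hq P ≠ 0) : IsUnit P := by
  set F : ℂ → ℂ := fun q => (∑' n, coeff n P.1 * q ^ n)⁻¹ with hF
  have hdiff : DifferentiableOn ℂ F (Metric.ball 0 1) :=
    (differentiableOn_tsum_convSubring P).inv fun q hq => h q (by simpa using hq)
  set Q : PowerSeries ℂ := PowerSeries.mk fun n => (n.factorial : ℂ)⁻¹ * iteratedDeriv n F 0
  have hsum : ∀ q : ℂ, ‖q‖ < 1 → HasSum (fun n => coeff n Q * q ^ n) (F q) := by
    intro q hq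
    have := Complex.hasSum_taylorSeries_on_ball (r := 1) hdiff (z := q) (by simpa using hq)
    have heq : (fun n => coeff n Q * q ^ n) = fun n : ℕ =>
        (n.factorial : ℂ)⁻¹ • (q - 0) ^ n • iteratedDeriv n F 0 := by
      funext n
      simp only [Q, coeff_mk, smul_eq_mul, sub_zero]
      ring
    rw [heq]
    exact this
  have hQ : Q ∈ convSubring := fun q hq => (hsum q hq).summable.norm
  refine IsUnit.of_mul_eq_one ⟨Q, hQ⟩ (convSubring_ext fun q hq => ?_)
  rw [map_mul, map_one, (hasSum_evalDisc ⟨Q, hQ⟩ q hq).unique (hsum q hq)]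
  exact mul_inv_cancel₀ (h q hq)

/-- The nome lies in the open unit disc. -/
lemma norm_qParam_lt (τ : ℍ) : ‖Function.Periodic.qParam 1 τ‖ < 1 :=
  Function.Periodic.norm_qParam_lt_one one_pos τ.im_pos

/-- Evaluation at the nome of a point of the upper half-plane. -/
def evalUHP (τ : ℍ) : convSubring →+* ℂ := evalDisc _ (norm_qParam_lt τ)

lemma hasSum_evalUHP (P : convSubring) (τ : ℍ) :
    HasSum (fun n => coeff n P.1 * Function.Periodic.qParam 1 τ ^ n) (evalUHP τ P) :=
  hasSum_evalDisc P _ _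

/-- A convergent `q`-series with the transformation law under `S` is the `q`-expansion of a
modular form. -/
theorem exists_modularForm_of_S_law (P : convSubring) {w : ℤ}
    (hS : ∀ τ : ℍ, evalUHP (ModularGroup.S • τ) P = (τ : ℂ) ^ w * evalUHP τ P) :
    ∃ g : ModularForm 𝒮ℒ w, qExpansion 1 g = P.1 ∧ ∀ τ, g τ = evalUHP τ P := by
  set F : ℍ → ℂ := fun τ => evalUHP τ P with hF
  have hSl : F ∣[w] ModularGroup.S = F := by
    ext τ
    rw [SlashInvariantForm.slash_S_apply]
    have : F (UpperHalfPlane.mk (-τ : ℂ)⁻¹ τ.im_inv_neg_coe_pos) = F (ModularGroup.S • τ) := by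
      rw [UpperHalfPlane.modular_S_smul]
    rw [this, hF]
    simp only
    rw [hS, mul_comm, ← mul_assoc, ← zpow_add₀ (UpperHalfPlane.ne_zero τ)]
    simp
  have hTl : F ∣[w] ModularGroup.T = F := by
    ext τ
    have hden : denom (SpecialLinearGroup.toGL
        ((SpecialLinearGroup.map (Int.castRingHom ℝ)) ModularGroup.T)) (τ : ℂ) = 1 := by
      change ((((ModularGroup.T 1 0 : ℤ) : ℝ) : ℂ) * τ + (((ModularGroup.T 1 1 : ℤ) : ℝ) : ℂ)) = 1
      simp [ModularGroup.T]
    simp only [SL_slash_apply, modular_T_smul, hF]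
    rw [hden, _root_.one_zpow, mul_one]
    refine (hasSum_evalUHP P _).unique ?_
    have : Function.Periodic.qParam 1 (((1 : ℝ) +ᵥ τ : ℍ) : ℂ) = Function.Periodic.qParam 1 τ := by
      rw [UpperHalfPlane.coe_vadd, Function.Periodic.qParam, Function.Periodic.qParam,
        Complex.exp_eq_exp_iff_exists_int]
      exact ⟨1, by push_cast; ring⟩
    rw [this]
    exact hasSum_evalUHP P τ
  have hinv := SlashInvariantForm.slash_action_generators_SL2Z hSl hTl
  have hsum : ∀ τ : ℍ, HasSum (fun m => coeff m P.1 • Function.Periodic.qParam 1 τ ^ m) (F τ) :=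
    fun τ => by simpa using hasSum_evalUHP P τ
  let g : ModularForm 𝒮ℒ w :=
    { toFun := F
      slash_action_eq' := by
        rintro A ⟨A, rfl⟩
        exact hinv A
      holo' := by
        rw [UpperHalfPlane.mdifferentiable_iff]
        refine DifferentiableOn.congr (f := (fun q => ∑' n, coeff n P.1 * q ^ n) ∘
          Function.Periodic.qParam 1) ?_ fun z hz => ?_
        · refine (differentiableOn_tsum_convSubring P).comp
            (Function.Periodic.differentiable_qParam).differentiableOn fun z hz => ?_
          simpa using Function.Periodic.norm_qParam_lt_one one_pos hz
        · simp only [Function.comp, hF]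
          rw [ofComplex_apply_of_im_pos hz]
          rfl
      bdd_at_cusps' := by
        intro c hc
        rw [Subgroup.IsArithmetic.isCusp_iff_isCusp_SL2Z] at hc
        rw [OnePoint.isBoundedAt_iff_forall_SL2Z hc]
        intro γ _
        rw [hinv γ]
        exact isBoundedAtImInfty_of_hasSum_qExpansion one_pos hsum }
  refine ⟨g, PowerSeries.ext fun n => ?_, fun _ => rfl⟩
  exact (ModularFormClass.qExpansion_coeff_unique (f := g) one_pos one_mem_strictPeriods_SL
    hsum n).symm

end Convergent

section Entire

/-- The power series `P` represents the entire function `F`. -/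
def Represents (F : ℂ → ℂ) (P : PowerSeries ℂ) : Prop :=
  ∀ z, HasSum (fun n => coeff n P * z ^ n) (F z)

lemma Represents.unique {F : ℂ → ℂ} {P Q : PowerSeries ℂ} (hP : Represents F P)
    (hQ : Represents F Q) : P = Q :=
  PowerSeries.ext fun n => congr_fun (coeff_unique_of_hasSum (r := 1) one_pos
    (a := fun n => coeff n P) (b := fun n => coeff n Q) (fun z _ => hP z) (fun z _ => hQ z)) n

lemma Represents.mul {F G : ℂ → ℂ} {P Q : PowerSeries ℂ} (hP : Represents F P)
    (hQ : Represents G Q) : Represents (fun z => F z * G z) (P * Q) := by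
  intro z
  have h1 := (hP z).summable.norm
  have h2 := (hQ z).summable.norm
  have h := (summable_norm_sum_mul_antidiagonal_of_summable_norm h1 h2).of_norm.hasSum
  rw [← tsum_mul_tsum_eq_tsum_sum_antidiagonal_of_summable_norm h1 h2, (hP z).tsum_eq,
    (hQ z).tsum_eq] at h
  refine h.congr_fun ?_
  intro n
  rw [PowerSeries.coeff_mul, Finset.sum_mul]
  refine Finset.sum_congr rfl fun x hx => ?_
  rw [← Finset.HasAntidiagonal.mem_antidiagonal.1 hx, pow_add]
  ring

lemma Represents.rescale {F : ℂ → ℂ} {P : PowerSeries ℂ} (hP : Represents F P) (c : ℂ) :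
    Represents (fun z => F (c * z)) (PowerSeries.rescale c P) := by
  intro z
  simpa [PowerSeries.coeff_rescale, mul_pow, mul_assoc, mul_comm, mul_left_comm] using hP (c * z)

lemma represents_C (c : ℂ) : Represents (fun _ => c) (PowerSeries.C c) := by
  intro z
  convert hasSum_ite_eq (0 : ℕ) c using 2 with n
  rw [PowerSeries.coeff_C]
  split_ifs with h <;> simp [h]

/-- The Taylor series of `exp (γ z ^ 2)`. -/
def gaussSeries (γ : ℂ) : PowerSeries ℂ :=
  PowerSeries.mk fun n => if Even n then γ ^ (n / 2) / (n / 2).factorial else 0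

lemma represents_gaussSeries (γ : ℂ) :
    Represents (fun z => Complex.exp (γ * z ^ 2)) (gaussSeries γ) := by
  intro z
  have h := NormedSpace.expSeries_div_hasSum_exp (𝔸 := ℂ) (γ * z ^ 2)
  rw [← Complex.exp_eq_exp_ℂ] at h
  have hinj : Function.Injective fun n : ℕ => 2 * n := fun a b h => by simpa using h
  rw [← hinj.hasSum_iff]
  · refine h.congr_fun ?_
    intro n
    simp [gaussSeries, mul_pow, pow_mul]
    ring
  · intro n hn
    have : ¬ Even n := fun ⟨m, hm⟩ => hn ⟨m, by simp; omega⟩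
    simp [gaussSeries, this]

lemma gaussSeries_mul (γ δ : ℂ) : gaussSeries γ * gaussSeries δ = gaussSeries (γ + δ) :=
  ((represents_gaussSeries γ).mul (represents_gaussSeries δ)).unique (by
    simpa [add_mul, Complex.exp_add] using represents_gaussSeries (γ + δ))

lemma rescale_gaussSeries (c γ : ℂ) :
    PowerSeries.rescale c (gaussSeries γ) = gaussSeries (γ * c ^ 2) :=
  ((represents_gaussSeries γ).rescale c).unique (by
    have h : (fun z => Complex.exp (γ * c ^ 2 * z ^ 2)) =
        fun z => Complex.exp (γ * (c * z) ^ 2) := by funext z; ring_nf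
    exact h ▸ represents_gaussSeries (γ * c ^ 2))

lemma gaussSeries_zero : gaussSeries 0 = 1 :=
  (represents_gaussSeries 0).unique (by simpa using represents_C 1)

lemma gaussSeries_pow (γ : ℂ) (n : ℕ) : gaussSeries γ ^ n = gaussSeries (n * γ) := by
  induction n with
  | zero => simp [gaussSeries_zero]
  | succ n ih => rw [pow_succ, ih, gaussSeries_mul]; push_cast; ring_nf

end Entire

section TriangularSeries

variable {R : Type*} [CommRing R]

/-- Triangular numbers. -/
def tri (n : ℕ) : ℕ := n * (n + 1) / 2

lemma tri_succ (n : ℕ) : tri (n + 1) = tri n + (n + 1) := by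
  unfold tri
  rw [show (n + 1) * (n + 1 + 1) = n * (n + 1) + (n + 1) * 2 by ring,
    Nat.add_mul_div_right _ _ two_pos]

lemma tri_strictMono : StrictMono tri :=
  strictMono_nat_of_lt_succ fun n => by rw [tri_succ]; omega

lemma le_tri (n : ℕ) : n ≤ tri n := tri_strictMono.le_apply

lemma two_mul_tri (n : ℕ) : 2 * tri n = n * (n + 1) := by
  induction n with
  | zero => rfl
  | succ n ih => rw [tri_succ, mul_add, ih]; ring

/-- The series `∑ F n * q ^ (n (n + 1) / 2)`. -/
def triSeries (F : ℕ → R) : PowerSeries R :=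
  PowerSeries.mk fun N => ∑ n ∈ Finset.range (N + 1), if tri n = N then F n else 0

lemma coeff_triSeries_tri (F : ℕ → R) (n : ℕ) : coeff (tri n) (triSeries F) = F n := by
  rw [triSeries, coeff_mk, Finset.sum_eq_single n]
  · simp
  · intro m _ hm
    simp [tri_strictMono.injective.ne hm]
  · intro h
    exact absurd (Finset.mem_range.2 (Nat.lt_succ_of_le (le_tri n))) h

lemma coeff_triSeries_of_notMem (F : ℕ → R) {N : ℕ} (h : N ∉ Set.range tri) :
    coeff N (triSeries F) = 0 := by
  rw [triSeries, coeff_mk]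
  exact Finset.sum_eq_zero fun n _ => if_neg fun hn => h ⟨n, hn⟩

lemma coeff_triSeries_zero (F : ℕ → R) : coeff 0 (triSeries F) = F 0 :=
  coeff_triSeries_tri F 0

lemma triSeries_ext {F : ℕ → R} {P : PowerSeries R} (h1 : ∀ n, coeff (tri n) P = F n)
    (h2 : ∀ N, N ∉ Set.range tri → coeff N P = 0) : P = triSeries F := by
  ext N
  by_cases hN : N ∈ Set.range tri
  · obtain ⟨n, rfl⟩ := hN
    rw [h1, coeff_triSeries_tri]
  · rw [h2 N hN, coeff_triSeries_of_notMem F hN]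

lemma map_triSeries {R' : Type*} [CommRing R'] (f : R →+* R') (F : ℕ → R) :
    PowerSeries.map f (triSeries F) = triSeries fun n => f (F n) :=
  triSeries_ext (fun n => by rw [coeff_map, coeff_triSeries_tri])
    fun N hN => by rw [coeff_map, coeff_triSeries_of_notMem F hN, map_zero]

lemma C_mul_triSeries (a : R) (F : ℕ → R) :
    PowerSeries.C a * triSeries F = triSeries fun n => a * F n :=
  triSeries_ext (fun n => by rw [coeff_C_mul, coeff_triSeries_tri])
    fun N hN => by rw [coeff_C_mul, coeff_triSeries_of_notMem F hN, mul_zero]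

lemma triSeries_mem_convSubring {F : ℕ → ℂ}
    (hF : ∀ q : ℂ, ‖q‖ < 1 → Summable fun n => ‖F n * q ^ tri n‖) :
    triSeries F ∈ convSubring := by
  intro q hq
  rw [← tri_strictMono.injective.summable_iff]
  · refine (hF q hq).congr fun n => ?_
    simp [coeff_triSeries_tri]
  · intro N hN
    simp [coeff_triSeries_of_notMem F hN]

lemma hasSum_triSeries {F : ℕ → ℂ} (hF : triSeries F ∈ convSubring) (q : ℂ) (hq : ‖q‖ < 1) :
    HasSum (fun n => F n * q ^ tri n) (evalDisc q hq ⟨_, hF⟩) := by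
  have h := hasSum_evalDisc ⟨_, hF⟩ q hq
  rw [← tri_strictMono.injective.hasSum_iff] at h
  · refine h.congr_fun ?_
    intro n
    simp [coeff_triSeries_tri]
  · intro N hN
    simp [coeff_triSeries_of_notMem F hN]

end TriangularSeries

section Theta

lemma summable_pow_tri_mul_exp {r : ℝ} (h0 : 0 ≤ r) (h1 : r < 1) (x : ℝ) :
    Summable fun n : ℕ => r ^ tri n * Real.exp ((n + 1 / 2) * x) := by
  wlog hr : 0 < r generalizing r
  · refine Summable.of_nonneg_of_le (fun n => by positivity) (fun n => ?_)
      (this (r := 1 / 2) (by norm_num) (by norm_num) (by norm_num))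
    gcongr
    linarith
  refine summable_of_ratio_test_tendsto_lt_one (l := 0) one_pos
    (Filter.Eventually.of_forall fun n => by positivity) ?_
  have : ∀ n : ℕ, ‖r ^ tri (n + 1) * Real.exp (((n + 1 : ℕ) + 1 / 2) * x)‖ /
      ‖r ^ tri n * Real.exp ((n + 1 / 2) * x)‖ = r ^ (n + 1) * Real.exp x := by
    intro n
    rw [Real.norm_of_nonneg (by positivity), Real.norm_of_nonneg (by positivity),
      div_eq_iff (by positivity), tri_succ, pow_add]
    have : Real.exp (((n + 1 : ℕ) + 1 / 2) * x) =
        Real.exp x * Real.exp ((n + 1 / 2) * x) := by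
      rw [← Real.exp_add]; push_cast; ring_nf
    rw [this]; ring
  simp_rw [this]
  have := ((tendsto_pow_atTop_nhds_zero_of_lt_one h0 h1).comp
    (Filter.tendsto_add_atTop_nat 1)).mul_const (Real.exp x)
  simpa using this

/-- The coefficient of `q ^ tri n * Z ^ j` in the theta series
`∑ (-1) ^ n q ^ tri n (exp ((n + 1/2) Z) - exp (-(n + 1/2) Z))`. -/
def thetaCoeff (j n : ℕ) : ℂ :=
  (-1) ^ n * (((n : ℂ) + 1 / 2) ^ j - (-((n : ℂ) + 1 / 2)) ^ j) / j.factorial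

lemma thetaCoeff_zero (n : ℕ) : thetaCoeff 0 n = 0 := by simp [thetaCoeff]

lemma thetaCoeff_one (n : ℕ) : thetaCoeff 1 n = (((-1) ^ n * (2 * n + 1) : ℤ) : ℂ) := by
  simp [thetaCoeff]; ring

lemma norm_thetaCoeff_le (j n : ℕ) :
    ‖thetaCoeff j n‖ ≤ 2 * (((n : ℝ) + 1 / 2) ^ j / j.factorial) := by
  have hb : ‖((n : ℂ) + 1 / 2)‖ = (n : ℝ) + 1 / 2 := by
    have : ((n : ℂ) + 1 / 2) = (((n : ℝ) + 1 / 2 : ℝ) : ℂ) := by push_cast; ring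
    rw [this, Complex.norm_real, Real.norm_of_nonneg (by positivity)]
  rw [thetaCoeff, norm_div, norm_mul, norm_pow, norm_neg, norm_one, one_pow, one_mul,
    Complex.norm_natCast, ← mul_div_assoc]
  gcongr
  refine (norm_sub_le _ _).trans ?_
  rw [norm_pow, norm_pow, norm_neg, hb]
  linarith

lemma summable_theta_prod (q : ℂ) (hq : ‖q‖ < 1) (z : ℂ) :
    Summable fun x : ℕ × ℕ => thetaCoeff x.2 x.1 * q ^ tri x.1 * z ^ x.2 := by
  have hexp : ∀ n : ℕ, HasSum (fun j : ℕ => 2 * ‖q‖ ^ tri n *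
      ((((n : ℝ) + 1 / 2) * ‖z‖) ^ j / j.factorial))
      (2 * ‖q‖ ^ tri n * Real.exp (((n : ℝ) + 1 / 2) * ‖z‖)) := by
    intro n
    have := NormedSpace.expSeries_div_hasSum_exp (𝔸 := ℝ) (((n : ℝ) + 1 / 2) * ‖z‖)
    rw [← Real.exp_eq_exp_ℝ] at this
    exact this.mul_left _
  have hs : Summable fun x : ℕ × ℕ => 2 * ‖q‖ ^ tri x.1 *
      ((((x.1 : ℝ) + 1 / 2) * ‖z‖) ^ x.2 / x.2.factorial) := by
    rw [summable_prod_of_nonneg (fun x => by positivity)]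
    refine ⟨fun n => (hexp n).summable, ?_⟩
    simp_rw [fun n => (hexp n).tsum_eq, mul_assoc]
    exact (summable_pow_tri_mul_exp (norm_nonneg q) hq ‖z‖).mul_left 2
  refine Summable.of_norm_bounded hs fun x => ?_
  rw [norm_mul, norm_mul, norm_pow, norm_pow]
  calc _ ≤ 2 * (((x.1 : ℝ) + 1 / 2) ^ x.2 / x.2.factorial) * ‖q‖ ^ tri x.1 * ‖z‖ ^ x.2 := by
        gcongr
        exact norm_thetaCoeff_le _ _
    _ = _ := by rw [mul_pow]; ring

lemma triSeries_thetaCoeff_mem (j : ℕ) : triSeries (thetaCoeff j) ∈ convSubring := by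
  refine triSeries_mem_convSubring fun q hq => ?_
  have := ((summable_theta_prod q hq 1).norm.prod_symm).prod_factor j
  simpa using this

/-- The terms of the theta function in exponential form. -/
def thetaTerm (q z : ℂ) (n : ℕ) : ℂ :=
  (-1) ^ n * q ^ tri n *
    (Complex.exp (((n : ℂ) + 1 / 2) * z) - Complex.exp (-(((n : ℂ) + 1 / 2) * z)))

lemma hasSum_thetaCoeff_right (q z : ℂ) (n : ℕ) :
    HasSum (fun j => thetaCoeff j n * q ^ tri n * z ^ j) (thetaTerm q z n) := by
  have h1 := NormedSpace.expSeries_div_hasSum_exp (𝔸 := ℂ) (((n : ℂ) + 1 / 2) * z)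
  have h2 := NormedSpace.expSeries_div_hasSum_exp (𝔸 := ℂ) (-(((n : ℂ) + 1 / 2) * z))
  rw [← Complex.exp_eq_exp_ℂ] at h1 h2
  refine ((h1.sub h2).mul_left ((-1) ^ n * q ^ tri n)).congr_fun fun j => ?_
  rw [thetaCoeff, ← neg_mul, mul_pow, mul_pow]
  ring

/-- The theta function as a function of the elliptic variable. -/
def thetaFun (q z : ℂ) : ℂ := ∑' n, thetaTerm q z n

lemma hasSum_thetaFun (q : ℂ) (hq : ‖q‖ < 1) (z : ℂ) :
    HasSum (fun j => evalDisc q hq ⟨_, triSeries_thetaCoeff_mem j⟩ * z ^ j) (thetaFun q z) := by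
  have hs := summable_theta_prod q hq z
  have h1 := hs.hasSum.prod_fiberwise (fun n => hasSum_thetaCoeff_right q z n)
  rw [thetaFun, h1.tsum_eq]
  have hs' := hs.prod_symm
  have h2 := hs'.hasSum.prod_fiberwise (g := fun j =>
    evalDisc q hq ⟨_, triSeries_thetaCoeff_mem j⟩ * z ^ j)
    (fun j => (hasSum_triSeries (triSeries_thetaCoeff_mem j) q hq).mul_right (z ^ j))
  have h3 : ∑' x : ℕ × ℕ, thetaCoeff x.swap.2 x.swap.1 * q ^ tri x.swap.1 * z ^ x.swap.2 =
      ∑' x : ℕ × ℕ, thetaCoeff x.2 x.1 * q ^ tri x.1 * z ^ x.2 :=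
    (Equiv.prodComm ℕ ℕ).tsum_eq fun x : ℕ × ℕ => thetaCoeff x.2 x.1 * q ^ tri x.1 * z ^ x.2
  rwa [h3] at h2

/-- The theta series divided by the elliptic variable, as a Taylor series whose coefficients are
convergent `q`-series. -/
def thetaH : PowerSeries convSubring :=
  PowerSeries.mk fun i => ⟨triSeries (thetaCoeff (i + 1)), triSeries_thetaCoeff_mem (i + 1)⟩

/-- The specialisation of `thetaH` at a point of the upper half-plane. -/
def thetaHAt (τ : ℍ) : PowerSeries ℂ := PowerSeries.map (evalUHP τ) thetaH

lemma represents_thetaFun (τ : ℍ) :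
    Represents (thetaFun (Function.Periodic.qParam 1 τ)) (PowerSeries.X * thetaHAt τ) := by
  intro z
  refine (hasSum_thetaFun _ (norm_qParam_lt τ) z).congr_fun fun j => ?_
  congr 1
  rcases j with _ | j
  · rw [PowerSeries.coeff_zero_X_mul]
    have : (⟨triSeries (thetaCoeff 0), triSeries_thetaCoeff_mem 0⟩ : convSubring) = 0 := by
      ext n
      simp only [triSeries, coeff_mk, thetaCoeff_zero]
      simp
    rw [this, map_zero]
  · rw [PowerSeries.coeff_succ_X_mul, thetaHAt, PowerSeries.coeff_map, thetaH, coeff_mk]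
    rfl

lemma thetaFun_eq_jacobiTheta₂ (τ : ℍ) (z : ℂ) :
    thetaFun (Function.Periodic.qParam 1 τ) (2 * Real.pi * I * z) =
      Complex.exp (Real.pi * I * z) * jacobiTheta₂ (z + 1 / 2 + τ / 2) τ := by
  have h := ((hasSum_jacobiTheta₂_term (z + 1 / 2 + τ / 2) τ.im_pos).mul_left
    (Complex.exp (Real.pi * I * z))).nat_add_neg_add_one
  rw [← h.tsum_eq, thetaFun]
  refine tsum_congr fun n => ?_
  have htri : (tri n : ℂ) = n * (n + 1) / 2 := by
    have := two_mul_tri n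
    field_simp
    rw [mul_comm]
    exact_mod_cast this
  have hm1 : ((-1 : ℂ)) ^ n = Complex.exp (n * (Real.pi * I)) := by
    rw [Complex.exp_nat_mul, Complex.exp_pi_mul_I]
  have hm2 : ((-1 : ℂ)) ^ n = -Complex.exp (-(n + 1 : ℂ) * (Real.pi * I)) := by
    rw [show (-(n + 1 : ℂ) * (Real.pi * I)) = -(((n + 1 : ℕ) : ℂ) * (Real.pi * I)) by
      push_cast; ring, Complex.exp_neg, Complex.exp_nat_mul, Complex.exp_pi_mul_I]
    rcases Nat.even_or_odd n with h | h <;> simp [h.neg_one_pow, pow_succ]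
  have hq : Function.Periodic.qParam 1 τ ^ tri n =
      Complex.exp (Real.pi * I * (n * (n + 1)) * τ) := by
    rw [Function.Periodic.qParam, ← Complex.exp_nat_mul, htri]
    congr 1; push_cast; field_simp
  rw [thetaTerm, mul_sub, hq]
  nth_rewrite 2 [hm2]
  rw [hm1, neg_mul, neg_mul, sub_neg_eq_add]
  simp only [jacobiTheta₂_term, ← Complex.exp_add]
  congr 2
  · push_cast; ring
  · push_cast; ring

/-- The automorphy factor of the theta function. -/
def thetaMu (τ : ℍ) : ℂ :=
  (-I * τ) ^ (1 / 2 : ℂ) * Complex.exp (Real.pi * I * (τ - 1) ^ 2 / (4 * τ))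

lemma coe_S_smul (τ : ℍ) : ((ModularGroup.S • τ : ℍ) : ℂ) = -1 / τ := by
  rw [UpperHalfPlane.modular_S_smul]
  simp [neg_div, inv_neg]

lemma thetaFun_S (τ : ℍ) (z : ℂ) :
    thetaFun (Function.Periodic.qParam 1 (ModularGroup.S • τ : ℍ)) (2 * Real.pi * I * (z / τ)) =
      thetaMu τ * Complex.exp (Real.pi * I * z ^ 2 / τ) *
        thetaFun (Function.Periodic.qParam 1 τ) (2 * Real.pi * I * z) := by
  have hτ : (τ : ℂ) ≠ 0 := UpperHalfPlane.ne_zero τ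
  rw [thetaFun_eq_jacobiTheta₂, thetaFun_eq_jacobiTheta₂, coe_S_smul]
  have hfe := jacobiTheta₂_functional_equation (z + τ / 2 - 1 / 2) τ
  have hper := jacobiTheta₂_add_left (z + τ / 2 - 1 / 2) τ
  rw [show (z + τ / 2 - 1 / 2 + 1 : ℂ) = z + 1 / 2 + τ / 2 by ring] at hper
  rw [hper, hfe]
  rw [show ((z + τ / 2 - 1 / 2) / τ : ℂ) = z / τ + 1 / 2 + -1 / τ / 2 by field_simp; ring]
  have hroot : (-I * τ : ℂ) ^ (1 / 2 : ℂ) ≠ 0 := by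
    rw [Complex.cpow_ne_zero_iff_of_exponent_ne_zero (by norm_num)]
    simp [hτ]
  have hexp : Complex.exp (Real.pi * I * (z / τ)) =
      Complex.exp (Real.pi * I * (τ - 1) ^ 2 / (4 * τ)) * Complex.exp (Real.pi * I * z ^ 2 / τ) *
        Complex.exp (Real.pi * I * z) *
        Complex.exp (-Real.pi * I * (z + τ / 2 - 1 / 2) ^ 2 / τ) := by
    simp only [← Complex.exp_add]
    congr 1
    field_simp
    ring
  rw [hexp, thetaMu]
  field_simp

lemma thetaMu_pow_eight (τ : ℍ) :
    thetaMu τ ^ 8 * Function.Periodic.qParam 1 (ModularGroup.S • τ : ℍ) =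
      (τ : ℂ) ^ 4 * Function.Periodic.qParam 1 τ := by
  have hτ : (τ : ℂ) ≠ 0 := UpperHalfPlane.ne_zero τ
  have hroot : ((-I * τ : ℂ) ^ (1 / 2 : ℂ)) ^ 8 = (τ : ℂ) ^ 4 := by
    rw [← Complex.cpow_nat_mul]
    norm_num
    rw [mul_pow, I_pow_four, one_mul]
  rw [thetaMu, mul_pow, hroot, mul_assoc, ← Complex.exp_nat_mul, Function.Periodic.qParam,
    Function.Periodic.qParam, ← Complex.exp_add, coe_S_smul]
  congr 1
  rw [Complex.exp_eq_exp_iff_exists_int]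
  refine ⟨-2, ?_⟩
  push_cast
  field_simp
  ring

/-- The transformation law of `thetaHAt` under `S`. -/
lemma rescale_thetaHAt_S (τ : ℍ) :
    PowerSeries.rescale ((τ : ℂ)⁻¹) (thetaHAt (ModularGroup.S • τ)) =
      PowerSeries.C (thetaMu τ * τ) * (gaussSeries (-I / (4 * Real.pi * τ)) * thetaHAt τ) := by
  have hτ : (τ : ℂ) ≠ 0 := UpperHalfPlane.ne_zero τ
  have hpi : (Real.pi : ℂ) ≠ 0 := by exact_mod_cast Real.pi_ne_zero
  have h1 := (represents_thetaFun (ModularGroup.S • τ)).rescale (τ : ℂ)⁻¹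
  have h2 := (represents_C (thetaMu τ)).mul
    ((represents_gaussSeries (-I / (4 * Real.pi * τ))).mul (represents_thetaFun τ))
  have h3 : (fun z => thetaFun (Function.Periodic.qParam 1 (ModularGroup.S • τ : ℍ)) ((τ : ℂ)⁻¹ * z))
      = fun z => thetaMu τ * (Complex.exp (-I / (4 * Real.pi * τ) * z ^ 2) *
        thetaFun (Function.Periodic.qParam 1 τ) z) := by
    funext z
    have h := thetaFun_S τ (z / (2 * Real.pi * I))
    rw [show (2 * Real.pi * I * (z / (2 * Real.pi * I) / τ) : ℂ) = (τ : ℂ)⁻¹ * z by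
        field_simp,
      show (2 * Real.pi * I * (z / (2 * Real.pi * I)) : ℂ) = z by field_simp] at h
    rw [h, mul_assoc]
    congr 3
    field_simp
    rw [I_sq]
    ring
  rw [h3] at h1
  have h4 := h1.unique h2
  rw [map_mul, PowerSeries.rescale_X] at h4
  have hX : PowerSeries.X * (PowerSeries.C (τ : ℂ)⁻¹ *
      PowerSeries.rescale ((τ : ℂ)⁻¹) (thetaHAt (ModularGroup.S • τ))) =
      PowerSeries.X * (PowerSeries.C (thetaMu τ) *
        (gaussSeries (-I / (4 * Real.pi * τ)) * thetaHAt τ)) := by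
    linear_combination h4
  have h5 := mul_left_cancel₀ PowerSeries.X_ne_zero hX
  rw [map_mul, mul_comm (PowerSeries.C (thetaMu τ)), mul_assoc, ← h5, ← mul_assoc, ← map_mul,
    mul_inv_cancel₀ hτ, map_one, one_mul]

end Theta

section Nullwert

/-- The theta derivative at the origin, `∑ (-1) ^ n (2 n + 1) q ^ tri n`. -/
def thetaNull : convSubring := constantCoeff thetaH

lemma thetaNull_val :
    thetaNull.1 = triSeries fun n => (((-1) ^ n * (2 * n + 1) : ℤ) : ℂ) := by
  rw [thetaNull, ← coeff_zero_eq_constantCoeff_apply, thetaH, coeff_mk]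
  exact congrArg triSeries (funext fun n => thetaCoeff_one n)

lemma evalUHP_thetaNull (τ : ℍ) : evalUHP τ thetaNull = constantCoeff (thetaHAt τ) := by
  rw [thetaHAt, ← coeff_zero_eq_constantCoeff_apply, coeff_map, coeff_zero_eq_constantCoeff_apply]
  rfl

lemma constantCoeff_gaussSeries (γ : ℂ) : constantCoeff (gaussSeries γ) = 1 := by
  rw [← coeff_zero_eq_constantCoeff_apply, gaussSeries, coeff_mk]
  simp

lemma constantCoeff_rescale {R : Type*} [CommRing R] (c : R) (P : PowerSeries R) :
    constantCoeff (PowerSeries.rescale c P) = constantCoeff P := by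
  rw [← coeff_zero_eq_constantCoeff_apply, coeff_rescale, pow_zero, one_mul,
    coeff_zero_eq_constantCoeff_apply]

lemma evalUHP_S_thetaNull (τ : ℍ) :
    evalUHP (ModularGroup.S • τ) thetaNull = thetaMu τ * τ * evalUHP τ thetaNull := by
  have := congrArg constantCoeff (rescale_thetaHAt_S τ)
  simp only [constantCoeff_rescale, map_mul constantCoeff, constantCoeff_C,
    constantCoeff_gaussSeries, one_mul] at this
  rw [evalUHP_thetaNull, evalUHP_thetaNull, this]

lemma X_mem_convSubring : (PowerSeries.X : PowerSeries ℂ) ∈ convSubring := by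
  intro q _
  refine summable_of_ne_finset_zero (s := {1}) fun n hn => ?_
  simp [PowerSeries.coeff_X, show n ≠ 1 by simpa using hn]

lemma evalDisc_X (q : ℂ) (hq : ‖q‖ < 1) : evalDisc q hq ⟨_, X_mem_convSubring⟩ = q := by
  refine (hasSum_evalDisc _ q hq).unique ?_
  convert hasSum_ite_eq (1 : ℕ) q using 2 with n
  rw [PowerSeries.coeff_X]
  split_ifs with h <;> simp [h]

lemma constantCoeff_thetaNull : constantCoeff thetaNull.1 = 1 := by
  rw [thetaNull_val, ← coeff_zero_eq_constantCoeff_apply, coeff_triSeries_zero]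
  simp

/-- Jacobi's identity `Δ = q (∑ (-1) ^ n (2 n + 1) q ^ tri n) ^ 8`. -/
lemma discriminant_eq_thetaNull (τ : ℍ) :
    ModularForm.discriminant τ = Function.Periodic.qParam 1 τ * evalUHP τ thetaNull ^ 8 ∧
      qExpansion 1 ModularForm.discriminant = PowerSeries.X * thetaNull.1 ^ 8 := by
  set D : convSubring := ⟨_, X_mem_convSubring⟩ * thetaNull ^ 8 with hD
  have hev : ∀ τ, evalUHP τ D = Function.Periodic.qParam 1 τ * evalUHP τ thetaNull ^ 8 := by
    intro τ
    rw [hD, map_mul, map_pow]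
    congr 1
    exact evalDisc_X _ _
  have hDval : D.1 = PowerSeries.X * thetaNull.1 ^ 8 := rfl
  obtain ⟨g, hg, hgev⟩ := exists_modularForm_of_S_law D (w := 12) fun τ => by
    rw [hev, hev, evalUHP_S_thetaNull]
    have := thetaMu_pow_eight τ
    have h12 : (τ : ℂ) ^ (12 : ℤ) = (τ : ℂ) ^ 4 * (τ : ℂ) ^ 8 := by
      rw [← pow_add]; norm_cast
    rw [h12]
    linear_combination (τ : ℂ) ^ 8 * evalUHP τ thetaNull ^ 8 * this
  have h0 : coeff 0 (qExpansion 1 g) = 0 := by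
    rw [hg, hDval, PowerSeries.coeff_zero_X_mul]
  have h1 : coeff 1 (qExpansion 1 g) = 1 := by
    rw [hg, hDval, show (1 : ℕ) = 0 + 1 from rfl, PowerSeries.coeff_succ_X_mul,
      coeff_zero_eq_constantCoeff_apply, map_pow, constantCoeff_thetaNull, one_pow]
  obtain ⟨c, hc⟩ := CuspForm.exists_smul_discriminant_of_weight_eq_twelve (toCuspForm g h0)
  have hcg : (c • ModularForm.discriminant : ℍ → ℂ) = g := congrArg DFunLike.coe hc
  have hq := ModularForm.qExpansion_smul one_pos one_mem_strictPeriods_SL c CuspForm.discriminant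
  have hq' : qExpansion 1 g = c • qExpansion 1 ModularForm.discriminant := by
    rw [← hcg]; exact hq
  have hc1 : c = 1 := by
    have := congrArg (coeff 1) hq'
    rw [h1] at this
    simpa [discriminant_qExpansion_coeff_one] using this.symm
  subst hc1
  rw [one_smul] at hcg hq'
  exact ⟨by rw [congrFun hcg τ, hgev, hev], by rw [← hq', hg, hDval]⟩

lemma discriminant_coeff_mem (O : Subring ℂ) (n : ℕ) :
    coeff n (qExpansion 1 ModularForm.discriminant) ∈ O := by
  have hX : (PowerSeries.X : PowerSeries ℂ) ∈ coeffSubring O := ⟨PowerSeries.X, by simp⟩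
  have ht : thetaNull.1 ∈ coeffSubring O := by
    refine ⟨triSeries fun n => (((-1) ^ n * (2 * n + 1) : ℤ) : O), ?_⟩
    rw [map_triSeries, thetaNull_val]
    exact congrArg triSeries (funext fun n => map_intCast O.subtype _)
  rw [(discriminant_eq_thetaNull UpperHalfPlane.I).2]
  exact mem_coeffSubring.1 (mul_mem hX (pow_mem ht 8)) n

lemma isUnit_thetaNull : IsUnit thetaNull := by
  refine isUnit_convSubring _ fun q hq => ?_
  by_cases h0 : q = 0
  · subst h0
    have h1 : evalDisc 0 hq thetaNull = 1 := by
      refine (hasSum_evalDisc _ 0 hq).unique ?_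
      convert hasSum_ite_eq (0 : ℕ) (1 : ℂ) using 2 with n
      split_ifs with h
      · subst h
        rw [coeff_zero_eq_constantCoeff_apply, constantCoeff_thetaNull]
        simp
      · simp [h]
    rw [h1]
    exact one_ne_zero
  · intro h
    let τ : ℍ := ⟨Function.Periodic.invQParam 1 q,
      Function.Periodic.im_invQParam_pos_of_norm_lt_one one_pos hq h0⟩
    have hτ : Function.Periodic.qParam 1 (τ : ℂ) = q :=
      Function.Periodic.qParam_right_inv one_ne_zero h0
    apply ModularForm.discriminant_ne_zero τ
    rw [(discriminant_eq_thetaNull τ).1]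
    have : evalUHP τ thetaNull = evalDisc q hq thetaNull := by
      refine (hasSum_evalUHP _ τ).unique ?_
      rw [hτ]
      exact hasSum_evalDisc _ q hq
    rw [this, h]
    simp

end Nullwert

section Functional

variable {R R' : Type*} [CommRing R] [CommRing R']

/-- The quotient `(Q - Q(0)) / t`, where `t = X / W`. -/
def quoStep (W : PowerSeries R) : PowerSeries R →ₗ[R] PowerSeries R where
  toFun Q := W * PowerSeries.mk fun i => coeff (i + 1) Q
  map_add' P Q := by
    rw [← mul_add]
    congr 1
  map_smul' c Q := by
    ext n
    simp only [RingHom.id_apply]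
    rw [show (PowerSeries.mk fun i => coeff (i + 1) (c • Q)) =
      c • PowerSeries.mk fun i => coeff (i + 1) Q by ext i; simp, mul_smul_comm]

lemma X_mul_quoStep (W Q : PowerSeries R) :
    X * quoStep W Q = W * (Q - C (constantCoeff Q)) := by
  have h := PowerSeries.sub_const_eq_X_mul_shift Q
  rw [h]
  simp only [quoStep, LinearMap.coe_mk, AddHom.coe_mk]
  ring

/-- The `n`-th coefficient of the expansion of `Q` in powers of `t = X / W`. -/
def tCoeff (W : PowerSeries R) (n : ℕ) : PowerSeries R →ₗ[R] R :=
  (coeff 0).comp ((quoStep W) ^ n)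

lemma tCoeff_zero (W Q : PowerSeries R) : tCoeff W 0 Q = constantCoeff Q := by
  simp [tCoeff]

lemma tCoeff_succ (W : PowerSeries R) (n : ℕ) (Q : PowerSeries R) :
    tCoeff W (n + 1) Q = tCoeff W n (quoStep W Q) := by
  simp [tCoeff, pow_succ]

/-- Compatibility of `t`-coefficients with ring homomorphisms scaling `t` by `a`. -/
lemma tCoeff_map (f : R →+* R') (σ : PowerSeries R →+* PowerSeries R') {W : PowerSeries R}
    {W' : PowerSeries R'} (hW : IsUnit W) (a : R') (hC : ∀ c, σ (C c) = C (f c))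
    (h0 : ∀ Q, constantCoeff (σ Q) = f (constantCoeff Q))
    (hX : σ X * W' = C a * (X * σ W)) (n : ℕ) (Q : PowerSeries R) :
    tCoeff W' n (σ Q) = a ^ n * f (tCoeff W n Q) := by
  induction n generalizing Q with
  | zero => simp [tCoeff_zero, h0]
  | succ n ih =>
    have key : quoStep W' (σ Q) = C a * σ (quoStep W Q) := by
      have h1 := X_mul_quoStep W' (σ Q)
      have h2 := congrArg σ (X_mul_quoStep W Q)
      rw [map_mul, map_mul, map_sub, hC, ← h0] at h2
      have hu : IsUnit (σ W) := hW.map σ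
      apply hu.mul_left_cancel
      apply PowerSeries.X_mul_cancel
      calc X * (σ W * quoStep W' (σ Q)) = σ W * (X * quoStep W' (σ Q)) := by ring
        _ = W' * (σ W * (σ Q - C (constantCoeff (σ Q)))) := by rw [h1]; ring
        _ = (σ X * W') * σ (quoStep W Q) := by rw [← h2]; ring
        _ = X * (σ W * (C a * σ (quoStep W Q))) := by rw [hX]; ring
    rw [tCoeff_succ, tCoeff_succ, key, ← smul_eq_C_mul, map_smul, ih, smul_eq_mul, pow_succ]
    ring

lemma tCoeff_eq_zero_of_X_pow_dvd (W : PowerSeries R) {n m : ℕ} (h : n < m) (Q : PowerSeries R)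
    (hQ : X ^ m ∣ Q) : tCoeff W n Q = 0 := by
  induction n generalizing m Q with
  | zero =>
    rw [tCoeff_zero, ← coeff_zero_eq_constantCoeff_apply]
    exact X_pow_dvd_iff.1 hQ 0 h
  | succ n ih =>
    rw [tCoeff_succ]
    refine ih (m := m - 1) (by omega) _ ?_
    refine Dvd.dvd.mul_left (X_pow_dvd_iff.2 fun i hi => ?_) _
    rw [coeff_mk]
    exact X_pow_dvd_iff.1 hQ _ (by omega)

lemma tCoeff_eq_sum (W : PowerSeries R) (V : PowerSeries R) (n : ℕ) (Q : PowerSeries R) :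
    tCoeff W n (V * Q) =
      ∑ j ∈ Finset.range (n + 1), coeff j Q * tCoeff W n (V * X ^ j) := by
  have hd : X ^ (n + 1) ∣ V * (Q - ∑ j ∈ Finset.range (n + 1), C (coeff j Q) * X ^ j) := by
    refine Dvd.dvd.mul_left (X_pow_dvd_iff.2 fun i hi => ?_) _
    rw [map_sub, map_sum]
    simp only [coeff_C_mul, coeff_X_pow]
    rw [Finset.sum_eq_single i]
    · simp
    · intro b _ hb
      simp [hb.symm]
    · intro h
      exact absurd (Finset.mem_range.2 hi) h
  have h0 := tCoeff_eq_zero_of_X_pow_dvd W (Nat.lt_succ_self n) _ hd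
  rw [mul_sub, map_sub, sub_eq_zero] at h0
  rw [h0, Finset.mul_sum, map_sum]
  refine Finset.sum_congr rfl fun j _ => ?_
  rw [mul_left_comm, ← smul_eq_C_mul, map_smul, smul_eq_mul]

lemma X_pow_dvd_of_tCoeff_eq_zero {W : PowerSeries R} (hW : IsUnit W) (m : ℕ)
    (Q : PowerSeries R) (h : ∀ i < m, tCoeff W i Q = 0) : X ^ m ∣ Q := by
  induction m generalizing Q with
  | zero => simp
  | succ m ih =>
    have h1 := ih (quoStep W Q) fun i hi => by
      rw [← tCoeff_succ]
      exact h _ (by omega)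
    have h2 := X_mul_quoStep W Q
    have h3 := h 0 (by omega)
    rw [tCoeff_zero] at h3
    rw [h3, map_zero, sub_zero] at h2
    rw [← hW.dvd_mul_left, ← h2, pow_succ']
    exact mul_dvd_mul_left _ h1

end Functional

section ThetaQuotients

lemma isUnit_thetaH : IsUnit thetaH := isUnit_iff_constantCoeff.2 isUnit_thetaNull

/-- A theta quotient of weight `0` and index `-1`. -/
def thetaU : PowerSeries convSubring :=
  PowerSeries.rescale 2 thetaH ^ 2 * Ring.inverse (thetaH * PowerSeries.rescale 3 thetaH)

/-- The cofactor `X / t` of a theta quotient `t` of weight `-1` and index `0`. -/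
def thetaW : PowerSeries convSubring :=
  C thetaNull * PowerSeries.rescale 2 thetaH ^ 3 *
    Ring.inverse (thetaH ^ 3 * PowerSeries.rescale 3 thetaH)

lemma thetaU_mul : thetaU * (thetaH * PowerSeries.rescale 3 thetaH) =
    PowerSeries.rescale 2 thetaH ^ 2 := by
  rw [thetaU, mul_assoc, Ring.inverse_mul_cancel, mul_one]
  exact isUnit_thetaH.mul (isUnit_thetaH.map _)

lemma thetaW_mul : thetaW * (thetaH ^ 3 * PowerSeries.rescale 3 thetaH) =
    C thetaNull * PowerSeries.rescale 2 thetaH ^ 3 := by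
  rw [thetaW, mul_assoc, Ring.inverse_mul_cancel, mul_one]
  exact (isUnit_thetaH.pow 3).mul (isUnit_thetaH.map _)

lemma isUnit_thetaW : IsUnit thetaW := by
  refine isUnit_of_mul_isUnit_left (y := thetaH ^ 3 * PowerSeries.rescale 3 thetaH) ?_
  rw [thetaW_mul]
  exact (isUnit_thetaNull.map _).mul ((isUnit_thetaH.map _).pow 3)

def thetaUAt (τ : ℍ) : PowerSeries ℂ := PowerSeries.map (evalUHP τ) thetaU

def thetaWAt (τ : ℍ) : PowerSeries ℂ := PowerSeries.map (evalUHP τ) thetaW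

lemma map_rescale {R R' : Type*} [CommRing R] [CommRing R'] (f : R →+* R') (c : R)
    (P : PowerSeries R) : PowerSeries.map f (PowerSeries.rescale c P) =
      PowerSeries.rescale (f c) (PowerSeries.map f P) := by
  ext n
  simp [coeff_rescale]

lemma thetaUAt_mul (τ : ℍ) : thetaUAt τ * (thetaHAt τ * PowerSeries.rescale 3 (thetaHAt τ)) =
    PowerSeries.rescale 2 (thetaHAt τ) ^ 2 := by
  have := congrArg (PowerSeries.map (evalUHP τ)) thetaU_mul
  simp only [map_mul, map_pow, map_rescale, map_ofNat] at this
  exact this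

lemma thetaWAt_mul (τ : ℍ) :
    thetaWAt τ * (thetaHAt τ ^ 3 * PowerSeries.rescale 3 (thetaHAt τ)) =
      C (evalUHP τ thetaNull) * PowerSeries.rescale 2 (thetaHAt τ) ^ 3 := by
  have := congrArg (PowerSeries.map (evalUHP τ)) thetaW_mul
  simp only [map_mul, map_pow, map_rescale, map_ofNat, PowerSeries.map_C] at this
  exact this

lemma isUnit_thetaHAt (τ : ℍ) : IsUnit (thetaHAt τ) := isUnit_thetaH.map _

lemma isUnit_gaussSeries (γ : ℂ) : IsUnit (gaussSeries γ) := by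
  rw [isUnit_iff_constantCoeff, constantCoeff_gaussSeries]
  exact isUnit_one

lemma isUnit_C_thetaMu (τ : ℍ) : IsUnit (C (thetaMu τ * τ) : PowerSeries ℂ) := by
  refine IsUnit.map C (isUnit_iff_ne_zero.2 fun h => ?_)
  have h1 := (isUnit_thetaNull.map (evalUHP (ModularGroup.S • τ))).ne_zero
  rw [evalUHP_S_thetaNull, h, zero_mul] at h1
  exact h1 rfl

lemma rescale_comm (a b : ℂ) (P : PowerSeries ℂ) :
    PowerSeries.rescale a (PowerSeries.rescale b P) =
      PowerSeries.rescale b (PowerSeries.rescale a P) := by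
  rw [rescale_rescale, rescale_rescale, mul_comm]

lemma rescale_C {R : Type*} [CommRing R] (a b : R) :
    PowerSeries.rescale a (C b : PowerSeries R) = C b := by
  ext n
  rw [coeff_rescale, coeff_C]
  split_ifs with h <;> simp [h]

/-- The exponent of the Gaussian factor in the inversion law. -/
def gaussExp (τ : ℍ) : ℂ := -I / (4 * Real.pi * τ)

lemma rescale_rescale_thetaHAt_S (τ : ℍ) (c : ℂ) :
    PowerSeries.rescale (τ : ℂ)⁻¹ (PowerSeries.rescale c (thetaHAt (ModularGroup.S • τ))) =
      C (thetaMu τ * τ) * (gaussSeries (gaussExp τ * c ^ 2) *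
        PowerSeries.rescale c (thetaHAt τ)) := by
  rw [rescale_comm, rescale_thetaHAt_S, map_mul (PowerSeries.rescale c),
    map_mul (PowerSeries.rescale c), rescale_C, rescale_gaussSeries]
  rfl

lemma rescale_thetaUAt_S (τ : ℍ) :
    PowerSeries.rescale (τ : ℂ)⁻¹ (thetaUAt (ModularGroup.S • τ)) =
      gaussSeries (-2 * gaussExp τ) * thetaUAt τ := by
  have h := congrArg (PowerSeries.rescale (τ : ℂ)⁻¹) (thetaUAt_mul (ModularGroup.S • τ))
  have h1 := rescale_rescale_thetaHAt_S τ 1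
  rw [rescale_one] at h1
  simp only [RingHom.id_apply] at h1
  simp only [map_mul (PowerSeries.rescale (τ : ℂ)⁻¹), map_pow, h1,
    rescale_rescale_thetaHAt_S] at h
  have hG1 : gaussSeries (gaussExp τ * 1 ^ 2) * gaussSeries (gaussExp τ * 3 ^ 2) =
      gaussSeries (10 * gaussExp τ) := by
    rw [gaussSeries_mul]; ring_nf
  have hG2 : gaussSeries (gaussExp τ * 2 ^ 2) ^ 2 =
      gaussSeries (10 * gaussExp τ) * gaussSeries (-2 * gaussExp τ) := by
    rw [pow_two, gaussSeries_mul, gaussSeries_mul]; ring_nf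
  have hu : IsUnit (C (thetaMu τ * τ) ^ 2 * gaussSeries (10 * gaussExp τ) *
      (thetaHAt τ * PowerSeries.rescale 3 (thetaHAt τ))) :=
    (((isUnit_C_thetaMu τ).pow 2).mul (isUnit_gaussSeries _)).mul
      ((isUnit_thetaHAt τ).mul ((isUnit_thetaHAt τ).map _))
  apply hu.mul_left_cancel
  linear_combination h + C (thetaMu τ * τ) ^ 2 * PowerSeries.rescale 2 (thetaHAt τ) ^ 2 * hG2
    - PowerSeries.rescale (τ : ℂ)⁻¹ (thetaUAt (ModularGroup.S • τ)) * C (thetaMu τ * τ) ^ 2 *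
      (thetaHAt τ * PowerSeries.rescale 3 (thetaHAt τ)) * hG1
    - C (thetaMu τ * τ) ^ 2 * gaussSeries (10 * gaussExp τ) * gaussSeries (-2 * gaussExp τ) *
      thetaUAt_mul τ

lemma rescale_thetaWAt_S (τ : ℍ) :
    PowerSeries.rescale (τ : ℂ)⁻¹ (thetaWAt (ModularGroup.S • τ)) = thetaWAt τ := by
  have h := congrArg (PowerSeries.rescale (τ : ℂ)⁻¹) (thetaWAt_mul (ModularGroup.S • τ))
  have h1 := rescale_rescale_thetaHAt_S τ 1
  rw [rescale_one] at h1
  simp only [RingHom.id_apply] at h1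
  simp only [map_mul (PowerSeries.rescale (τ : ℂ)⁻¹), map_pow, h1, rescale_C,
    evalUHP_S_thetaNull, rescale_rescale_thetaHAt_S, map_mul C (thetaMu τ * τ)] at h
  have hG1 : gaussSeries (gaussExp τ * 1 ^ 2) ^ 3 * gaussSeries (gaussExp τ * 3 ^ 2) =
      gaussSeries (12 * gaussExp τ) := by
    rw [pow_three, gaussSeries_mul, gaussSeries_mul, gaussSeries_mul]; ring_nf
  have hG2 : gaussSeries (gaussExp τ * 2 ^ 2) ^ 3 = gaussSeries (12 * gaussExp τ) := by
    rw [pow_three, gaussSeries_mul, gaussSeries_mul]; ring_nf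
  have hu : IsUnit (C (thetaMu τ * τ) ^ 4 * gaussSeries (12 * gaussExp τ) *
      (thetaHAt τ ^ 3 * PowerSeries.rescale 3 (thetaHAt τ))) :=
    (((isUnit_C_thetaMu τ).pow 4).mul (isUnit_gaussSeries _)).mul
      (((isUnit_thetaHAt τ).pow 3).mul ((isUnit_thetaHAt τ).map _))
  apply hu.mul_left_cancel
  linear_combination h + C (thetaMu τ * τ) ^ 4 * C (evalUHP τ thetaNull) *
      PowerSeries.rescale 2 (thetaHAt τ) ^ 3 * hG2
    - PowerSeries.rescale (τ : ℂ)⁻¹ (thetaWAt (ModularGroup.S • τ)) * C (thetaMu τ * τ) ^ 4 *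
      (thetaHAt τ ^ 3 * PowerSeries.rescale 3 (thetaHAt τ)) * hG1
    - C (thetaMu τ * τ) ^ 4 * gaussSeries (12 * gaussExp τ) * thetaWAt_mul τ

/-- The inversion law for the `t`-coefficients of a series of index `M`. -/
lemma tCoeff_S (τ : ℍ) (M j : ℕ) (κ : ℂ) {P Q : PowerSeries ℂ}
    (h : PowerSeries.rescale (τ : ℂ)⁻¹ P = C κ * (gaussSeries (2 * M * gaussExp τ) * Q)) :
    tCoeff (thetaWAt (ModularGroup.S • τ)) j (thetaUAt (ModularGroup.S • τ) ^ M * P) =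
      κ * (τ : ℂ) ^ j * tCoeff (thetaWAt τ) j (thetaUAt τ ^ M * Q) := by
  have h1 := tCoeff_map (RingHom.id ℂ) (PowerSeries.rescale (τ : ℂ)⁻¹)
    (W := thetaWAt (ModularGroup.S • τ)) (W' := thetaWAt τ) (isUnit_thetaW.map _) (τ : ℂ)⁻¹
    (fun c => rescale_C _ _) (fun Q => constantCoeff_rescale _ _)
    (by rw [rescale_thetaWAt_S, rescale_X, mul_assoc]) j (thetaUAt (ModularGroup.S • τ) ^ M * P)
  have hG : gaussSeries (M * (-2 * gaussExp τ)) * gaussSeries (2 * M * gaussExp τ) = 1 := by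
    rw [gaussSeries_mul, ← gaussSeries_zero]; ring_nf
  have h2 : PowerSeries.rescale (τ : ℂ)⁻¹ (thetaUAt (ModularGroup.S • τ) ^ M * P) =
      C κ * (thetaUAt τ ^ M * Q) := by
    rw [map_mul, map_pow, rescale_thetaUAt_S, h, mul_pow, gaussSeries_pow]
    linear_combination thetaUAt τ ^ M * C κ * Q * hG
  rw [h2, ← smul_eq_C_mul, map_smul, smul_eq_mul, RingHom.id_apply, inv_pow] at h1
  have hτ : (τ : ℂ) ^ j ≠ 0 := pow_ne_zero _ τ.ne_zero
  field_simp at h1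
  rw [← h1]
  ring

end ThetaQuotients

section Substitution

variable {R : Type*} [CommRing R]

/-- Substitution of a series without constant term, as a ring homomorphism. -/
def substHom (E : PowerSeries R) (hE : constantCoeff E = 0) : PowerSeries R →+* PowerSeries R :=
  (substAlgHom (R := R) (HasSubst.of_constantCoeff_zero' hE)).toRingHom

lemma substHom_apply (E : PowerSeries R) (hE : constantCoeff E = 0) (P : PowerSeries R) :
    substHom E hE P = P.subst E :=
  congrFun (coe_substAlgHom (HasSubst.of_constantCoeff_zero' hE)) P

lemma coeff_substHom (E : PowerSeries R) (hE : constantCoeff E = 0) (P : PowerSeries R) (e : ℕ) :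
    coeff e (substHom E hE P) =
      ∑ d ∈ Finset.range (e + 1), coeff d P * coeff e (E ^ d) := by
  rw [substHom_apply, coeff_subst' (HasSubst.of_constantCoeff_zero' hE)]
  refine finsum_eq_sum_of_support_subset _ fun d hd => ?_
  by_contra h
  have hd' : e < d := by simpa using h
  refine hd ?_
  have : X ^ d ∣ E ^ d := pow_dvd_pow_of_dvd (X_dvd_iff.2 hE) d
  simp only [X_pow_dvd_iff.1 this e hd', smul_zero]

lemma substHom_X (E : PowerSeries R) (hE : constantCoeff E = 0) : substHom E hE X = E := by
  rw [substHom_apply, subst_X (HasSubst.of_constantCoeff_zero' hE)]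

lemma substHom_C (E : PowerSeries R) (hE : constantCoeff E = 0) (c : R) :
    substHom E hE (C c) = C c := by
  rw [substHom_apply]
  exact subst_C c

lemma constantCoeff_substHom (E : PowerSeries R) (hE : constantCoeff E = 0) (P : PowerSeries R) :
    constantCoeff (substHom E hE P) = constantCoeff P := by
  rw [← coeff_zero_eq_constantCoeff_apply, coeff_substHom]
  simp

end Substitution

section Units

variable (R : Type*) [CommRing R]

/-- The unit `1 + X`. -/
def onePlusX : (PowerSeries R)ˣ where
  val := 1 + X
  inv := PowerSeries.rescale (-1) (PowerSeries.mk 1)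
  val_inv := by
    have := congrArg (PowerSeries.rescale (-1 : R)) (mk_one_mul_one_sub_eq_one R)
    rw [map_mul, map_sub, map_one, rescale_neg_one_X, sub_neg_eq_add] at this
    rw [mul_comm, this]
  inv_val := by
    have := congrArg (PowerSeries.rescale (-1 : R)) (mk_one_mul_one_sub_eq_one R)
    rw [map_mul, map_sub, map_one, rescale_neg_one_X, sub_neg_eq_add] at this
    rw [this]

variable {R}

lemma map_onePlusX {R' : Type*} [CommRing R'] (f : R →+* R') (z : ℤ) :
    PowerSeries.map f ((onePlusX R ^ z : (PowerSeries R)ˣ) : PowerSeries R) =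
      ((onePlusX R' ^ z : (PowerSeries R')ˣ) : PowerSeries R') := by
  have h : Units.map (PowerSeries.map f).toMonoidHom (onePlusX R) = onePlusX R' := by
    ext1
    simp [onePlusX]
  rw [← h, ← map_zpow]
  rfl

lemma constantCoeff_onePlusX_zpow (z : ℤ) :
    constantCoeff ((onePlusX R ^ z : (PowerSeries R)ˣ) : PowerSeries R) = 1 := by
  have h : Units.map (constantCoeff (R := R)).toMonoidHom (onePlusX R) = 1 := by
    ext1
    simp [onePlusX]
  have h2 := congrArg (· ^ z) h
  simp only [← map_zpow, _root_.one_zpow] at h2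
  exact congrArg Units.val h2

end Units

section DoubleSeries

variable {R : Type*} [CommRing R]

/-- The series `∑ P_n q ^ tri n` as a power series in `X` over power series in `q`. -/
def triDouble (P : ℕ → PowerSeries R) : PowerSeries (PowerSeries R) :=
  PowerSeries.mk fun j => triSeries fun n => coeff j (P n)

lemma triSeries_add (F G : ℕ → R) :
    triSeries F + triSeries G = triSeries fun n => F n + G n :=
  triSeries_ext (fun n => by rw [map_add, coeff_triSeries_tri, coeff_triSeries_tri])
    fun N hN => by
      rw [map_add, coeff_triSeries_of_notMem F hN, coeff_triSeries_of_notMem G hN, add_zero]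

lemma triSeries_zero : triSeries (fun _ => (0 : R)) = 0 :=
  (triSeries_ext (fun _ => by simp) fun _ _ => by simp).symm

lemma sum_triSeries {ι : Type*} (s : Finset ι) (F : ι → ℕ → R) :
    ∑ i ∈ s, triSeries (F i) = triSeries fun n => ∑ i ∈ s, F i n := by
  induction s using Finset.cons_induction with
  | empty => simp [triSeries_zero]
  | cons a s ha ih =>
    rw [Finset.sum_cons, ih, triSeries_add]
    simp only [Finset.sum_cons]

lemma map_C_mul_triDouble (Q : PowerSeries R) (P : ℕ → PowerSeries R) :
    PowerSeries.map C Q * triDouble P = triDouble fun n => Q * P n := by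
  ext1 j
  rw [triDouble, triDouble, coeff_mul, coeff_mk]
  simp only [coeff_map, coeff_mk, C_mul_triSeries, sum_triSeries, coeff_mul]

lemma map_map_triDouble {R' : Type*} [CommRing R'] (f : R →+* R') (P : ℕ → PowerSeries R) :
    PowerSeries.map (PowerSeries.map f) (triDouble P) =
      triDouble fun n => PowerSeries.map f (P n) := by
  ext1 j
  simp only [triDouble, coeff_map, coeff_mk, map_triSeries]

lemma substHom_triDouble (E : PowerSeries R) (hE : constantCoeff E = 0)
    (hE' : constantCoeff (PowerSeries.map C E) = 0) (P : ℕ → PowerSeries R) :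
    substHom (PowerSeries.map C E) hE' (triDouble P) =
      triDouble fun n => substHom E hE (P n) := by
  ext1 j
  rw [coeff_substHom]
  simp only [triDouble, coeff_mk, coeff_substHom, ← map_pow, coeff_map]
  simp only [mul_comm _ (C _), C_mul_triSeries, sum_triSeries]
  simp only [mul_comm]

end DoubleSeries

section ThetaX

variable (R : Type*) [CommRing R]

/-- `(w ^ r - w ^ (-r)) / (w - w⁻¹)` for `w = 1 + X`. -/
def chebX (r : ℕ) : PowerSeries R :=
  ((onePlusX R ^ (1 - r : ℤ) : (PowerSeries R)ˣ) : PowerSeries R) *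
    ∑ i ∈ Finset.range r, ((onePlusX R : PowerSeries R) ^ 2) ^ i

lemma chebX_mul (r : ℕ) :
    ((onePlusX R : PowerSeries R) - ((onePlusX R)⁻¹ : (PowerSeries R)ˣ)) * chebX R r =
      ((onePlusX R ^ (r : ℤ) : (PowerSeries R)ˣ) : PowerSeries R) -
        ((onePlusX R ^ (-r : ℤ) : (PowerSeries R)ˣ) : PowerSeries R) := by
  set w := onePlusX R
  have hg := geom_sum_mul ((w : PowerSeries R) ^ 2) r
  have hww : (w : PowerSeries R) * (w⁻¹ : (PowerSeries R)ˣ) = 1 := w.mul_inv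
  have e1 : ((w ^ (1 - r : ℤ) : (PowerSeries R)ˣ) : PowerSeries R) =
      (w ^ (-r : ℤ) : (PowerSeries R)ˣ) * w := by
    rw [← Units.val_mul, ← _root_.zpow_add_one]
    congr 2
    ring
  have e2 : ((w ^ (-r : ℤ) : (PowerSeries R)ˣ) : PowerSeries R) * ((w : PowerSeries R) ^ 2) ^ r =
      (w ^ (r : ℤ) : (PowerSeries R)ˣ) := by
    rw [← pow_mul, ← Units.val_pow_eq_pow_val, ← Units.val_mul, ← zpow_natCast w (2 * r),
      ← _root_.zpow_add]
    congr 2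
    push_cast
    ring
  rw [chebX, e1]
  linear_combination (w ^ (-r : ℤ) : (PowerSeries R)ˣ) * hg + e2 -
    (w ^ (-r : ℤ) : (PowerSeries R)ˣ) *
      (∑ i ∈ Finset.range r, ((w : PowerSeries R) ^ 2) ^ i) * hww

lemma constantCoeff_chebX (r : ℕ) : constantCoeff (chebX R r) = r := by
  rw [chebX, map_mul, constantCoeff_onePlusX_zpow, map_sum]
  simp [onePlusX]

lemma map_chebX {R' : Type*} [CommRing R'] (f : R →+* R') (r : ℕ) :
    PowerSeries.map f (chebX R r) = chebX R' r := by
  have := map_onePlusX f 1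
  rw [zpow_one, zpow_one] at this
  simp only [chebX, map_mul, map_sum, map_pow, map_onePlusX, this]

/-- The theta series with argument multiplied by `k`, divided by `w - w⁻¹`. -/
def thetaX (k : ℕ) : PowerSeries (PowerSeries R) :=
  triDouble fun n => (-1) ^ n * chebX R (k * (2 * n + 1))

/-- The theta null value over a general ring. -/
def nullX : PowerSeries R := triSeries fun n => (-1) ^ n * (2 * n + 1)

lemma map_thetaX {R' : Type*} [CommRing R'] (f : R →+* R') (k : ℕ) :
    PowerSeries.map (PowerSeries.map f) (thetaX R k) = thetaX R' k := by
  simp only [thetaX, map_map_triDouble, map_mul, map_pow, map_neg, map_one, map_chebX]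

lemma map_nullX {R' : Type*} [CommRing R'] (f : R →+* R') :
    PowerSeries.map f (nullX R) = nullX R' := by
  simp only [nullX, map_triSeries, map_mul, map_pow, map_neg, map_one, map_add, map_natCast,
    map_ofNat]

lemma isUnit_nullX : IsUnit (nullX R) := by
  rw [isUnit_iff_constantCoeff, ← coeff_zero_eq_constantCoeff_apply, nullX, coeff_triSeries_zero]
  simp

lemma isUnit_thetaX {k : ℕ} (hk : IsUnit (k : R)) : IsUnit (thetaX R k) := by
  rw [isUnit_iff_constantCoeff, isUnit_iff_constantCoeff, ← coeff_zero_eq_constantCoeff_apply,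
    ← coeff_zero_eq_constantCoeff_apply, thetaX, triDouble, coeff_mk, coeff_triSeries_zero,
    coeff_zero_eq_constantCoeff_apply]
  simpa [constantCoeff_chebX] using hk

end ThetaX

section Comparison

/-- The series `e ^ (Z / 2) - 1`. -/
def halfExp : PowerSeries ℂ := PowerSeries.rescale (1 / 2 : ℂ) (PowerSeries.exp ℂ) - 1

lemma constantCoeff_halfExp : constantCoeff halfExp = 0 := by
  rw [halfExp, map_sub, constantCoeff_rescale, constantCoeff_exp, map_one, sub_self]

lemma constantCoeff_map_halfExp :
    constantCoeff (PowerSeries.map (C (R := ℂ)) halfExp) = 0 := by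
  rw [← coeff_zero_eq_constantCoeff_apply, coeff_map, coeff_zero_eq_constantCoeff_apply,
    constantCoeff_halfExp, map_zero]

lemma substHom_onePlusX (z : ℤ) :
    substHom halfExp constantCoeff_halfExp
      ((onePlusX ℂ ^ z : (PowerSeries ℂ)ˣ) : PowerSeries ℂ) =
      PowerSeries.rescale (z / 2 : ℂ) (PowerSeries.exp ℂ) := by
  have hnat : ∀ n : ℕ, substHom halfExp constantCoeff_halfExp
      ((onePlusX ℂ ^ (n : ℤ) : (PowerSeries ℂ)ˣ) : PowerSeries ℂ) =
      PowerSeries.rescale (n / 2 : ℂ) (PowerSeries.exp ℂ) := by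
    intro n
    rw [zpow_natCast, Units.val_pow_eq_pow_val, map_pow, onePlusX, map_add, map_one, substHom_X,
      halfExp, add_sub_cancel, ← map_pow, exp_pow_eq_rescale_exp, rescale_rescale]
    congr 2
    ring
  obtain ⟨n, rfl | rfl⟩ := z.eq_nat_or_neg
  · rw [Int.cast_natCast]
    exact hnat n
  · have hu : IsUnit (substHom halfExp constantCoeff_halfExp
        ((onePlusX ℂ ^ (n : ℤ) : (PowerSeries ℂ)ˣ) : PowerSeries ℂ)) :=
      (Units.isUnit _).map _
    apply hu.mul_left_cancel
    rw [← map_mul, ← Units.val_mul, ← _root_.zpow_add, add_neg_cancel, zpow_zero, Units.val_one,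
      map_one, hnat, exp_mul_exp_eq_exp_add]
    rw [show ((n : ℂ) / 2 + ((-(n : ℤ) : ℤ) : ℂ) / 2) = 0 by push_cast; ring, rescale_zero_apply]
    simp

/-- The theta series over formal power series in `q`. -/
def thetaZ : PowerSeries (PowerSeries ℂ) := PowerSeries.map convSubring.subtype thetaH

/-- Substitution `1 + X = e ^ (Z / 2)` in double series. -/
def substZ : PowerSeries (PowerSeries ℂ) →+* PowerSeries (PowerSeries ℂ) :=
  substHom (PowerSeries.map C halfExp) constantCoeff_map_halfExp

lemma substZ_onePlusX (z : ℤ) :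
    substZ ((onePlusX (PowerSeries ℂ) ^ z : (PowerSeries (PowerSeries ℂ))ˣ) :
      PowerSeries (PowerSeries ℂ)) =
      PowerSeries.map C (PowerSeries.rescale (z / 2 : ℂ) (PowerSeries.exp ℂ)) := by
  rw [← map_onePlusX (C (R := ℂ)), ← substHom_onePlusX, substZ]
  ext1 j
  simp only [coeff_substHom, coeff_map, map_sum, map_mul, ← map_pow]

lemma substZ_thetaX (k : ℕ) :
    substZ ((onePlusX (PowerSeries ℂ) : PowerSeries (PowerSeries ℂ)) -
      ((onePlusX (PowerSeries ℂ))⁻¹ : (PowerSeries (PowerSeries ℂ))ˣ)) * substZ (thetaX ℂ k) =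
      (k : PowerSeries (PowerSeries ℂ)) * X * PowerSeries.rescale (k : PowerSeries ℂ) thetaZ := by
  have h1 := map_onePlusX (C (R := ℂ)) 1
  have h2 := map_onePlusX (C (R := ℂ)) (-1)
  rw [zpow_one, zpow_one] at h1
  rw [_root_.zpow_neg_one, _root_.zpow_neg_one] at h2
  rw [← map_mul, ← h1, ← h2, ← map_sub, thetaX, map_C_mul_triDouble, substZ,
    substHom_triDouble halfExp constantCoeff_halfExp]
  have hP : ∀ n : ℕ, substHom halfExp constantCoeff_halfExp
      (((onePlusX ℂ : PowerSeries ℂ) - ((onePlusX ℂ)⁻¹ : (PowerSeries ℂ)ˣ)) *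
        ((-1) ^ n * chebX ℂ (k * (2 * n + 1)))) =
      (-1) ^ n * (PowerSeries.rescale (((k * (2 * n + 1) : ℕ) : ℤ) / 2 : ℂ) (PowerSeries.exp ℂ) -
        PowerSeries.rescale ((-((k * (2 * n + 1) : ℕ) : ℤ) : ℤ) / 2 : ℂ) (PowerSeries.exp ℂ)) := by
    intro n
    rw [mul_left_comm, chebX_mul, map_mul, map_pow, map_neg, map_one, map_sub, substHom_onePlusX,
      substHom_onePlusX]
  simp only [hP]
  ext1 j
  rw [show (k : PowerSeries (PowerSeries ℂ)) = C (k : PowerSeries ℂ) by simp, mul_assoc,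
    coeff_C_mul, triDouble, coeff_mk]
  cases j with
  | zero =>
    rw [coeff_zero_X_mul, mul_zero, ← triSeries_zero]
    refine congrArg triSeries (funext fun n => ?_)
    rw [show ((-1 : PowerSeries ℂ) ^ n) = C ((-1) ^ n) by simp, coeff_C_mul]
    simp [constantCoeff_rescale]
  | succ i =>
    rw [coeff_succ_X_mul, coeff_rescale, thetaZ, coeff_map, thetaH, coeff_mk, Subring.subtype_apply,
      ← mul_assoc, ← pow_succ', show (k : PowerSeries ℂ) ^ (i + 1) = C ((k : ℂ) ^ (i + 1)) by simp,
      C_mul_triSeries]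
    refine congrArg triSeries (funext fun n => ?_)
    rw [show ((-1 : PowerSeries ℂ) ^ n) = C ((-1) ^ n) by simp, coeff_C_mul, map_sub, coeff_rescale,
      coeff_rescale, coeff_exp, thetaCoeff]
    have e1 : (((k * (2 * n + 1) : ℕ) : ℤ) : ℂ) / 2 = k * (n + 1 / 2) := by push_cast; ring
    have e2 : ((-((k * (2 * n + 1) : ℕ) : ℤ) : ℤ) : ℂ) / 2 = k * (-(n + 1 / 2)) := by
      push_cast; ring
    rw [e1, e2, mul_pow, mul_pow]
    simp only [one_div, map_inv₀, map_natCast]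
    ring

lemma nullX_eq_thetaNull : nullX ℂ = thetaNull.1 := by
  rw [thetaNull_val, nullX]
  exact congrArg triSeries (funext fun n => by push_cast; rfl)

lemma thetaZ_U_mul : PowerSeries.map convSubring.subtype thetaU *
    (thetaZ * PowerSeries.rescale 3 thetaZ) = PowerSeries.rescale 2 thetaZ ^ 2 := by
  have := congrArg (PowerSeries.map convSubring.subtype) thetaU_mul
  simp only [map_mul, map_pow, map_rescale, map_ofNat] at this
  exact this

lemma thetaZ_W_mul : PowerSeries.map convSubring.subtype thetaW *
    (thetaZ ^ 3 * PowerSeries.rescale 3 thetaZ) =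
      C (nullX ℂ) * PowerSeries.rescale 2 thetaZ ^ 3 := by
  have := congrArg (PowerSeries.map convSubring.subtype) thetaW_mul
  simp only [map_mul, map_pow, map_rescale, map_ofNat, PowerSeries.map_C] at this
  rw [nullX_eq_thetaNull]
  exact this

lemma isUnit_thetaZ : IsUnit thetaZ := isUnit_thetaH.map _

end Comparison

section IntegralQuotients

variable (R : Type*) [CommRing R]

/-- The quotient `(w - w⁻¹) / X` for `w = 1 + X`. -/
def sX : PowerSeries R := (2 + X) * (((onePlusX R)⁻¹ : (PowerSeries R)ˣ) : PowerSeries R)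

lemma X_mul_sX : X * sX R =
    (onePlusX R : PowerSeries R) - (((onePlusX R)⁻¹ : (PowerSeries R)ˣ) : PowerSeries R) := by
  have h : (onePlusX R : PowerSeries R) * (((onePlusX R)⁻¹ : (PowerSeries R)ˣ) : PowerSeries R)
    = 1 := (onePlusX R).mul_inv
  have hw : (onePlusX R : PowerSeries R) = 1 + X := rfl
  rw [sX]
  rw [hw] at h ⊢
  linear_combination (1 + X) * h

lemma map_sX {R' : Type*} [CommRing R'] (f : R →+* R') : PowerSeries.map f (sX R) = sX R' := by
  have h2 := map_onePlusX f (-1)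
  rw [_root_.zpow_neg_one, _root_.zpow_neg_one] at h2
  simp only [sX, map_mul, map_add, map_ofNat, PowerSeries.map_X, h2]

/-- The integral form of `thetaU`. -/
def intU : PowerSeries (PowerSeries R) :=
  3 * thetaX R 2 ^ 2 * Ring.inverse (4 * (thetaX R 1 * thetaX R 3))

/-- The integral form of `thetaW`. -/
def intW : PowerSeries (PowerSeries R) :=
  3 * (C (nullX R) * thetaX R 2 ^ 3) *
    Ring.inverse (8 * (sX (PowerSeries R) * (thetaX R 1 ^ 3 * thetaX R 3)))

variable {R}

lemma isUnit_natCast_doubleSeries {n : ℕ} (h : IsUnit (n : R)) :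
    IsUnit (n : PowerSeries (PowerSeries R)) := by
  have := (h.map (C (R := R))).map (C (R := PowerSeries R))
  simpa using this

lemma isUnit_sX (h2 : IsUnit (2 : R)) : IsUnit (sX R) := by
  refine IsUnit.mul ?_ (Units.isUnit _)
  rw [isUnit_iff_constantCoeff, map_add, map_ofNat, constantCoeff_X, add_zero]
  exact h2

lemma isUnit_intU_denominator (h2 : IsUnit (2 : R)) (h3 : IsUnit (3 : R)) :
    IsUnit (4 * (thetaX R 1 * thetaX R 3)) := by
  refine IsUnit.mul ?_ ((isUnit_thetaX R (by simp)).mul (isUnit_thetaX R (by exact_mod_cast h3)))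
  have := isUnit_natCast_doubleSeries (R := R) (n := 4) (by
    convert h2.pow 2; norm_num)
  exact_mod_cast this

lemma isUnit_intW_denominator (h2 : IsUnit (2 : R)) (h3 : IsUnit (3 : R)) :
    IsUnit (8 * (sX (PowerSeries R) * (thetaX R 1 ^ 3 * thetaX R 3))) := by
  refine IsUnit.mul ?_ ((isUnit_sX ?_).mul
    (((isUnit_thetaX R (by simp)).pow 3).mul (isUnit_thetaX R (by exact_mod_cast h3))))
  · have := isUnit_natCast_doubleSeries (R := R) (n := 8) (by
      convert h2.pow 3; norm_num)
    exact_mod_cast this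
  · have := h2.map (C (R := R))
    rwa [map_ofNat] at this

lemma intU_mul (h2 : IsUnit (2 : R)) (h3 : IsUnit (3 : R)) :
    intU R * (4 * (thetaX R 1 * thetaX R 3)) = 3 * thetaX R 2 ^ 2 := by
  rw [intU, mul_assoc, Ring.inverse_mul_cancel _ (isUnit_intU_denominator h2 h3), mul_one]

lemma intW_mul (h2 : IsUnit (2 : R)) (h3 : IsUnit (3 : R)) :
    intW R * (8 * (sX (PowerSeries R) * (thetaX R 1 ^ 3 * thetaX R 3))) =
      3 * (C (nullX R) * thetaX R 2 ^ 3) := by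
  rw [intW, mul_assoc, Ring.inverse_mul_cancel _ (isUnit_intW_denominator h2 h3), mul_one]

lemma isUnit_intU (h2 : IsUnit (2 : R)) (h3 : IsUnit (3 : R)) : IsUnit (intU R) := by
  refine isUnit_of_mul_isUnit_left (y := 4 * (thetaX R 1 * thetaX R 3)) ?_
  rw [intU_mul h2 h3]
  refine IsUnit.mul ?_ ((isUnit_thetaX R (by exact_mod_cast h2)).pow 2)
  exact_mod_cast isUnit_natCast_doubleSeries (R := R) (n := 3) (by exact_mod_cast h3)

lemma isUnit_intW (h2 : IsUnit (2 : R)) (h3 : IsUnit (3 : R)) : IsUnit (intW R) := by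
  refine isUnit_of_mul_isUnit_left
    (y := 8 * (sX (PowerSeries R) * (thetaX R 1 ^ 3 * thetaX R 3))) ?_
  rw [intW_mul h2 h3]
  refine IsUnit.mul ?_ (((isUnit_nullX R).map _).mul
    ((isUnit_thetaX R (by exact_mod_cast h2)).pow 3))
  exact_mod_cast isUnit_natCast_doubleSeries (R := R) (n := 3) (by exact_mod_cast h3)

/-- The substitution `1 + X = e ^ (Z / 2)` from integral to complex double series. -/
def intSubst (f : R →+* ℂ) : PowerSeries (PowerSeries R) →+* PowerSeries (PowerSeries ℂ) :=
  substZ.comp (PowerSeries.map (PowerSeries.map f))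

lemma intSubst_thetaX (f : R →+* ℂ) (k : ℕ) :
    intSubst f (X * sX (PowerSeries R)) * intSubst f (thetaX R k) =
      (k : PowerSeries (PowerSeries ℂ)) * X * PowerSeries.rescale (k : PowerSeries ℂ) thetaZ := by
  simp only [intSubst, RingHom.comp_apply, map_thetaX]
  rw [map_mul (PowerSeries.map (PowerSeries.map f)), map_sX, PowerSeries.map_X, X_mul_sX,
    substZ_thetaX]

lemma intSubst_C (f : R →+* ℂ) (c : PowerSeries R) :
    intSubst f (C c) = C (PowerSeries.map f c) := by
  rw [intSubst, RingHom.comp_apply, PowerSeries.map_C, substZ, substHom_C]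

lemma constantCoeff_intSubst (f : R →+* ℂ) (P : PowerSeries (PowerSeries R)) :
    constantCoeff (intSubst f P) = PowerSeries.map f (constantCoeff P) := by
  rw [intSubst, RingHom.comp_apply, substZ, constantCoeff_substHom,
    ← coeff_zero_eq_constantCoeff_apply, coeff_map, coeff_zero_eq_constantCoeff_apply]

lemma intSubst_intU (f : R →+* ℂ) (h2 : IsUnit (2 : R)) (h3 : IsUnit (3 : R)) :
    intSubst f (intU R) = PowerSeries.map convSubring.subtype thetaU := by
  have h := congrArg (intSubst f) (intU_mul h2 h3)
  have t1 := intSubst_thetaX f 1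
  have t2 := intSubst_thetaX f 2
  have t3 := intSubst_thetaX f 3
  simp only [map_mul, map_pow, map_ofNat, Nat.cast_one, Nat.cast_ofNat, rescale_one,
    RingHom.id_apply, one_mul] at h t1 t2 t3
  have hu := thetaZ_U_mul
  apply (isUnit_thetaZ.mul (isUnit_thetaZ.map (PowerSeries.rescale 3))).mul_left_cancel
  apply PowerSeries.X_mul_cancel
  apply PowerSeries.X_mul_cancel
  apply mul_left_cancel₀ (a := (12 : PowerSeries (PowerSeries ℂ)))
    (by exact_mod_cast (isUnit_natCast_doubleSeries (R := ℂ) (n := 12) (by simp)).ne_zero)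
  set s := intSubst f X * intSubst f (sX (PowerSeries R))
  set U := intSubst f (intU R)
  set a := intSubst f (thetaX R 1)
  set b := intSubst f (thetaX R 2)
  set c := intSubst f (thetaX R 3)
  set A := thetaZ
  set B := PowerSeries.rescale 2 thetaZ
  set D := PowerSeries.rescale 3 thetaZ
  linear_combination s ^ 2 * h - 4 * U * (s * c) * t1 - 4 * U * (X * A) * t3 +
    3 * (s * b + 2 * X * B) * t2 - 12 * X ^ 2 * hu

lemma intSubst_X_mul_thetaW (f : R →+* ℂ) (h2 : IsUnit (2 : R)) (h3 : IsUnit (3 : R)) :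
    intSubst f X * PowerSeries.map convSubring.subtype thetaW = X * intSubst f (intW R) := by
  have h := congrArg (intSubst f) (intW_mul h2 h3)
  have t1 := intSubst_thetaX f 1
  have t2 := intSubst_thetaX f 2
  have t3 := intSubst_thetaX f 3
  simp only [map_mul, map_pow, map_ofNat, Nat.cast_one, Nat.cast_ofNat, rescale_one,
    RingHom.id_apply, one_mul, intSubst_C, map_nullX] at h t1 t2 t3
  have hu := thetaZ_W_mul
  apply ((isUnit_thetaZ.pow 3).mul (isUnit_thetaZ.map (PowerSeries.rescale 3))).mul_left_cancel
  apply PowerSeries.X_mul_cancel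
  apply PowerSeries.X_mul_cancel
  apply PowerSeries.X_mul_cancel
  apply mul_left_cancel₀ (a := (24 : PowerSeries (PowerSeries ℂ)))
    (by exact_mod_cast (isUnit_natCast_doubleSeries (R := ℂ) (n := 24) (by simp)).ne_zero)
  have p1 := congrArg (· ^ 3) t1
  have p2 := congrArg (· ^ 3) t2
  set x := intSubst f X
  set y := intSubst f (sX (PowerSeries R))
  set W := intSubst f (intW R)
  set a := intSubst f (thetaX R 1)
  set b := intSubst f (thetaX R 2)
  set c := intSubst f (thetaX R 3)
  set A := thetaZ
  set B := PowerSeries.rescale 2 thetaZ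
  set D := PowerSeries.rescale 3 thetaZ
  linear_combination 24 * x * X ^ 3 * hu - x * (x * y) ^ 3 * h +
    8 * W * (x * y * c) * p1 + 8 * W * (X * A) ^ 3 * t3 - 3 * x * C (nullX ℂ) * p2

/-- Complex constants as convergent series. -/
def constConv : ℂ →+* convSubring :=
  (C (R := ℂ)).codRestrict convSubring fun c q _ =>
    summable_of_ne_finset_zero (s := {0}) fun n hn => by
      simp [PowerSeries.coeff_C, show n ≠ 0 by simpa using hn]

/-- The exponential series `e ^ (u Z)` over convergent series. -/
def expConv (u : ℤ) : PowerSeries convSubring :=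
  PowerSeries.map constConv (PowerSeries.rescale (u : ℂ) (PowerSeries.exp ℂ))

/-- The `t`-coefficients of `e ^ (u Z)` are integral power series in `q`. -/
lemma map_tCoeff_int (f : R →+* ℂ) (h2 : IsUnit (2 : R)) (h3 : IsUnit (3 : R)) (M j : ℕ) (u : ℤ) :
    PowerSeries.map f (tCoeff (intW R) j (intU R ^ M *
      ((onePlusX (PowerSeries R) ^ (2 * u) : (PowerSeries (PowerSeries R))ˣ) :
        PowerSeries (PowerSeries R)))) =
      (tCoeff thetaW j (thetaU ^ M * expConv u)).1 := by
  have e1 := tCoeff_map (PowerSeries.map f) (intSubst f)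
    (W' := PowerSeries.map convSubring.subtype thetaW) (isUnit_intW h2 h3) 1
    (intSubst_C f) (constantCoeff_intSubst f)
    (by rw [intSubst_X_mul_thetaW f h2 h3]; simp) j (intU R ^ M *
      ((onePlusX (PowerSeries R) ^ (2 * u) : (PowerSeries (PowerSeries R))ˣ) :
        PowerSeries (PowerSeries R)))
  have e2 := tCoeff_map convSubring.subtype (PowerSeries.map convSubring.subtype)
    (W' := PowerSeries.map convSubring.subtype thetaW) isUnit_thetaW 1
    (fun c => PowerSeries.map_C _ _) (fun Q => by
      rw [← coeff_zero_eq_constantCoeff_apply, coeff_map, coeff_zero_eq_constantCoeff_apply])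
    (by simp) j (thetaU ^ M * expConv u)
  rw [one_pow, one_mul] at e1 e2
  rw [← e1]
  refine Eq.trans ?_ e2
  refine congrArg (tCoeff _ j) ?_
  rw [map_mul, map_mul, map_pow, map_pow, intSubst_intU f h2 h3]
  congr 1
  rw [intSubst, RingHom.comp_apply, map_onePlusX, substZ_onePlusX, expConv]
  rw [show (((2 * u : ℤ) : ℂ) / 2) = u by push_cast; ring]
  ext1 n
  simp only [coeff_map]
  rfl

end IntegralQuotients

section Fourier

/-- Coefficients of an absolutely convergent multiple Fourier series are determined by its sum. -/
lemma eq_zero_of_hasSum_fourier {ι d : Type*} [Fintype d] {e : ι → d → ℤ}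
    (he : Function.Injective e) {c : ι → ℂ} (hc : Summable fun i => ‖c i‖)
    (h : ∀ x : d → ℝ, HasSum (fun i =>
      c i * Complex.exp (2 * Real.pi * I * ∑ j, (e i j : ℂ) * (x j : ℂ))) 0)
    (i : ι) : c i = 0 := by
  have hsum : Summable fun i => c i • UnitAddTorus.mFourier (e i) := by
    refine Summable.of_norm ?_
    simpa [norm_smul, UnitAddTorus.mFourier_norm] using hc
  have hzero : ∑' i, c i • UnitAddTorus.mFourier (e i) = 0 := by
    ext t
    have hx : ∃ x : d → ℝ, (fun j => ((x j : ℝ) : UnitAddCircle)) = t := by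
      choose x hx using fun j => QuotientAddGroup.mk_surjective (t j)
      exact ⟨x, funext hx⟩
    obtain ⟨x, rfl⟩ := hx
    have h1 := (ContinuousMap.evalCLM ℂ (fun j => ((x j : ℝ) : UnitAddCircle))).hasSum hsum.hasSum
    refine h1.unique ((h x).congr_fun fun i => ?_)
    simp only [ContinuousMap.evalCLM_apply, ContinuousMap.smul_apply, smul_eq_mul]
    congr 1
    change ∏ j, fourier (e i j) ((x j : ℝ) : UnitAddCircle) = _
    rw [Finset.mul_sum, Complex.exp_sum]
    refine Finset.prod_congr rfl fun j _ => ?_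
    rw [fourier_coe_apply]
    congr 1
    simp
    ring
  have hs := hsum.hasSum
  rw [hzero] at hs
  let : MeasureTheory.MeasureSpace UnitAddCircle := ⟨AddCircle.haarAddCircle⟩
  have : MeasureTheory.IsProbabilityMeasure
      (MeasureTheory.volume : MeasureTheory.Measure UnitAddCircle) :=
    inferInstanceAs (MeasureTheory.IsProbabilityMeasure AddCircle.haarAddCircle)
  have horth : Orthonormal ℂ fun n : d → ℤ => ContinuousMap.toLp (E := ℂ) 2
      (MeasureTheory.volume : MeasureTheory.Measure (UnitAddTorus d)) ℂ
      (UnitAddTorus.mFourier n) :=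
    UnitAddTorus.orthonormal_mFourier (d := d)
  have h2 := (innerSL ℂ (ContinuousMap.toLp (E := ℂ) 2
      (MeasureTheory.volume : MeasureTheory.Measure (UnitAddTorus d)) ℂ
      (UnitAddTorus.mFourier (e i)))).hasSum ((ContinuousMap.toLp (E := ℂ) 2
      (MeasureTheory.volume : MeasureTheory.Measure (UnitAddTorus d)) ℂ).hasSum hs)
  classical
  rw [map_zero, map_zero] at h2
  refine (HasSum.unique h2 ((hasSum_ite_eq i (c i)).congr_fun fun j => ?_)).symm
  rw [map_smul, map_smul, innerSL_apply_apply, smul_eq_mul,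
    orthonormal_iff_ite.1 horth (e i) (e j)]
  by_cases hij : j = i
  · simp [hij]
  · simp [hij, he.eq_iff, Ne.symm hij]

/-- Two absolutely convergent multiple Fourier series with the same sum agree termwise. -/
lemma eq_of_hasSum_fourier {ι d : Type*} [Fintype d] {e : ι → d → ℤ}
    (he : Function.Injective e) {a b : ι → ℂ} {F : (d → ℝ) → ℂ}
    (ha : ∀ x : d → ℝ,
      HasSum (fun i => a i * Complex.exp (2 * Real.pi * I * ∑ j, (e i j : ℂ) * (x j : ℂ))) (F x))
    (hb : ∀ x : d → ℝ,
      HasSum (fun i => b i * Complex.exp (2 * Real.pi * I * ∑ j, (e i j : ℂ) * (x j : ℂ))) (F x))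
    (i : ι) : a i = b i := by
  have h : ∀ x : d → ℝ, HasSum (fun i => (a i - b i) *
      Complex.exp (2 * Real.pi * I * ∑ j, (e i j : ℂ) * (x j : ℂ))) 0 := by
    intro x
    simpa only [sub_mul, sub_self] using (ha x).sub (hb x)
  refine sub_eq_zero.1 (eq_zero_of_hasSum_fourier he (c := fun i => a i - b i) ?_ h i)
  simpa using (h 0).summable.norm

end Fourier

section Exponential

lemma summable_exp_prod {ι : Type*} {c : ι → ℂ} {u : ι → ℤ}
    (h : ∀ z : ℂ, Summable fun x => ‖c x * Complex.exp (u x * z)‖) (z : ℂ) :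
    Summable fun x : ι × ℕ => c x.1 * ((u x.1 : ℂ) ^ x.2 / x.2.factorial) * z ^ x.2 := by
  have hexp : ∀ x : ι, HasSum (fun j : ℕ => ‖c x‖ * ((|(u x : ℝ)| * ‖z‖) ^ j / j.factorial))
      (‖c x‖ * Real.exp (|(u x : ℝ)| * ‖z‖)) := by
    intro n
    have := NormedSpace.expSeries_div_hasSum_exp (𝔸 := ℝ) (|(u n : ℝ)| * ‖z‖)
    rw [← Real.exp_eq_exp_ℝ] at this
    exact this.mul_left _
  have hs : Summable fun x : ι × ℕ =>
      ‖c x.1‖ * ((|(u x.1 : ℝ)| * ‖z‖) ^ x.2 / x.2.factorial) := by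
    rw [summable_prod_of_nonneg (fun x => by positivity)]
    refine ⟨fun n => (hexp n).summable, ?_⟩
    simp_rw [fun n => (hexp n).tsum_eq]
    refine Summable.of_nonneg_of_le (fun x => by positivity) (fun x => ?_)
      ((h ‖z‖).add (h (-‖z‖)))
    rw [norm_mul, norm_mul, Complex.norm_exp, Complex.norm_exp, ← mul_add]
    refine mul_le_mul_of_nonneg_left ?_ (norm_nonneg _)
    have h1 : ((u x : ℂ) * (‖z‖ : ℂ)).re = (u x : ℝ) * ‖z‖ := by simp
    have h2 : ((u x : ℂ) * (-‖z‖ : ℂ)).re = -(u x : ℝ) * ‖z‖ := by simp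
    rw [h1, h2]
    rcases abs_cases (u x : ℝ) with h | h <;> rw [h.1]
    · exact le_add_of_nonneg_right (Real.exp_pos _).le
    · exact le_add_of_nonneg_left (Real.exp_pos _).le
  refine Summable.of_norm_bounded hs fun x => le_of_eq ?_
  rw [norm_mul, norm_mul, norm_pow, norm_div, norm_pow, mul_pow]
  simp
  ring

/-- Taylor expansion of an everywhere absolutely convergent exponential sum. -/
lemma represents_exp_sum {ι : Type*} {c : ι → ℂ} {u : ι → ℤ}
    (h : ∀ z : ℂ, Summable fun x => ‖c x * Complex.exp (u x * z)‖) :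
    Represents (fun z => ∑' x, c x * Complex.exp (u x * z))
      (PowerSeries.mk fun i => ∑' x, c x * ((u x : ℂ) ^ i / i.factorial)) := by
  intro z
  have hs := summable_exp_prod h z
  have h1 := hs.hasSum.prod_fiberwise (g := fun x => c x * Complex.exp (u x * z)) (fun x => by
    have := NormedSpace.expSeries_div_hasSum_exp (𝔸 := ℂ) ((u x : ℂ) * z)
    rw [← Complex.exp_eq_exp_ℂ] at this
    refine (this.mul_left (c x)).congr_fun fun j => ?_
    rw [mul_pow]; ring)
  have h2 := hs.prod_symm.hasSum.prod_fiberwise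
    (fun j => (hs.prod_symm.prod_factor j).hasSum)
  have h3 : (∑' x : ℕ × ι, c x.swap.1 * ((u x.swap.1 : ℂ) ^ x.swap.2 / x.swap.2.factorial) *
      z ^ x.swap.2) = ∑' x : ι × ℕ, c x.1 * ((u x.1 : ℂ) ^ x.2 / x.2.factorial) * z ^ x.2 :=
    (Equiv.prodComm ℕ ι).tsum_eq
      fun x : ι × ℕ => c x.1 * ((u x.1 : ℂ) ^ x.2 / x.2.factorial) * z ^ x.2
  rw [h3, ← h1.tsum_eq] at h2
  refine h2.congr_fun fun j => ?_
  rw [PowerSeries.coeff_mk, ← tsum_mul_right]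
  rfl

lemma summable_exp_coeff {ι : Type*} {c : ι → ℂ} {u : ι → ℤ}
    (h : ∀ z : ℂ, Summable fun x => ‖c x * Complex.exp (u x * z)‖) (i : ℕ) :
    Summable fun x => ‖c x * ((u x : ℂ) ^ i / i.factorial)‖ := by
  simpa using ((summable_exp_prod h 1).norm.prod_symm).prod_factor i

end Exponential

section Coordinates

lemma sqrtD_neg_four : sqrtD (-4) = 2 * I := by
  have : Real.sqrt 4 = 2 := by
    rw [show (4 : ℝ) = 2 ^ 2 by norm_num, Real.sqrt_sq (by norm_num)]
  simp [sqrtD, this]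

lemma mem_ringInt_neg_four {z : ℂ} :
    z ∈ ringInt (-4) ↔ ∃ a b : ℤ, z = (a : ℂ) + (b : ℂ) * I := by
  rw [ringInt, Set.mem_ofPred_eq, sqrtD_neg_four]
  constructor
  · rintro ⟨a, b, rfl⟩
    exact ⟨a - 2 * b, b, by push_cast; ring⟩
  · rintro ⟨a, b, rfl⟩
    exact ⟨a + 2 * b, b, by push_cast; ring⟩

/-- The Hermitian matrix with diagonal `m, n` and upper right entry `(u + v i) / 2`. -/
def hmat (m u v n : ℤ) : Matrix (Fin 2) (Fin 2) ℂ :=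
  !![(m : ℂ), ((u : ℂ) + v * I) / 2; ((u : ℂ) - v * I) / 2, (n : ℂ)]

lemma hmat_injective : Function.Injective fun x : ℤ × ℤ × ℤ × ℤ =>
    hmat x.2.1 x.2.2.1 x.2.2.2 x.1 := by
  rintro ⟨n, m, u, v⟩ ⟨n', m', u', v'⟩ h
  have h00 := congr_fun (congr_fun h 0) 0
  have h01 := congr_fun (congr_fun h 0) 1
  have h11 := congr_fun (congr_fun h 1) 1
  simp only [hmat, Matrix.of_apply, Matrix.cons_val', Matrix.cons_val_zero, Matrix.cons_val_one,
    Matrix.cons_val_fin_one, Int.cast_inj] at h00 h01 h11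
  have hre := congr_arg Complex.re h01
  have him := congr_arg Complex.im h01
  simp at hre him
  simp [h00, h11, hre, him]

lemma exists_hmat {H : Matrix (Fin 2) (Fin 2) ℂ} (hH : H ∈ HermLattice (-4)) :
    ∃ m u v n : ℤ, H = hmat m u v n ∧ 0 ≤ m ∧ 0 ≤ n ∧ u ^ 2 + v ^ 2 ≤ 4 * (m * n) := by
  obtain ⟨⟨hherm, hdiag, hoff⟩, hpos⟩ := hH
  obtain ⟨m, hm⟩ := hdiag 0
  obtain ⟨n, hn⟩ := hdiag 1
  obtain ⟨a, b, hab⟩ := mem_ringInt_neg_four.1 (hoff 0 1)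
  rw [sqrtD_neg_four] at hab
  have h01 : H 0 1 = ((b : ℂ) + ((-a : ℤ) : ℂ) * I) / 2 := by
    have : H 0 1 = -I * (2 * I * H 0 1) / 2 := by
      linear_combination (H 0 1) * I_mul_I
    rw [this, hab]
    push_cast
    linear_combination (-(b : ℂ) / 2) * I_mul_I
  have h10 : H 1 0 = ((b : ℂ) - ((-a : ℤ) : ℂ) * I) / 2 := by
    have := hherm.apply 0 1
    rw [← star_star (H 1 0), this, h01]
    simp [sub_eq_add_neg]
  have hH : H = hmat m b (-a) n := by
    ext i j
    fin_cases i <;> fin_cases j <;> simp [hmat, hm, hn, h01, h10]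
  refine ⟨m, b, -a, n, hH, ?_, ?_, ?_⟩
  · have := hpos.diag_nonneg (i := 0)
    rw [hm] at this
    exact_mod_cast this
  · have := hpos.diag_nonneg (i := 1)
    rw [hn] at this
    exact_mod_cast this
  · have := hpos.det_nonneg
    rw [hH, hmat, Matrix.det_fin_two_of] at this
    have h2 : (m : ℂ) * n - ((b : ℂ) + ((-a : ℤ) : ℂ) * I) / 2 *
        (((b : ℂ) - ((-a : ℤ) : ℂ) * I) / 2) =
        (((m * n - (b ^ 2 + a ^ 2) / 4 : ℝ)) : ℂ) := by
      push_cast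
      linear_combination ((a : ℂ) ^ 2 / 4) * I_mul_I
    rw [h2] at this
    have h3 : (0 : ℝ) ≤ m * n - (b ^ 2 + a ^ 2) / 4 := by exact_mod_cast this
    have h4 : (b : ℝ) ^ 2 + (-a) ^ 2 ≤ 4 * (m * n) := by linarith [neg_sq (a : ℝ)]
    exact_mod_cast h4

/-- Points of the Hermitian half-space in coordinates for which `tr (H Z)` is linear. -/
def zmat (τ a b τ' : ℂ) : Matrix (Fin 2) (Fin 2) ℂ := !![τ, a + b * I; a - b * I, τ']

lemma trace_hmat_mul_zmat (m u v n : ℤ) (τ a b τ' : ℂ) :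
    (hmat m u v n * zmat τ a b τ').trace = m * τ + u * a + v * b + n * τ' := by
  simp [hmat, zmat, Matrix.trace_fin_two]
  linear_combination (-(v : ℂ) * b) * I_mul_I

lemma zmat_mem {τ a b τ' : ℂ} (h1 : 0 < τ.im) (h2 : a.im ^ 2 + b.im ^ 2 < τ.im * τ'.im) :
    zmat τ a b τ' ∈ HermitianUpperHalfSpace := by
  have key : (zmat τ a b τ' - (zmat τ a b τ')ᴴ).map (fun w => w / (2 * Complex.I)) =
      !![(τ.im : ℂ), (a.im : ℂ) + b.im * I; (a.im : ℂ) - b.im * I, (τ'.im : ℂ)] := by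
    ext i j
    fin_cases i <;> fin_cases j <;>
    · simp [zmat]
      apply Complex.ext <;> simp [Complex.div_re, Complex.div_im] <;> ring
  rw [HermitianUpperHalfSpace, Set.mem_ofPred_eq, key]
  refine Matrix.PosDef.of_dotProduct_mulVec_pos ?_ ?_
  · ext i j
    fin_cases i <;> fin_cases j <;> simp [sub_eq_add_neg]
  · intro x hx
    have : star x ⬝ᵥ (!![(τ.im : ℂ), (a.im : ℂ) + b.im * I; (a.im : ℂ) - b.im * I, (τ'.im : ℂ)] *ᵥ x)
        = ((τ.im * ((x 0).re ^ 2 + (x 0).im ^ 2) + τ'.im * ((x 1).re ^ 2 + (x 1).im ^ 2) +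
          2 * (a.im * ((x 0).re * (x 1).re + (x 0).im * (x 1).im) +
            b.im * ((x 0).im * (x 1).re - (x 0).re * (x 1).im)) : ℝ) : ℂ) := by
      apply Complex.ext <;>
      · simp [dotProduct, Matrix.mulVec, Fin.sum_univ_two, pow_two]
        ring
    rw [this]
    have hpos : 0 < (x 0).re ^ 2 + (x 0).im ^ 2 + ((x 1).re ^ 2 + (x 1).im ^ 2) := by
      by_contra hcon
      apply hx
      have e1 : (x 0).re = 0 := by nlinarith
      have e2 : (x 0).im = 0 := by nlinarith
      have e3 : (x 1).re = 0 := by nlinarith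
      have e4 : (x 1).im = 0 := by nlinarith
      funext i
      fin_cases i <;> apply Complex.ext <;> simpa
    rw [Complex.zero_lt_real]
    generalize (x 0).re = p at *
    generalize (x 0).im = q at *
    generalize (x 1).re = r at *
    generalize (x 1).im = s at *
    generalize τ.im = t at *
    generalize τ'.im = t' at *
    generalize a.im = α at *
    generalize b.im = β at *
    have hid : t * (t * (p ^ 2 + q ^ 2) + t' * (r ^ 2 + s ^ 2) +
        2 * (α * (p * r + q * s) + β * (q * r - p * s))) =
        (t * p + α * r - β * s) ^ 2 + (t * q + α * s + β * r) ^ 2 +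
          (t * t' - (α ^ 2 + β ^ 2)) * (r ^ 2 + s ^ 2) := by ring
    refine pos_of_mul_pos_right ?_ h1.le
    rw [hid]
    by_cases hrs : r ^ 2 + s ^ 2 = 0
    · have hr : r = 0 := by nlinarith
      have hs : s = 0 := by nlinarith
      subst hr hs
      have : 0 < t ^ 2 * (p ^ 2 + q ^ 2) := by
        apply mul_pos (pow_pos h1 2)
        linarith
      nlinarith
    · have : 0 < r ^ 2 + s ^ 2 := lt_of_le_of_ne (by positivity) (Ne.symm hrs)
      have := mul_pos (sub_pos.2 h2) this
      positivity

end Coordinates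

section Transformation

variable {k : ℤ} (f : HermitianModularForm (-4) k)

/-- The Fourier coefficient at `hmat m u v n`. -/
def fcoeff (m u v n : ℤ) : ℂ := f.coeff (hmat m u v n)

lemma fcoeff_ne_zero {m u v n : ℤ} (h : fcoeff f m u v n ≠ 0) :
    0 ≤ m ∧ 0 ≤ n ∧ u ^ 2 + v ^ 2 ≤ 4 * (m * n) := by
  obtain ⟨m', u', v', n', he, h'⟩ := exists_hmat (f.coeff_supported _ h)
  have := @hmat_injective (n, m, u, v) (n', m', u', v') he
  simp only [Prod.mk.injEq] at this
  obtain ⟨rfl, rfl, rfl, rfl⟩ := this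
  exact h'

lemma hasSum_fcoeff {τ a b τ' : ℂ} (h1 : 0 < τ.im) (h2 : a.im ^ 2 + b.im ^ 2 < τ.im * τ'.im) :
    HasSum (fun x : ℤ × ℤ × ℤ × ℤ => fcoeff f x.2.1 x.2.2.1 x.2.2.2 x.1 *
      Complex.exp (2 * Real.pi * I * (x.2.1 * τ + x.2.2.1 * a + x.2.2.2 * b + x.1 * τ')))
      (f.toFun (zmat τ a b τ')) := by
  have h := f.expansion _ (zmat_mem h1 h2)
  have h' : HasSum (fun H : Matrix (Fin 2) (Fin 2) ℂ => f.coeff H *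
      Complex.exp (2 * Real.pi * I * (H * zmat τ a b τ').trace)) (f.toFun (zmat τ a b τ')) := by
    refine (hasSum_subtype_iff_of_support_subset (s := HermLattice (-4)) ?_).1 h
    intro H hH
    exact f.coeff_supported H (left_ne_zero_of_mul hH)
  refine ((hmat_injective.hasSum_iff ?_).2 h').congr_fun fun x => ?_
  · intro H hH
    by_contra hne
    obtain ⟨m, u, v, n, rfl, -⟩ := exists_hmat (f.coeff_supported H (left_ne_zero_of_mul hne))
    exact hH ⟨(n, m, u, v), rfl⟩
  · simp only [Function.comp_apply, trace_hmat_mul_zmat, fcoeff]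

lemma toFun_conj {U V Z : Matrix (Fin 2) (Fin 2) ℂ} (hU : ∀ i j, U i j ∈ ringInt (-4))
    (hV : ∀ i j, V i j ∈ ringInt (-4)) (hUV : Uᴴ * V = 1) (hdet : U.det * V.det = 1)
    (hZ : Z ∈ HermitianUpperHalfSpace) :
    f.toFun (U * Z * Uᴴ) = V.det ^ k * f.toFun Z := by
  have h0 : (0 : ℂ) ∈ ringInt (-4) := mem_ringInt_neg_four.2 ⟨0, 0, by simp⟩
  have hVU : Vᴴ * U = 1 := by
    have := congr_arg Matrix.conjTranspose hUV
    simpa using this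
  have hM : Matrix.fromBlocks U 0 0 V ∈ HermitianModularGroup (-4) := by
    refine ⟨?_, ?_⟩
    · rintro (i | i) (j | j) <;> simp [hU, hV, h0]
    · rw [J2, Matrix.fromBlocks_conjTranspose, Matrix.fromBlocks_multiply,
        Matrix.fromBlocks_multiply]
      simp [hUV, hVU]
  have h := f.transform _ hM Z hZ
  have hinv : V⁻¹ = Uᴴ := Matrix.inv_eq_left_inv hUV
  simpa [matAct, nuChar, Matrix.det_fromBlocks_zero₂₁, hdet, hinv] using h

lemma toFun_S {τ a b τ' : ℂ} (h1 : 0 < τ.im) (h2 : a.im ^ 2 + b.im ^ 2 < τ.im * τ'.im) :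
    f.toFun (zmat (-1 / τ) (a / τ) (b / τ) (τ' - (a ^ 2 + b ^ 2) / τ)) =
      τ ^ k * f.toFun (zmat τ a b τ') := by
  have hτ : τ ≠ 0 := by
    rintro rfl
    simp at h1
  have h0 : (0 : ℂ) ∈ ringInt (-4) := mem_ringInt_neg_four.2 ⟨0, 0, by simp⟩
  have h1' : (1 : ℂ) ∈ ringInt (-4) := mem_ringInt_neg_four.2 ⟨1, 0, by simp⟩
  have h1'' : (-1 : ℂ) ∈ ringInt (-4) := mem_ringInt_neg_four.2 ⟨-1, 0, by simp⟩
  have hM : Matrix.fromBlocks !![0, 0; 0, 1] !![-1, 0; 0, 0] !![1, 0; 0, 0] !![0, 0; 0, 1] ∈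
      HermitianModularGroup (-4) := by
    refine ⟨?_, ?_⟩
    · rintro (i | i) (j | j) <;> fin_cases i <;> fin_cases j <;> simp [h0, h1', h1'']
    · rw [J2, Matrix.fromBlocks_conjTranspose, Matrix.fromBlocks_multiply,
        Matrix.fromBlocks_multiply]
      congr 1 <;> ext i j <;> fin_cases i <;> fin_cases j <;>
        simp [Matrix.mul_apply, Fin.sum_univ_two]
  have hdet : (Matrix.fromBlocks !![0, 0; 0, 1] !![-1, 0; 0, 0] !![1, 0; 0, 0]
      !![(0 : ℂ), 0; 0, 1]).det = 1 := by
    have : Matrix.fromBlocks !![0, 0; 0, 1] !![-1, 0; 0, 0] !![1, 0; 0, 0] !![(0 : ℂ), 0; 0, 1] =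
        Matrix.fromBlocks 1 !![-1, 0; 0, 0] 0 1 * Matrix.fromBlocks 1 0 !![1, 0; 0, 0] 1 *
          Matrix.fromBlocks 1 !![-1, 0; 0, 0] 0 1 := by
      rw [Matrix.fromBlocks_multiply, Matrix.fromBlocks_multiply]
      congr 1 <;> ext i j <;> fin_cases i <;> fin_cases j <;>
        simp [Matrix.mul_apply, Fin.sum_univ_two]
    rw [this, Matrix.det_mul, Matrix.det_mul, Matrix.det_fromBlocks_zero₂₁,
      Matrix.det_fromBlocks_zero₁₂]
    simp
  have h := f.transform _ hM _ (zmat_mem h1 h2)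
  rw [nuChar, hdet] at h
  have hden : !![(1 : ℂ), 0; 0, 0] * zmat τ a b τ' + !![0, 0; 0, 1] = !![τ, a + b * I; 0, 1] := by
    ext i j
    fin_cases i <;> fin_cases j <;> simp [zmat]
  have hinv : !![τ, a + b * I; 0, 1]⁻¹ = !![τ⁻¹, -(a + b * I) / τ; 0, 1] := by
    refine Matrix.inv_eq_left_inv ?_
    ext i j
    fin_cases i <;> fin_cases j <;> simp [hτ]
    field_simp
    ring
  have hact : matAct (Matrix.fromBlocks !![0, 0; 0, 1] !![-1, 0; 0, 0] !![1, 0; 0, 0]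
      !![(0 : ℂ), 0; 0, 1]) (zmat τ a b τ') =
      zmat (-1 / τ) (a / τ) (b / τ) (τ' - (a ^ 2 + b ^ 2) / τ) := by
    rw [matAct, Matrix.toBlocks_fromBlocks₁₁, Matrix.toBlocks_fromBlocks₁₂,
      Matrix.toBlocks_fromBlocks₂₁, Matrix.toBlocks_fromBlocks₂₂, hden, hinv]
    ext i j
    fin_cases i <;> fin_cases j <;> simp [zmat]
    · ring
    · ring
    · field_simp
    · field_simp
      linear_combination (b ^ 2) * I_mul_I
  rw [hact, Matrix.toBlocks_fromBlocks₂₁, Matrix.toBlocks_fromBlocks₂₂, hden] at h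
  simpa [Matrix.det_fin_two_of] using h

end Transformation

section CoefficientSymmetry

variable {k : ℤ} (f : HermitianModularForm (-4) k)

lemma fcoeff_eq_of_hasSum (ρ : Equiv.Perm (ℤ × ℤ × ℤ × ℤ))
    (h : ∀ τ a b τ' : ℂ, τ.im = 1 → a.im = 0 → b.im = 0 → τ'.im = 1 →
      HasSum (fun x : ℤ × ℤ × ℤ × ℤ => fcoeff f x.2.1 x.2.2.1 x.2.2.2 x.1 *
        Complex.exp (2 * Real.pi * I * ((ρ x).2.1 * τ + (ρ x).2.2.1 * a + (ρ x).2.2.2 * b +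
          (ρ x).1 * τ'))) (f.toFun (zmat τ a b τ'))) (x : ℤ × ℤ × ℤ × ℤ) :
    fcoeff f x.2.1 x.2.2.1 x.2.2.2 x.1 =
      fcoeff f (ρ x).2.1 (ρ x).2.2.1 (ρ x).2.2.2 (ρ x).1 := by
  set c : ℤ × ℤ × ℤ × ℤ → ℂ := fun x => fcoeff f x.2.1 x.2.2.1 x.2.2.2 x.1 with hc
  set E : ℤ × ℤ × ℤ × ℤ → ℂ := fun x => Complex.exp (2 * Real.pi * I * (x.2.1 * I + x.1 * I))
  have he : Function.Injective fun x : ℤ × ℤ × ℤ × ℤ => ![x.2.1, x.2.2.1, x.2.2.2, x.1] := by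
    rintro ⟨n, m, u, v⟩ ⟨n', m', u', v'⟩ h
    have h0 := congr_fun h 0
    have h1 := congr_fun h 1
    have h2 := congr_fun h 2
    have h3 := congr_fun h 3
    simp at h0 h1 h2 h3
    simp [*]
  have key := eq_of_hasSum_fourier he (a := fun y => c (ρ.symm y) * E y) (b := fun y => c y * E y)
    (F := fun x => f.toFun (zmat (x 0 + I) (x 1) (x 2) (x 3 + I))) (fun x => ?_) (fun x => ?_) (ρ x)
  · simp only [Equiv.symm_apply_apply] at key
    exact mul_right_cancel₀ (Complex.exp_ne_zero _) key
  · have := h (x 0 + I) (x 1) (x 2) (x 3 + I) (by simp) (by simp) (by simp) (by simp)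
    rw [← ρ.symm.hasSum_iff] at this
    refine this.congr_fun fun y => ?_
    simp only [Function.comp_apply, Equiv.apply_symm_apply, mul_assoc, E, hc]
    rw [← Complex.exp_add]
    congr 2
    simp [Fin.sum_univ_four]
    ring
  · have := hasSum_fcoeff f (τ := x 0 + I) (a := x 1) (b := x 2) (τ' := x 3 + I) (by simp)
      (by simp)
    refine this.congr_fun fun y => ?_
    simp only [mul_assoc, E, hc]
    rw [← Complex.exp_add]
    congr 2
    simp [Fin.sum_univ_four]
    ring

lemma fcoeff_swap (hk : Even k) (m u v n : ℤ) :
    fcoeff f m u v n = fcoeff f n u (-v) m := by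
  let ρ : Equiv.Perm (ℤ × ℤ × ℤ × ℤ) :=
    { toFun := fun x => (x.2.1, x.1, x.2.2.1, -x.2.2.2)
      invFun := fun x => (x.2.1, x.1, x.2.2.1, -x.2.2.2)
      left_inv := fun x => by simp
      right_inv := fun x => by simp }
  refine fcoeff_eq_of_hasSum f ρ (fun τ a b τ' h1 h2 h3 h4 => ?_) (n, m, u, v)
  have hlaw := toFun_conj f (U := !![0, 1; 1, 0]) (V := !![0, 1; 1, 0]) (Z := zmat τ a b τ')
    (by
      intro i j
      rw [mem_ringInt_neg_four]
      fin_cases i <;> fin_cases j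
      exacts [⟨0, 0, by simp⟩, ⟨1, 0, by simp⟩, ⟨1, 0, by simp⟩, ⟨0, 0, by simp⟩])
    (by
      intro i j
      rw [mem_ringInt_neg_four]
      fin_cases i <;> fin_cases j
      exacts [⟨0, 0, by simp⟩, ⟨1, 0, by simp⟩, ⟨1, 0, by simp⟩, ⟨0, 0, by simp⟩])
    (by ext i j; fin_cases i <;> fin_cases j <;> simp [Matrix.mul_apply]) (by simp [Matrix.det_fin_two_of])
    (zmat_mem (by simp [h1]) (by simp [h1, h2, h3, h4]))
  have hz : !![(0 : ℂ), 1; 1, 0] * zmat τ a b τ' * !![(0 : ℂ), 1; 1, 0]ᴴ = zmat τ' a (-b) τ := by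
    ext i j
    fin_cases i <;> fin_cases j <;> simp [zmat, Matrix.mul_apply, sub_eq_add_neg]
  have hdet : (!![(0 : ℂ), 1; 1, 0]).det ^ k = 1 := by
    rw [Matrix.det_fin_two_of]
    simpa using hk.neg_one_zpow
  rw [hz, hdet, one_mul] at hlaw
  rw [← hlaw]
  refine (hasSum_fcoeff f (τ := τ') (a := a) (b := -b) (τ' := τ) (by simp [h4])
    (by simp [h1, h2, h3, h4])).congr_fun fun x => ?_
  congr 3
  simp only [ρ, Equiv.coe_fn_mk]
  push_cast
  ring

lemma fcoeff_shift_left (m u v n : ℤ) :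
    fcoeff f m u v n = fcoeff f (m + u + n) (u + 2 * n) v n := by
  let ρ : Equiv.Perm (ℤ × ℤ × ℤ × ℤ) :=
    { toFun := fun x => (x.1, x.2.1 + x.2.2.1 + x.1, x.2.2.1 + 2 * x.1, x.2.2.2)
      invFun := fun x => (x.1, x.2.1 - x.2.2.1 + x.1, x.2.2.1 - 2 * x.1, x.2.2.2)
      left_inv := fun x => by ext <;> simp; ring
      right_inv := fun x => by ext <;> simp; ring }
  refine fcoeff_eq_of_hasSum f ρ (fun τ a b τ' h1 h2 h3 h4 => ?_) (n, m, u, v)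
  have hlaw := toFun_conj f (U := !![1, 0; 1, 1]) (V := !![1, -1; 0, 1]) (Z := zmat τ a b τ')
    (by
      intro i j
      rw [mem_ringInt_neg_four]
      fin_cases i <;> fin_cases j
      exacts [⟨1, 0, by simp⟩, ⟨0, 0, by simp⟩, ⟨1, 0, by simp⟩, ⟨1, 0, by simp⟩])
    (by
      intro i j
      rw [mem_ringInt_neg_four]
      fin_cases i <;> fin_cases j
      exacts [⟨1, 0, by simp⟩, ⟨-1, 0, by simp⟩, ⟨0, 0, by simp⟩, ⟨1, 0, by simp⟩])
    (by ext i j; fin_cases i <;> fin_cases j <;> simp [Matrix.mul_apply]) (by simp [Matrix.det_fin_two_of])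
    (zmat_mem (by simp [h1]) (by simp [h1, h2, h3, h4]))
  have hz : !![(1 : ℂ), 0; 1, 1] * zmat τ a b τ' * !![(1 : ℂ), 0; 1, 1]ᴴ =
      zmat τ (a + τ) b (τ' + 2 * a + τ) := by
    ext i j
    fin_cases i <;> fin_cases j <;> simp [zmat, Matrix.mul_apply] <;> ring
  rw [hz, Matrix.det_fin_two_of, mul_one, mul_zero, sub_zero, _root_.one_zpow, one_mul] at hlaw
  rw [← hlaw]
  refine (hasSum_fcoeff f (τ := τ) (a := a + τ) (b := b) (τ' := τ' + 2 * a + τ) (by simp [h1])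
    (by simp [h1, h2, h3, h4])).congr_fun fun x => ?_
  congr 3
  simp only [ρ, Equiv.coe_fn_mk]
  push_cast
  ring

lemma fcoeff_shift_right (m u v n : ℤ) :
    fcoeff f m u v n = fcoeff f (m + v + n) u (v + 2 * n) n := by
  let ρ : Equiv.Perm (ℤ × ℤ × ℤ × ℤ) :=
    { toFun := fun x => (x.1, x.2.1 + x.2.2.2 + x.1, x.2.2.1, x.2.2.2 + 2 * x.1)
      invFun := fun x => (x.1, x.2.1 - x.2.2.2 + x.1, x.2.2.1, x.2.2.2 - 2 * x.1)
      left_inv := fun x => by ext <;> simp; ring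
      right_inv := fun x => by ext <;> simp; ring }
  refine fcoeff_eq_of_hasSum f ρ (fun τ a b τ' h1 h2 h3 h4 => ?_) (n, m, u, v)
  have hlaw := toFun_conj f (U := !![1, 0; -I, 1]) (V := !![1, -I; 0, 1]) (Z := zmat τ a b τ')
    (by
      intro i j
      rw [mem_ringInt_neg_four]
      fin_cases i <;> fin_cases j
      exacts [⟨1, 0, by simp⟩, ⟨0, 0, by simp⟩, ⟨0, -1, by simp⟩, ⟨1, 0, by simp⟩])
    (by
      intro i j
      rw [mem_ringInt_neg_four]
      fin_cases i <;> fin_cases j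
      exacts [⟨1, 0, by simp⟩, ⟨0, -1, by simp⟩, ⟨0, 0, by simp⟩, ⟨1, 0, by simp⟩])
    (by ext i j; fin_cases i <;> fin_cases j <;> simp [Matrix.mul_apply]) (by simp [Matrix.det_fin_two_of])
    (zmat_mem (by simp [h1]) (by simp [h1, h2, h3, h4]))
  have hz : !![(1 : ℂ), 0; -I, 1] * zmat τ a b τ' * !![(1 : ℂ), 0; -I, 1]ᴴ =
      zmat τ a (b + τ) (τ' + 2 * b + τ) := by
    ext i j
    fin_cases i <;> fin_cases j <;> simp [zmat, Matrix.mul_apply]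
    · ring
    · ring
    · linear_combination (-2 * b - τ) * I_mul_I
  rw [hz, Matrix.det_fin_two_of, mul_one, mul_zero, sub_zero, _root_.one_zpow, one_mul] at hlaw
  rw [← hlaw]
  refine (hasSum_fcoeff f (τ := τ) (a := a) (b := b + τ) (τ' := τ' + 2 * b + τ) (by simp [h1])
    (by simp [h1, h2, h3, h4])).congr_fun fun x => ?_
  congr 3
  simp only [ρ, Equiv.coe_fn_mk]
  push_cast
  ring

end CoefficientSymmetry

section FourierJacobi

variable {k : ℤ} (f : HermitianModularForm (-4) k)

/-- The terms of the Fourier–Jacobi coefficient of index `n`. -/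
def fjTerm (n : ℤ) (τ z w : ℂ) (y : ℤ × ℤ × ℤ) : ℂ :=
  fcoeff f y.1 y.2.1 y.2.2 n * Complex.exp (2 * Real.pi * I * (y.1 * τ)) *
    (Complex.exp (y.2.1 * z) * Complex.exp (y.2.2 * w))

lemma two_pi_I_mul_div (z : ℂ) : 2 * Real.pi * I * (z / (2 * Real.pi * I)) = z := by
  have : (2 * Real.pi * I : ℂ) ≠ 0 := Complex.two_pi_I_ne_zero
  field_simp

lemma hasSum_fjTerm_prod {τ z w τ' : ℂ} (h1 : 0 < τ.im)
    (h2 : (z / (2 * Real.pi * I)).im ^ 2 + (w / (2 * Real.pi * I)).im ^ 2 < τ.im * τ'.im) :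
    HasSum (fun x : ℤ × ℤ × ℤ × ℤ => fjTerm f x.1 τ z w x.2 *
      Complex.exp (2 * Real.pi * I * (x.1 * τ')))
      (f.toFun (zmat τ (z / (2 * Real.pi * I)) (w / (2 * Real.pi * I)) τ')) := by
  refine (hasSum_fcoeff f h1 h2).congr_fun fun x => ?_
  rw [fjTerm, mul_assoc, mul_assoc, ← Complex.exp_add, ← Complex.exp_add, ← Complex.exp_add]
  congr 2
  rw [mul_add, mul_add, mul_add, mul_left_comm _ (x.2.2.1 : ℂ), mul_left_comm _ (x.2.2.2 : ℂ),
    two_pi_I_mul_div, two_pi_I_mul_div]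
  ring

lemma exists_im_bound (s c A : ℝ) (hs : 0 < s) : ∃ t : ℝ, A < s * (t + c) := by
  refine ⟨A / s + 1 - c, ?_⟩
  have : s * (A / s + 1 - c + c) = A + s := by field_simp; ring
  linarith

lemma summable_fjTerm (n : ℤ) {τ : ℂ} (h1 : 0 < τ.im) (z w : ℂ) :
    Summable fun y => ‖fjTerm f n τ z w y‖ := by
  obtain ⟨t, ht⟩ := exists_im_bound τ.im 0
    ((z / (2 * Real.pi * I)).im ^ 2 + (w / (2 * Real.pi * I)).im ^ 2) h1
  have h := (hasSum_fjTerm_prod f (τ' := t * I) h1 (by simpa using ht)).summable.norm.prod_factor n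
  simp only [norm_mul] at h
  simpa only [norm_mul] using (summable_mul_right_iff (norm_ne_zero_iff.2 (Complex.exp_ne_zero _))).1 h

/-- The Fourier–Jacobi coefficient of index `n`. -/
def fjSum (n : ℤ) (τ z w : ℂ) : ℂ := ∑' y, fjTerm f n τ z w y

lemma hasSum_fjSum {τ z w τ' : ℂ} (h1 : 0 < τ.im)
    (h2 : (z / (2 * Real.pi * I)).im ^ 2 + (w / (2 * Real.pi * I)).im ^ 2 < τ.im * τ'.im) :
    HasSum (fun n : ℤ => fjSum f n τ z w * Complex.exp (2 * Real.pi * I * (n * τ')))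
      (f.toFun (zmat τ (z / (2 * Real.pi * I)) (w / (2 * Real.pi * I)) τ')) :=
  (hasSum_fjTerm_prod f h1 h2).prod_fiberwise fun n =>
    (summable_fjTerm f n h1 z w).of_norm.hasSum.mul_right _

lemma fjSum_S (n : ℤ) (τ : ℍ) (z w : ℂ) :
    fjSum f n ((ModularGroup.S • τ : ℍ) : ℂ) ((τ : ℂ)⁻¹ * z) ((τ : ℂ)⁻¹ * w) =
      (τ : ℂ) ^ k * (Complex.exp (2 * n * gaussExp τ * z ^ 2) *
        Complex.exp (2 * n * gaussExp τ * w ^ 2)) * fjSum f n τ z w := by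
  have hτ : (τ : ℂ) ≠ 0 := τ.ne_zero
  have hS : ((ModularGroup.S • τ : ℍ) : ℂ) = -1 / (τ : ℂ) := by
    rw [coe_S_smul]
  set a := z / (2 * Real.pi * I) with ha
  set b := w / (2 * Real.pi * I) with hb
  have ha' : (τ : ℂ)⁻¹ * z / (2 * Real.pi * I) = a / τ := by rw [ha]; ring
  have hb' : (τ : ℂ)⁻¹ * w / (2 * Real.pi * I) = b / τ := by rw [hb]; ring
  set δ := (a ^ 2 + b ^ 2) / (τ : ℂ) with hδ
  obtain ⟨t₁, ht₁⟩ := exists_im_bound (τ : ℂ).im 0 (a.im ^ 2 + b.im ^ 2) τ.im_pos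
  obtain ⟨t₂, ht₂⟩ := exists_im_bound ((ModularGroup.S • τ : ℍ) : ℂ).im (-δ.im)
    ((a / τ).im ^ 2 + (b / τ).im ^ 2) (ModularGroup.S • τ).im_pos
  set t := max t₁ t₂ with ht
  have h1 : a.im ^ 2 + b.im ^ 2 < (τ : ℂ).im * t := by
    refine ht₁.trans_le ?_
    rw [add_zero]
    exact mul_le_mul_of_nonneg_left (le_max_left _ _) τ.im_pos.le
  have h2 : (a / τ).im ^ 2 + (b / τ).im ^ 2 <
      ((ModularGroup.S • τ : ℍ) : ℂ).im * (t - δ.im) := by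
    refine ht₂.trans_le ?_
    rw [← sub_eq_add_neg]
    exact mul_le_mul_of_nonneg_left (sub_le_sub_right (le_max_right _ _) _)
      (ModularGroup.S • τ).im_pos.le
  have he : Function.Injective fun (n : ℤ) (_ : Unit) => n := fun _ _ h => congr_fun h ()
  have key := eq_of_hasSum_fourier he
    (a := fun n => fjSum f n ((ModularGroup.S • τ : ℍ) : ℂ) ((τ : ℂ)⁻¹ * z) ((τ : ℂ)⁻¹ * w) *
      Complex.exp (2 * Real.pi * I * (n * (t * I - δ))))
    (b := fun n => (τ : ℂ) ^ k * (fjSum f n τ z w * Complex.exp (2 * Real.pi * I * (n * (t * I)))))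
    (F := fun x => (τ : ℂ) ^ k * f.toFun (zmat τ a b (x () + t * I)))
    (fun x => ?_) (fun x => ?_) n
  · have e1 : Complex.exp (2 * Real.pi * I * (n * (t * I - δ))) =
        Complex.exp (2 * Real.pi * I * (n * (t * I))) *
          Complex.exp (-(2 * Real.pi * I * (n * δ))) := by
      rw [← Complex.exp_add]; congr 1; ring
    have e2 : Complex.exp (2 * n * gaussExp τ * z ^ 2) *
        Complex.exp (2 * n * gaussExp τ * w ^ 2) = Complex.exp (2 * Real.pi * I * (n * δ)) := by
      rw [← Complex.exp_add]
      congr 1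
      have hπ : (Real.pi : ℂ) ≠ 0 := Complex.ofReal_ne_zero.2 Real.pi_ne_zero
      rw [hδ, ha, hb, gaussExp]
      field_simp
      rw [I_sq]
      ring
    have e3 : Complex.exp (-(2 * Real.pi * I * (n * δ))) * Complex.exp (2 * Real.pi * I * (n * δ))
        = 1 := by rw [← Complex.exp_add]; simp
    simp only [e1] at key
    have e4 := Complex.exp_ne_zero (2 * Real.pi * I * (n * (t * I)))
    rw [e2]
    apply mul_left_cancel₀ e4
    linear_combination (Complex.exp (2 * Real.pi * I * (n * δ))) * key -
      (Complex.exp (2 * Real.pi * I * (n * (t * I))) *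
        fjSum f n ((ModularGroup.S • τ : ℍ) : ℂ) ((τ : ℂ)⁻¹ * z) ((τ : ℂ)⁻¹ * w)) * e3
  · have h := hasSum_fjSum f (τ := ((ModularGroup.S • τ : ℍ) : ℂ)) (z := (τ : ℂ)⁻¹ * z)
      (w := (τ : ℂ)⁻¹ * w) (τ' := x () + t * I - δ) (ModularGroup.S • τ).im_pos
      (by rw [ha', hb']; simpa using h2)
    rw [ha', hb'] at h
    rw [← toFun_S f (τ := (τ : ℂ)) τ.im_pos (by simpa using h1), ← hδ]
    rw [hS] at h ⊢
    refine h.congr_fun fun n => ?_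
    rw [mul_assoc, ← Complex.exp_add]
    congr 2
    simp
    ring
  · have h := hasSum_fjSum f (τ := (τ : ℂ)) (z := z) (w := w) (τ' := x () + t * I) τ.im_pos
      (by simpa using h1)
    refine (h.mul_left _).congr_fun fun n => ?_
    rw [mul_assoc, mul_assoc, ← Complex.exp_add]
    congr 3
    simp
    ring

end FourierJacobi

section Jets

variable {k : ℤ} (f : HermitianModularForm (-4) k)

/-- The terms of the Taylor coefficients of the Fourier–Jacobi coefficient of index `n`. -/
def jetTerm (n : ℤ) (i i' : ℕ) (τ : ℂ) (y : ℤ × ℤ × ℤ) : ℂ :=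
  fcoeff f y.1 y.2.1 y.2.2 n * Complex.exp (2 * Real.pi * I * (y.1 * τ)) *
    ((y.2.1 : ℂ) ^ i / i.factorial) * ((y.2.2 : ℂ) ^ i' / i'.factorial)

lemma summable_halfJetTerm (n : ℤ) (i : ℕ) {τ : ℂ} (hτ : 0 < τ.im) (w : ℂ) :
    Summable fun y : ℤ × ℤ × ℤ =>
      ‖fcoeff f y.1 y.2.1 y.2.2 n * Complex.exp (2 * Real.pi * I * (y.1 * τ)) *
        ((y.2.1 : ℂ) ^ i / i.factorial) * Complex.exp (y.2.2 * w)‖ := by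
  have := summable_exp_coeff (c := fun y : ℤ × ℤ × ℤ => fcoeff f y.1 y.2.1 y.2.2 n *
    Complex.exp (2 * Real.pi * I * (y.1 * τ)) * Complex.exp (y.2.2 * w)) (u := fun y => y.2.1)
    (fun z => by
      refine (summable_fjTerm f n hτ z w).congr fun y => ?_
      rw [fjTerm]
      congr 1
      ring) i
  refine this.congr fun y => ?_
  congr 1
  ring

lemma summable_jetTerm (n : ℤ) (i i' : ℕ) {τ : ℂ} (hτ : 0 < τ.im) :
    Summable fun y => ‖jetTerm f n i i' τ y‖ :=
  summable_exp_coeff (c := fun y : ℤ × ℤ × ℤ => fcoeff f y.1 y.2.1 y.2.2 n *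
    Complex.exp (2 * Real.pi * I * (y.1 * τ)) * ((y.2.1 : ℂ) ^ i / i.factorial))
    (u := fun y => y.2.2) (fun w => summable_halfJetTerm f n i hτ w) i'

/-- A finite set containing the possible off-diagonal indices for diagonal `(m, M)`. -/
def box (M m : ℕ) : Finset (ℤ × ℤ) :=
  Finset.Icc (-(m + M : ℤ)) (m + M) ×ˢ Finset.Icc (-(m + M : ℤ)) (m + M)

lemma mem_box {M m : ℕ} {u v : ℤ} (h : fcoeff f m u v M ≠ 0) : (u, v) ∈ box M m := by
  obtain ⟨-, -, h⟩ := fcoeff_ne_zero f h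
  have h1 : u ^ 2 ≤ (m + M : ℤ) ^ 2 := by nlinarith [sq_nonneg v, sq_nonneg (m - M : ℤ)]
  have h2 : v ^ 2 ≤ (m + M : ℤ) ^ 2 := by nlinarith [sq_nonneg u, sq_nonneg (m - M : ℤ)]
  have h1 := abs_le_of_sq_le_sq' h1 (by positivity)
  have h2 := abs_le_of_sq_le_sq' h2 (by positivity)
  exact Finset.mem_product.2 ⟨Finset.mem_Icc.2 h1, Finset.mem_Icc.2 h2⟩

/-- The Taylor coefficients of the Fourier–Jacobi coefficient of index `M`, as `q`-series. -/
def jetSeries (M i i' : ℕ) : PowerSeries ℂ := PowerSeries.mk fun m => ∑ y ∈ box M m,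
  fcoeff f m y.1 y.2 M * ((y.1 : ℂ) ^ i / i.factorial) * ((y.2 : ℂ) ^ i' / i'.factorial)

lemma exp_mul_natCast (m : ℕ) (τ : ℂ) :
    Complex.exp (2 * Real.pi * I * ((m : ℤ) * τ)) = Function.Periodic.qParam 1 τ ^ m := by
  rw [Function.Periodic.qParam, ← Complex.exp_nat_mul]
  congr 1
  push_cast
  ring

lemma hasSum_jetSeries (M i i' : ℕ) {τ : ℂ} (hτ : 0 < τ.im) :
    HasSum (fun m => coeff m (jetSeries f M i i') * Function.Periodic.qParam 1 τ ^ m)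
      (∑' y, jetTerm f M i i' τ y) := by
  have h := (summable_jetTerm f M i i' hτ).of_norm.hasSum
  have hinj : Function.Injective (Prod.map (Nat.cast : ℕ → ℤ) (id : ℤ × ℤ → ℤ × ℤ)) :=
    Nat.cast_injective.prodMap Function.injective_id
  rw [← hinj.hasSum_iff] at h
  · refine h.prod_fiberwise fun m => ?_
    rw [jetSeries, coeff_mk, Finset.sum_mul]
    have : ∀ y ∈ box M m, fcoeff f m y.1 y.2 M * ((y.1 : ℂ) ^ i / i.factorial) *
        ((y.2 : ℂ) ^ i' / i'.factorial) * Function.Periodic.qParam 1 τ ^ m =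
        ((jetTerm f M i i' τ) ∘ Prod.map Nat.cast id) (m, y) := by
      intro y _
      simp only [Function.comp_apply, Prod.map_apply, id_eq, jetTerm, exp_mul_natCast]
      ring
    rw [Finset.sum_congr rfl this]
    refine hasSum_sum_of_ne_finset_zero fun y hy => ?_
    have : fcoeff f m y.1 y.2 M = 0 := by
      by_contra hne
      exact hy (mem_box f hne)
    simp [jetTerm, this]
  · rintro ⟨m, y⟩ hy
    have : fcoeff f m y.1 y.2 M = 0 := by
      by_contra hne
      refine hy ⟨(m.toNat, y), ?_⟩
      simp [(fcoeff_ne_zero f hne).1]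
    simp [jetTerm, this]

lemma jetSeries_mem (M i i' : ℕ) : jetSeries f M i i' ∈ convSubring := by
  rw [mem_convSubring]
  intro q hq
  by_cases h0 : q = 0
  · subst h0
    refine summable_of_ne_finset_zero (s := {0}) fun m hm => ?_
    simp only [Finset.mem_singleton] at hm
    simp [hm]
  · have him := Function.Periodic.im_invQParam_pos_of_norm_lt_one (h := 1) one_pos hq h0
    have := (hasSum_jetSeries f M i i' him).summable.norm
    rwa [Function.Periodic.qParam_right_inv one_ne_zero h0] at this

/-- The weights turning Taylor coefficients into modular quantities. -/
def jetWeight (M j i : ℕ) : convSubring := tCoeff thetaW j (thetaU ^ M * PowerSeries.X ^ i)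

lemma evalUHP_jetWeight (M j i : ℕ) (τ : ℍ) :
    evalUHP τ (jetWeight M j i) = tCoeff (thetaWAt τ) j (thetaUAt τ ^ M * PowerSeries.X ^ i) := by
  have := tCoeff_map (evalUHP τ) (PowerSeries.map (evalUHP τ)) (W := thetaW) (W' := thetaWAt τ)
    isUnit_thetaW 1 (fun c => PowerSeries.map_C _ c)
    (fun Q => by rw [← coeff_zero_eq_constantCoeff_apply, coeff_map,
      coeff_zero_eq_constantCoeff_apply])
    (by simp [thetaWAt]) j (thetaU ^ M * PowerSeries.X ^ i)
  rw [one_pow, one_mul, map_mul (PowerSeries.map (evalUHP τ)), map_pow, map_pow,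
    PowerSeries.map_X] at this
  rw [jetWeight, ← this, thetaUAt]

/-- The modified Taylor coefficients of the Fourier–Jacobi coefficient of index `M`. -/
def jetForm (M j j' : ℕ) : convSubring :=
  ∑ i ∈ Finset.range (j + 1), ∑ i' ∈ Finset.range (j' + 1),
    jetWeight M j i * jetWeight M j' i' * ⟨jetSeries f M i i', jetSeries_mem f M i i'⟩

lemma evalUHP_jetSeries (M i i' : ℕ) (τ : ℍ) :
    evalUHP τ ⟨jetSeries f M i i', jetSeries_mem f M i i'⟩ = ∑' y, jetTerm f M i i' τ y :=
  (hasSum_evalUHP _ τ).unique (hasSum_jetSeries f M i i' τ.im_pos)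

/-- The partially modified Fourier–Jacobi coefficient. -/
def halfJet (M j : ℕ) (τ : ℍ) (w : ℂ) : ℂ := ∑' y : ℤ × ℤ × ℤ,
  fcoeff f y.1 y.2.1 y.2.2 M * Complex.exp (2 * Real.pi * I * (y.1 * τ)) *
    (∑ i ∈ Finset.range (j + 1), evalUHP τ (jetWeight M j i) *
      ((y.2.1 : ℂ) ^ i / i.factorial)) * Complex.exp (y.2.2 * w)

lemma halfJet_S (M j : ℕ) (τ : ℍ) (w : ℂ) :
    halfJet f M j (ModularGroup.S • τ) ((τ : ℂ)⁻¹ * w) =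
      (τ : ℂ) ^ (k + j) * (Complex.exp (2 * M * gaussExp τ * w ^ 2) * halfJet f M j τ w) := by
  set P : ℍ → ℂ → PowerSeries ℂ := fun τ w => PowerSeries.mk fun i => ∑' y : ℤ × ℤ × ℤ,
    fcoeff f y.1 y.2.1 y.2.2 M * Complex.exp (2 * Real.pi * I * (y.1 * τ)) *
      Complex.exp (y.2.2 * w) * ((y.2.1 : ℂ) ^ i / i.factorial) with hP
  have hrep : ∀ (τ : ℍ) (w : ℂ), Represents (fun z => fjSum f M τ z w) (P τ w) := by
    intro τ w
    have := represents_exp_sum (c := fun y : ℤ × ℤ × ℤ => fcoeff f y.1 y.2.1 y.2.2 M *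
      Complex.exp (2 * Real.pi * I * (y.1 * τ)) * Complex.exp (y.2.2 * w)) (u := fun y => y.2.1)
      (fun z => by
        refine (summable_fjTerm f M τ.im_pos z w).congr fun y => ?_
        rw [fjTerm]
        congr 1
        ring)
    convert this using 2 with z
    refine tsum_congr fun y => ?_
    rw [fjTerm]
    ring
  have hjet : ∀ (τ : ℍ) (w : ℂ),
      tCoeff (thetaWAt τ) j (thetaUAt τ ^ M * P τ w) = halfJet f M j τ w := by
    intro τ w
    rw [tCoeff_eq_sum, halfJet]
    simp_rw [Finset.mul_sum, Finset.sum_mul]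
    rw [Summable.tsum_finsetSum]
    · refine Finset.sum_congr rfl fun i _ => ?_
      rw [hP, coeff_mk, ← evalUHP_jetWeight, ← tsum_mul_right]
      refine tsum_congr fun y => ?_
      ring
    · intro i _
      refine ((summable_halfJetTerm f M i τ.im_pos w).of_norm.mul_left
        (evalUHP τ (jetWeight M j i))).congr fun y => ?_
      ring
  have hlaw : PowerSeries.rescale (τ : ℂ)⁻¹ (P (ModularGroup.S • τ) ((τ : ℂ)⁻¹ * w)) =
      C ((τ : ℂ) ^ k * Complex.exp (2 * M * gaussExp τ * w ^ 2)) *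
        (gaussSeries (2 * M * gaussExp τ) * P τ w) := by
    refine ((hrep (ModularGroup.S • τ) ((τ : ℂ)⁻¹ * w)).rescale (τ : ℂ)⁻¹).unique ?_
    have := (represents_C ((τ : ℂ) ^ k * Complex.exp (2 * M * gaussExp τ * w ^ 2))).mul
      ((represents_gaussSeries (2 * M * gaussExp τ)).mul (hrep τ w))
    convert this using 2 with z
    rw [fjSum_S]
    push_cast
    ring
  have h := tCoeff_S τ M j _ hlaw
  rw [hjet, hjet] at h
  rw [h, _root_.zpow_add₀ τ.ne_zero, zpow_natCast]
  ring

lemma evalUHP_jetForm_S (M j j' : ℕ) (τ : ℍ) :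
    evalUHP (ModularGroup.S • τ) (jetForm f M j j') =
      (τ : ℂ) ^ (k + j + j') * evalUHP τ (jetForm f M j j') := by
  set P : ℍ → PowerSeries ℂ := fun τ => PowerSeries.mk fun i' => ∑' y : ℤ × ℤ × ℤ,
    fcoeff f y.1 y.2.1 y.2.2 M * Complex.exp (2 * Real.pi * I * (y.1 * τ)) *
    (∑ i ∈ Finset.range (j + 1), evalUHP τ (jetWeight M j i) *
      ((y.2.1 : ℂ) ^ i / i.factorial)) * ((y.2.2 : ℂ) ^ i' / i'.factorial) with hP
  have hrep : ∀ τ : ℍ, Represents (fun w => halfJet f M j τ w) (P τ) := by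
    intro τ
    refine represents_exp_sum (c := fun y : ℤ × ℤ × ℤ => fcoeff f y.1 y.2.1 y.2.2 M *
      Complex.exp (2 * Real.pi * I * (y.1 * τ)) *
      (∑ i ∈ Finset.range (j + 1), evalUHP τ (jetWeight M j i) *
      ((y.2.1 : ℂ) ^ i / i.factorial))) (u := fun y => y.2.2) (fun w => ?_)
    refine Summable.norm ?_
    simp_rw [Finset.mul_sum, Finset.sum_mul]
    refine summable_sum fun i _ => ?_
    refine ((summable_halfJetTerm f M i τ.im_pos w).of_norm.mul_left
        (evalUHP τ (jetWeight M j i))).congr fun y => ?_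
    ring
  have hjet : ∀ τ : ℍ,
      tCoeff (thetaWAt τ) j' (thetaUAt τ ^ M * P τ) = evalUHP τ (jetForm f M j j') := by
    intro τ
    rw [tCoeff_eq_sum, jetForm, Finset.sum_comm, map_sum]
    refine Finset.sum_congr rfl fun i' _ => ?_
    rw [hP, coeff_mk, ← evalUHP_jetWeight, map_sum]
    simp_rw [Finset.mul_sum, Finset.sum_mul]
    rw [Summable.tsum_finsetSum, Finset.sum_mul]
    · refine Finset.sum_congr rfl fun i _ => ?_
      rw [map_mul, map_mul, evalUHP_jetSeries, ← tsum_mul_right, ← tsum_mul_left]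
      refine tsum_congr fun y => ?_
      rw [jetTerm]
      ring
    · intro i _
      refine ((summable_jetTerm f M i i' τ.im_pos).of_norm.mul_left
        (evalUHP τ (jetWeight M j i))).congr fun y => ?_
      rw [jetTerm]
      ring
  have hlaw : PowerSeries.rescale (τ : ℂ)⁻¹ (P (ModularGroup.S • τ)) =
      C ((τ : ℂ) ^ (k + j)) * (gaussSeries (2 * M * gaussExp τ) * P τ) := by
    refine ((hrep (ModularGroup.S • τ)).rescale (τ : ℂ)⁻¹).unique ?_
    have := (represents_C ((τ : ℂ) ^ (k + j))).mul
      ((represents_gaussSeries (2 * M * gaussExp τ)).mul (hrep τ))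
    convert this using 2 with w
    rw [halfJet_S]
  have h := tCoeff_S τ M j' _ hlaw
  rw [hjet, hjet] at h
  rw [h, _root_.zpow_add₀ τ.ne_zero (k + j), zpow_natCast]

/-- The modified Taylor coefficients are elliptic modular forms. -/
lemma exists_modularForm_jetForm (M j j' : ℕ) :
    ∃ g : ModularForm 𝒮ℒ (k + j + j'), qExpansion 1 g = (jetForm f M j j').1 := by
  obtain ⟨g, hg, -⟩ := exists_modularForm_of_S_law _ (evalUHP_jetForm_S f M j j')
  exact ⟨g, hg⟩

/-- The contribution of an exponential to a modified Taylor coefficient. -/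
def expJet (M j : ℕ) (u : ℤ) : convSubring := tCoeff thetaW j (thetaU ^ M * expConv u)

lemma expJet_eq_sum (M j : ℕ) (u : ℤ) : expJet M j u =
    ∑ i ∈ Finset.range (j + 1), constConv ((u : ℂ) ^ i / i.factorial) * jetWeight M j i := by
  rw [expJet, tCoeff_eq_sum]
  refine Finset.sum_congr rfl fun i _ => ?_
  rw [jetWeight, expConv, coeff_map, coeff_rescale, PowerSeries.coeff_exp]
  congr 2
  simp [div_eq_mul_inv]

lemma coeff_expJet_mul (M j j' N : ℕ) (u v : ℤ) :
    coeff N (expJet M j u * expJet M j' v).1 =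
      ∑ i ∈ Finset.range (j + 1), ∑ i' ∈ Finset.range (j' + 1),
        ((u : ℂ) ^ i / i.factorial) * ((v : ℂ) ^ i' / i'.factorial) *
          coeff N (jetWeight M j i * jetWeight M j' i').1 := by
  rw [expJet_eq_sum, expJet_eq_sum, Finset.sum_mul_sum, AddSubmonoidClass.coe_finsetSum, map_sum]
  refine Finset.sum_congr rfl fun i _ => ?_
  rw [AddSubmonoidClass.coe_finsetSum, map_sum]
  refine Finset.sum_congr rfl fun i' _ => ?_
  rw [mul_mul_mul_comm, ← map_mul constConv]
  exact PowerSeries.coeff_C_mul _ _ _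

lemma coeff_jetForm (M j j' N : ℕ) : coeff N (jetForm f M j j').1 =
    ∑ x ∈ Finset.HasAntidiagonal.antidiagonal N, ∑ y ∈ box M x.2,
      coeff x.1 (expJet M j y.1 * expJet M j' y.2).1 * fcoeff f x.2 y.1 y.2 M := by
  simp_rw [coeff_expJet_mul, Finset.sum_mul]
  rw [jetForm, AddSubmonoidClass.coe_finsetSum, map_sum]
  simp_rw [AddSubmonoidClass.coe_finsetSum, map_sum]
  have : ∀ i i', coeff N (jetWeight M j i * jetWeight M j' i' *
      ⟨jetSeries f M i i', jetSeries_mem f M i i'⟩ : convSubring).1 =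
      ∑ x ∈ Finset.HasAntidiagonal.antidiagonal N, ∑ y ∈ box M x.2,
        ((y.1 : ℂ) ^ i / i.factorial) * ((y.2 : ℂ) ^ i' / i'.factorial) *
          coeff x.1 (jetWeight M j i * jetWeight M j' i').1 * fcoeff f x.2 y.1 y.2 M := by
    intro i i'
    change coeff N ((jetWeight M j i * jetWeight M j' i').1 * jetSeries f M i i') = _
    rw [coeff_mul]
    refine Finset.sum_congr rfl fun x _ => ?_
    rw [jetSeries, coeff_mk, Finset.mul_sum]
    refine Finset.sum_congr rfl fun y _ => ?_
    ring
  simp_rw [this]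
  simp_rw [Finset.sum_comm (t := Finset.HasAntidiagonal.antidiagonal N)]
  refine Finset.sum_congr rfl fun x _ => ?_
  simp_rw [Finset.sum_comm (t := box M x.2)]

end Jets

section Vanishing

variable {R : Type*} [CommRing R]

lemma eq_zero_of_X_pow_dvd_sum (h2 : IsUnit (2 : R)) (n : ℕ) (r : ℕ → R)
    (h : (X : PowerSeries R) ^ n ∣ ∑ i ∈ Finset.range n, C (r i) * (X * (2 + X)) ^ i) :
    ∀ i < n, r i = 0 := by
  intro i
  induction i using Nat.strong_induction_on with
  | _ i ih =>
    intro hi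
    have h0 := PowerSeries.X_pow_dvd_iff.1 h i hi
    rw [map_sum, Finset.sum_eq_single i] at h0
    · have : coeff i (C (r i) * (X * (2 + X)) ^ i : PowerSeries R) = r i * 2 ^ i := by
        rw [coeff_C_mul, mul_pow, coeff_X_pow_mul', if_pos le_rfl, Nat.sub_self,
          coeff_zero_eq_constantCoeff_apply, map_pow, map_add, constantCoeff_X, add_zero,
          map_ofNat]
      rw [this] at h0
      exact ((h2.pow i).mul_left_eq_zero).1 h0
    · intro j hj hji
      rcases lt_or_gt_of_ne hji with hlt | hgt
      · rw [ih j hlt (hlt.trans hi)]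
        simp
      · rw [coeff_C_mul, mul_pow, coeff_X_pow_mul', if_neg (not_le.2 hgt), mul_zero]
    · intro hni
      exact absurd (Finset.mem_range.2 hi) hni

lemma eq_zero_of_X_pow_dvd_sum_sq (h2 : IsUnit (2 : R)) (n : ℕ) (r : ℕ → R)
    (h : (X : PowerSeries R) ^ n ∣ ∑ i ∈ Finset.range n, C (r i) * ((1 + X) ^ 2) ^ i) :
    ∀ i < n, r i = 0 := by
  nontriviality R
  set Q : Polynomial R := ∑ i ∈ Finset.range n, Polynomial.C (r i) * Polynomial.X ^ i with hQ
  have hcoeff : ∀ i < n, Q.coeff i = r i := by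
    intro i hi
    simp [hQ, Polynomial.coeff_C_mul, Polynomial.coeff_X_pow, hi]
  have hdeg : Q.degree < n := by
    refine Polynomial.degree_sum_fin_lt (fun i : Fin n => r i) |>.trans_le' ?_
    rw [hQ, Finset.sum_range]
  set T := Polynomial.taylor 1 Q with hT
  have hTdeg : T.degree < n := by rwa [hT, Polynomial.degree_taylor]
  have hsum : ∑ i ∈ Finset.range n, C (r i) * ((1 + X) ^ 2) ^ i =
      ∑ i ∈ Finset.range n, (C (T.coeff i) * (X * (2 + X)) ^ i : PowerSeries R) := by
    have e1 : ∑ i ∈ Finset.range n, C (r i) * ((1 + X) ^ 2) ^ i =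
        Q.eval₂ (C : R →+* PowerSeries R) ((1 + X) ^ 2) := by
      rw [hQ, Polynomial.eval₂_finsetSum]
      simp
    have e2 : ∑ i ∈ Finset.range n, (C (T.coeff i) * (X * (2 + X)) ^ i : PowerSeries R) =
        T.eval₂ (C : R →+* PowerSeries R) (X * (2 + X)) := by
      rw [Polynomial.eval₂_def, Polynomial.sum_def]
      refine (Finset.sum_subset (fun i hi => ?_) fun i _ hi => ?_).symm
      · rw [Finset.mem_range]
        by_contra hin
        exact Polynomial.mem_support_iff.1 hi (Polynomial.coeff_eq_zero_of_degree_lt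
          (hTdeg.trans_le (by exact_mod_cast not_lt.1 hin)))
      · rw [Polynomial.notMem_support_iff.1 hi]
        simp
    rw [e1, e2, hT, Polynomial.taylor_apply, Polynomial.eval₂_comp]
    congr 1
    simp
    ring
  rw [hsum] at h
  have hz := eq_zero_of_X_pow_dvd_sum h2 n _ h
  have hT0 : T = 0 := by
    ext i
    rw [Polynomial.coeff_zero]
    by_cases hi : i < n
    · exact hz i hi
    · exact Polynomial.coeff_eq_zero_of_degree_lt (hTdeg.trans_le (by exact_mod_cast not_lt.1 hi))
  have hQ0 : Q = 0 := Polynomial.taylor_injective 1 (by rw [← hT, hT0, map_zero])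
  intro i hi
  rw [← hcoeff i hi, hQ0, Polynomial.coeff_zero]

lemma sum_Icc_eq_sum_range {A : Type*} [AddCommMonoid A] (M : ℕ) (F : ℤ → A) :
    ∑ u ∈ Finset.Icc (-(M : ℤ)) M, F u = ∑ i ∈ Finset.range (2 * M + 1), F ((i : ℤ) - M) := by
  refine (Finset.sum_nbij' (fun i : ℕ => (i : ℤ) - M) (fun u : ℤ => (u + M).toNat) ?_ ?_ ?_ ?_
    ?_).symm
  · intro i hi
    simp at hi ⊢
    omega
  · intro u hu
    simp at hu ⊢
    omega
  · intro i hi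
    simp
  · intro u hu
    simp at hu ⊢
    omega
  · intro i hi
    rfl

/-- Exponents in a short interval are separated by the twisted Taylor coefficients. -/
lemma eq_zero_of_sum_tCoeff {U W : PowerSeries R} (h2 : IsUnit (2 : R)) (hU : IsUnit U)
    (hW : IsUnit W) (M : ℕ) (e : ℤ → R)
    (h : ∀ j ≤ 2 * M, ∑ u ∈ Finset.Icc (-(M : ℤ)) M,
      e u * tCoeff W j (U ^ M * ↑(onePlusX R ^ (2 * u))) = 0) :
    ∀ u ∈ Finset.Icc (-(M : ℤ)) M, e u = 0 := by
  set Q : PowerSeries R := ∑ u ∈ Finset.Icc (-(M : ℤ)) M, C (e u) * ↑(onePlusX R ^ (2 * u))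
    with hQ
  have hdvd : X ^ (2 * M + 1) ∣ U ^ M * Q := by
    refine X_pow_dvd_of_tCoeff_eq_zero hW _ _ fun j hj => ?_
    rw [← h j (by omega), hQ, Finset.mul_sum, map_sum]
    refine Finset.sum_congr rfl fun u _ => ?_
    rw [mul_left_comm, ← PowerSeries.smul_eq_C_mul, map_smul, smul_eq_mul]
  rw [(hU.pow M).dvd_mul_left] at hdvd
  have hdvd2 : X ^ (2 * M + 1) ∣ ∑ i ∈ Finset.range (2 * M + 1),
      C (e ((i : ℤ) - M)) * ((1 + X : PowerSeries R) ^ 2) ^ i := by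
    have : ∑ i ∈ Finset.range (2 * M + 1),
        C (e ((i : ℤ) - M)) * ((1 + X : PowerSeries R) ^ 2) ^ i =
        Q * (1 + X) ^ (2 * M) := by
      rw [hQ, sum_Icc_eq_sum_range, Finset.sum_mul]
      refine Finset.sum_congr rfl fun i _ => ?_
      rw [mul_assoc]
      congr 1
      have hval : (1 + X : PowerSeries R) = ((onePlusX R : (PowerSeries R)ˣ) : PowerSeries R) := rfl
      rw [hval, ← pow_mul, ← Units.val_pow_eq_pow_val, ← Units.val_pow_eq_pow_val,
        ← Units.val_mul, ← zpow_natCast, ← zpow_natCast, ← _root_.zpow_add]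
      congr 2
      push_cast
      ring
    rw [this]
    exact hdvd.mul_right _
  have key := eq_zero_of_X_pow_dvd_sum_sq h2 _ (fun i => e ((i : ℤ) - M)) hdvd2
  intro u hu
  rw [Finset.mem_Icc] at hu
  have := key (u + M).toNat (by omega)
  rwa [show (((u + M).toNat : ℕ) : ℤ) - M = u by omega] at this

end Vanishing

section Arithmetic

/-- The twisted Taylor coefficients of an exponential, with integral coefficients. -/
def intJet (R : Type*) [CommRing R] (M j : ℕ) (u : ℤ) : PowerSeries R :=
  tCoeff (intW R) j (intU R ^ M *
    ((onePlusX (PowerSeries R) ^ (2 * u) : (PowerSeries (PowerSeries R))ˣ) :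
      PowerSeries (PowerSeries R)))

lemma map_intJet_mul {O : Subring ℂ} (h2 : IsUnit (2 : O)) (h3 : IsUnit (3 : O))
    (M j j' : ℕ) (u v : ℤ) :
    PowerSeries.map O.subtype (intJet O M j u * intJet O M j' v) =
      (expJet M j u * expJet M j' v).1 := by
  rw [map_mul, intJet, intJet, map_tCoeff_int _ h2 h3, map_tCoeff_int _ h2 h3]
  rfl

lemma constantCoeff_intJet {R S : Type*} [CommRing R] [CommRing S] (g : R →+* S)
    (h2 : IsUnit (2 : R)) (h3 : IsUnit (3 : R)) (M j : ℕ) (u : ℤ) :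
    g (constantCoeff (intJet R M j u)) =
      tCoeff (PowerSeries.map (g.comp constantCoeff) (intW R)) j
        (PowerSeries.map (g.comp constantCoeff) (intU R) ^ M *
          ((onePlusX S ^ (2 * u) : (PowerSeries S)ˣ) : PowerSeries S)) := by
  have := tCoeff_map (g.comp constantCoeff) (PowerSeries.map (g.comp constantCoeff))
    (W' := PowerSeries.map (g.comp constantCoeff) (intW R)) (isUnit_intW h2 h3) 1
    (fun c => PowerSeries.map_C _ c)
    (fun Q => by rw [← coeff_zero_eq_constantCoeff_apply, coeff_map,
      coeff_zero_eq_constantCoeff_apply])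
    (by simp) j (intU R ^ M *
    ((onePlusX (PowerSeries R) ^ (2 * u) : (PowerSeries (PowerSeries R))ˣ) :
      PowerSeries (PowerSeries R)))
  rw [one_pow, one_mul, map_mul (PowerSeries.map (g.comp constantCoeff)), map_pow,
    map_onePlusX] at this
  rw [this]
  rfl

variable {k : ℤ} {f : HermitianModularForm (-4) k} {O : Subring ℂ} {J : Submodule O ℂ}

lemma mul_mem_of_mem {z w : ℂ} (hz : z ∈ O) (hw : w ∈ J) : z * w ∈ J :=
  J.smul_mem (⟨z, hz⟩ : O) hw

/-- A doubly indexed family in `O` lies in `J` if all its jets do. -/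
lemma mem_of_sum_jets_mem (h2 : IsUnit (2 : O)) (h3 : IsUnit (3 : O)) (M : ℕ) (a : ℤ → ℤ → O)
    (h : ∀ j ≤ 2 * M, ∀ j' ≤ 2 * M,
      ((∑ u ∈ Finset.Icc (-(M : ℤ)) M, ∑ v ∈ Finset.Icc (-(M : ℤ)) M,
        constantCoeff (intJet O M j u * intJet O M j' v) * a u v : O) : ℂ) ∈ J) :
    ∀ u ∈ Finset.Icc (-(M : ℤ)) M, ∀ v ∈ Finset.Icc (-(M : ℤ)) M, (a u v : ℂ) ∈ J := by
  set A : Ideal O := J.comap (Algebra.linearMap O ℂ) with hA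
  have hmem : ∀ z : O, Ideal.Quotient.mk A z = 0 ↔ (z : ℂ) ∈ J := fun z => by
    rw [Ideal.Quotient.eq_zero_iff_mem]
    rfl
  set g := Ideal.Quotient.mk A with hg
  have hg2 : IsUnit (2 : O ⧸ A) := by
    have := h2.map g
    rwa [map_ofNat] at this
  have hU := (isUnit_intU h2 h3).map (PowerSeries.map (g.comp (constantCoeff (R := O))))
  have hW := (isUnit_intW h2 h3).map (PowerSeries.map (g.comp (constantCoeff (R := O))))
  have key : ∀ j' ≤ 2 * M, ∀ u ∈ Finset.Icc (-(M : ℤ)) M,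
      ∑ v ∈ Finset.Icc (-(M : ℤ)) M, g (a u v) * g (constantCoeff (intJet O M j' v)) = 0 := by
    intro j' hj'
    refine eq_zero_of_sum_tCoeff hg2 hU hW M _ fun j hj => ?_
    have := (hmem _).2 (h j hj j' hj')
    rw [map_sum] at this
    rw [← this]
    refine Finset.sum_congr rfl fun u _ => ?_
    rw [← constantCoeff_intJet g h2 h3, map_sum, Finset.sum_mul]
    refine Finset.sum_congr rfl fun v _ => ?_
    rw [map_mul, map_mul, map_mul]
    ring
  intro u hu v hv
  rw [← hmem]
  refine eq_zero_of_sum_tCoeff hg2 hU hW M (fun v => g (a u v)) (fun j' hj' => ?_) v hv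
  rw [← key j' hj' u hu]
  exact Finset.sum_congr rfl fun v _ => by rw [← constantCoeff_intJet g h2 h3]

lemma fcoeff_eq_reduce_left (f : HermitianModularForm (-4) k) (m u v n : ℤ) :
    fcoeff f m u v n = fcoeff f (m - u + n) (u - 2 * n) v n := by
  rw [fcoeff_shift_left f (m - u + n)]
  congr 1 <;> ring

lemma fcoeff_eq_reduce_right (f : HermitianModularForm (-4) k) (m u v n : ℤ) :
    fcoeff f m u v n = fcoeff f (m - v + n) u (v - 2 * n) n := by
  rw [fcoeff_shift_right f (m - v + n)]
  congr 1 <;> ring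

/-- Coefficients with large off-diagonal part reduce to smaller diagonal part. -/
lemma fcoeff_mem_of_notMem_Icc {M : ℕ} {m : ℤ}
    (h : ∀ m' < m, ∀ u v : ℤ, fcoeff f m' u v M ∈ J) {u v : ℤ}
    (huv : ¬ (u ∈ Finset.Icc (-(M : ℤ)) M ∧ v ∈ Finset.Icc (-(M : ℤ)) M)) :
    fcoeff f m u v M ∈ J := by
  simp only [Finset.mem_Icc] at huv
  by_cases h1 : (M : ℤ) < u
  · rw [fcoeff_eq_reduce_left]
    exact h _ (by omega) _ _
  by_cases h2 : u < -(M : ℤ)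
  · rw [fcoeff_shift_left]
    exact h _ (by omega) _ _
  by_cases h3 : (M : ℤ) < v
  · rw [fcoeff_eq_reduce_right]
    exact h _ (by omega) _ _
  · rw [fcoeff_shift_right]
    exact h _ (by omega) _ _

/-- A Sturm bound for the Fourier–Jacobi coefficient of index `M`. -/
lemma fcoeff_mem_of_lt (h2 : IsUnit (2 : O)) (h3 : IsUnit (3 : O))
    (hO : ∀ m u v n : ℤ, fcoeff f m u v n ∈ O) {M N : ℕ} (hN : k + 4 * M < 12 * N)
    (h : ∀ m : ℕ, m < N → ∀ u v : ℤ, fcoeff f m u v M ∈ J) (m : ℤ) :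
    ∀ u v : ℤ, fcoeff f m u v M ∈ J := by
  have hexp : ∀ (j j' : ℕ) (u v : ℤ) (n : ℕ),
      coeff n (expJet M j u * expJet M j' v).1 ∈ O := by
    intro j j' u v n
    rw [← map_intJet_mul h2 h3, coeff_map]
    exact Subtype.property _
  have hform : ∀ j ≤ 2 * M, ∀ j' ≤ 2 * M, ∀ n, coeff n (jetForm f M j j').1 ∈ J := by
    intro j hj j' hj'
    obtain ⟨g, hg⟩ := exists_modularForm_jetForm f M j j'
    rw [← hg]
    refine sturm_levelOne_congruence O J (discriminant_coeff_mem O) N g ?_ (by omega) ?_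
    · intro n
      rw [hg, coeff_jetForm]
      exact sum_mem fun x _ => sum_mem fun y _ => mul_mem (hexp _ _ _ _ _) (hO _ _ _ _)
    · intro n hn
      rw [hg, coeff_jetForm]
      refine sum_mem fun x hx => sum_mem fun y _ => mul_mem_of_mem (hexp _ _ _ _ _) ?_
      have := Finset.HasAntidiagonal.mem_antidiagonal.1 hx
      exact h _ (by omega) _ _
  rcases lt_or_ge m 0 with hm | hm
  · intro u v
    have : fcoeff f m u v M = 0 := by
      by_contra hne
      exact absurd (fcoeff_ne_zero f hne).1 (not_le.2 hm)
    rw [this]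
    exact zero_mem _
  lift m to ℕ using hm
  induction m using Nat.strong_induction_on with
  | _ m ih =>
    have hlt : ∀ m' < (m : ℤ), ∀ u v : ℤ, fcoeff f m' u v M ∈ J := by
      intro m' hm' u v
      rcases lt_or_ge m' 0 with h0 | h0
      · have : fcoeff f m' u v M = 0 := by
          by_contra hne
          exact absurd (fcoeff_ne_zero f hne).1 (not_le.2 h0)
        rw [this]
        exact zero_mem _
      · lift m' to ℕ using h0
        exact ih m' (by exact_mod_cast hm') u v
    intro u v
    by_cases huv : u ∈ Finset.Icc (-(M : ℤ)) M ∧ v ∈ Finset.Icc (-(M : ℤ)) M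
    swap
    · exact fcoeff_mem_of_notMem_Icc hlt huv
    refine mem_of_sum_jets_mem h2 h3 M (fun u v => ⟨fcoeff f m u v M, hO _ _ _ _⟩) ?_
      u huv.1 v huv.2
    intro j hj j' hj'
    have hc := hform j hj j' hj' m
    rw [coeff_jetForm, ← Finset.add_sum_erase _ _ (a := (0, m)) (by simp)] at hc
    rw [J.add_mem_iff_left] at hc
    swap
    · refine sum_mem fun x hx => sum_mem fun y _ => mul_mem_of_mem (hexp _ _ _ _ _) ?_
      obtain ⟨hne, hx⟩ := Finset.mem_erase.1 hx
      have hx := Finset.HasAntidiagonal.mem_antidiagonal.1 hx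
      refine hlt _ ?_ _ _
      have : x.1 ≠ 0 := fun h0 => hne (Prod.ext h0 (by simp; omega))
      omega
    have hsub : Finset.Icc (-(M : ℤ)) M ×ˢ Finset.Icc (-(M : ℤ)) M ⊆ box M m := by
      refine Finset.product_subset_product ?_ ?_ <;>
        exact Finset.Icc_subset_Icc (by omega) (by omega)
    rw [← Finset.sum_sdiff hsub, J.add_mem_iff_right] at hc
    swap
    · refine sum_mem fun y hy => mul_mem_of_mem (hexp _ _ _ _ _)
        (fcoeff_mem_of_notMem_Icc hlt fun hy' => ?_)
      exact (Finset.mem_sdiff.1 hy).2 (Finset.mem_product.2 hy')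
    rw [Finset.sum_product] at hc
    convert hc using 1
    push_cast
    refine Finset.sum_congr rfl fun u _ => Finset.sum_congr rfl fun v _ => ?_
    rw [← Subring.coe_mul, ← map_intJet_mul h2 h3, coeff_map, coeff_zero_eq_constantCoeff_apply]
    rfl

/-- A Sturm bound for Hermitian modular forms over the Gaussian integers. -/
theorem fcoeff_mem_of_le (hk : Even k) (h2 : IsUnit (2 : O)) (h3 : IsUnit (3 : O))
    (hO : ∀ m u v n : ℤ, fcoeff f m u v n ∈ O)
    (h : ∀ m n : ℕ, 8 * m ≤ k → 8 * n ≤ k → ∀ u v : ℤ, fcoeff f m u v n ∈ J) (M : ℕ) :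
    ∀ m u v : ℤ, fcoeff f m u v M ∈ J := by
  induction M using Nat.strong_induction_on with
  | _ M ih =>
    rcases lt_or_ge k (8 * M) with hM | hM
    · refine fcoeff_mem_of_lt h2 h3 hO (N := M) (by omega) fun m hm u v => ?_
      rw [fcoeff_swap f hk]
      exact ih m hm _ _ _
    · exact fcoeff_mem_of_lt h2 h3 hO (N := (k / 8).toNat + 1) (by omega)
        fun m hm u v => h m M (by omega) hM u v

end Arithmetic

section LocalRing

variable {p : ℕ}

/-- The subring of `p`-integral rational numbers in `ℂ`. -/
def pIntegral (hp : p.Prime) : Subring ℂ where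
  carrier := {z | IsPIntegral p z}
  mul_mem' := by
    rintro x y ⟨a, b, hb, hx⟩ ⟨c, d, hd, hy⟩
    refine ⟨a * c, b * d, (Nat.prime_iff_prime_int.1 hp).not_dvd_mul hb hd, ?_⟩
    push_cast
    rw [← hx, ← hy]
    ring
  one_mem' := ⟨1, 1, (Nat.prime_iff_prime_int.1 hp).not_dvd_one, by simp⟩
  add_mem' := by
    rintro x y ⟨a, b, hb, hx⟩ ⟨c, d, hd, hy⟩
    refine ⟨a * d + c * b, b * d, (Nat.prime_iff_prime_int.1 hp).not_dvd_mul hb hd, ?_⟩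
    push_cast
    rw [← hx, ← hy]
    ring
  zero_mem' := ⟨0, 1, (Nat.prime_iff_prime_int.1 hp).not_dvd_one, by simp⟩
  neg_mem' := by
    rintro x ⟨a, b, hb, hx⟩
    refine ⟨-a, b, hb, ?_⟩
    push_cast
    rw [← hx]
    ring

lemma mem_pIntegral {hp : p.Prime} {z : ℂ} : z ∈ pIntegral hp ↔ IsPIntegral p z := Iff.rfl

lemma modCongr_one_zero_iff (hp : p.Prime) {z : ℂ} :
    ModCongr p 1 z 0 ↔ z / p ∈ pIntegral hp := by
  rw [mem_pIntegral, ModCongr, sub_zero, pow_one]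

/-- The complex numbers congruent to zero modulo `p`. -/
def pMultiples (hp : p.Prime) : Submodule (pIntegral hp) ℂ where
  carrier := {z | ModCongr p 1 z 0}
  add_mem' := by
    intro x y hx hy
    refine (modCongr_one_zero_iff hp).2 ?_
    rw [add_div]
    exact add_mem ((modCongr_one_zero_iff hp).1 hx) ((modCongr_one_zero_iff hp).1 hy)
  zero_mem' := by
    refine (modCongr_one_zero_iff hp).2 ?_
    rw [zero_div]
    exact zero_mem _
  smul_mem' := by
    intro c x hx
    refine (modCongr_one_zero_iff hp).2 ?_
    rw [Subring.smul_def, smul_eq_mul, mul_div_assoc]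
    exact mul_mem c.2 ((modCongr_one_zero_iff hp).1 hx)

lemma mem_pMultiples {hp : p.Prime} {z : ℂ} : z ∈ pMultiples hp ↔ ModCongr p 1 z 0 := Iff.rfl

lemma isUnit_natCast_pIntegral (hp : p.Prime) {n : ℕ} (hn : 0 < n) (hnp : n < p) :
    IsUnit (n : pIntegral hp) := by
  have hmem : ((n : ℂ)⁻¹) ∈ pIntegral hp := by
    refine ⟨1, n, fun hd => ?_, ?_⟩
    · exact absurd (Nat.le_of_dvd hn (Int.natCast_dvd_natCast.1 hd)) (not_le.2 hnp)
    · rw [Int.cast_natCast, mul_inv_cancel₀ (by exact_mod_cast hn.ne'), Int.cast_one]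
  refine IsUnit.of_mul_eq_one ⟨_, hmem⟩ (Subtype.ext ?_)
  push_cast
  exact mul_inv_cancel₀ (by exact_mod_cast hn.ne')

end LocalRing

lemma hmat_mem_invDiff (u v : ℤ) : ((u : ℂ) + v * I) / 2 ∈ invDiff (-4) := by
  change sqrtD (-4) * _ ∈ ringInt (-4)
  rw [sqrtD_neg_four, mem_ringInt_neg_four]
  refine ⟨-v, u, ?_⟩
  push_cast
  linear_combination (v : ℂ) * I_mul_I

lemma hmat_eq (m u v n : ℤ) : hmat m u v n =
    !![(m : ℂ), ((u : ℂ) + v * I) / 2; (starRingEnd ℂ) (((u : ℂ) + v * I) / 2), (n : ℂ)] := by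
  rw [hmat]
  congr 3
  rw [map_div₀, map_ofNat]
  simp [sub_eq_add_neg]

lemma normSq_offDiag (u v : ℤ) :
    Complex.normSq (((u : ℂ) + v * I) / 2) = ((u : ℝ) ^ 2 + (v : ℝ) ^ 2) / 4 := by
  simp [Complex.normSq_apply]
  ring

end HermitianSturm

open HermitianSturm

/-- **Sturm-type congruence criterion for Hermitian modular forms over ℚ(√-1)**
(Theorem 1.1, case `K = ℚ(√-1)`, `d_K = -4`). If a symmetric Hermitian modular
form of even weight `k` with `p`-integral Fourier coefficients has
`a_f([[m, α], [ᾱ, n]]) ≡ 0 (mod p)` for all `0 ≤ m ≤ (5k+8)/40`,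
`0 ≤ n ≤ (15k+4)/120`, `α ∈ D_K⁻¹` with `mn - N(α) ≥ 0`, then all its Fourier
coefficients are `≡ 0 (mod p)`. -/
theorem congruence_criterion_sqrt_neg_one
    (p : ℕ) (hp : Nat.Prime p) (hp5 : 5 ≤ p) (k : ℤ) (hk : Even k)
    (f : HermitianModularForm (-4) k) (hsym : IsSymmetricHMF f)
    (hint : ∀ H, IsPIntegral p (f.coeff H))
    (hcong : ∀ (m n : ℤ) (α : ℂ), α ∈ invDiff (-4) →
      0 ≤ m → 40 * m ≤ 5 * k + 8 → 0 ≤ n → 120 * n ≤ 15 * k + 4 →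
      Complex.normSq α ≤ (m : ℝ) * (n : ℝ) →
      ModCongr p 1 (f.coeff !![(m : ℂ), α; (starRingEnd ℂ) α, (n : ℂ)]) 0) :
    ∀ H ∈ HermLattice (-4), ModCongr p 1 (f.coeff H) 0 := by
  intro H hH
  obtain ⟨m, u, v, n, rfl, -, hn, -⟩ := exists_hmat hH
  lift n to ℕ using hn
  refine fcoeff_mem_of_le (f := f) (O := pIntegral hp) (J := pMultiples hp) hk
    (isUnit_natCast_pIntegral hp (n := 2) (by omega) (by omega))
    (isUnit_natCast_pIntegral hp (n := 3) (by omega) (by omega))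
    (fun _ _ _ _ => hint _) (fun m n hm hn u v => ?_) n m u v
  by_cases h0 : fcoeff f m u v n = 0
  · rw [h0]
    exact zero_mem _
  obtain ⟨-, -, hle⟩ := fcoeff_ne_zero f h0
  rw [mem_pMultiples, fcoeff, hmat_eq]
  refine hcong m n _ (hmat_mem_invDiff u v) (by omega) (by omega) (by omega) (by omega) ?_
  rw [normSq_offDiag]
  have : (u : ℝ) ^ 2 + (v : ℝ) ^ 2 ≤ 4 * (((m : ℤ) : ℝ) * ((n : ℤ) : ℝ)) := by exact_mod_cast hle
  linarith

end
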